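/- arXiv:1302.4804 — 2 statements merged into one kernel-verified Lean document; each statement's English description precedes it below -/
import Mathlib

section
/- Let Λ be a semi-stable net of quadrics in a,b,c,d,e with basis (Q1,Q2,Q3), and let I=(Q1,Q2,Q3) ⊆ ℂ[a,b,c,d,e] be the ideal it generates. Then (i) every minimal prime over I has height 3 (so the subscheme of ℙ⁴ cut out by the net is purely one-dimensional), and (ii) the common zero locus of Q1,Q2,Q3 in ℂ⁵ ∖ {0} is a connected topological space in the Zariski topology (so the corresponding curve in ℙ⁴ is connected). -/
open MvPolynomial

/-- The space of polynomials in the five variables `a,b,c,d,e` (indexed `0,…,4`). -/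
abbrev Quin : Type := MvPolynomial (Fin 5) ℂ

/-- `m` is (the exponent vector of) a quadratic monomial. -/
def QuadMon (m : Fin 5 →₀ ℕ) : Prop := (m.sum fun _ n => n) = 2

/-- A net of quadrics: a 3-dimensional space of quadratic forms. -/
def IsNet (Λ : Submodule ℂ Quin) : Prop :=
  Module.finrank ℂ Λ = 3 ∧ ∀ Q ∈ Λ, MvPolynomial.IsHomogeneous Q 2

/-- The `ρ`-weight of a monomial. -/
def wt (ρ : Fin 5 → ℤ) (m : Fin 5 →₀ ℕ) : ℤ := ∑ i, (m i : ℤ) * ρ i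

/-- `Λ` is semistable with respect to the weight vector `ρ`: there are three distinct
quadratic monomials with total `ρ`-weight `≥ 0` such that the corresponding coefficient
map `Λ → ℂ³` is bijective. -/
def SemistableWrt (Λ : Submodule ℂ Quin) (ρ : Fin 5 → ℤ) : Prop :=
  ∃ m1 m2 m3 : Fin 5 →₀ ℕ, m1 ≠ m2 ∧ m1 ≠ m3 ∧ m2 ≠ m3 ∧
    QuadMon m1 ∧ QuadMon m2 ∧ QuadMon m3 ∧
    0 ≤ wt ρ m1 + wt ρ m2 + wt ρ m3 ∧
    Function.Bijective (fun Q : Λ =>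
      (![MvPolynomial.coeff m1 (Q : Quin), MvPolynomial.coeff m2 (Q : Quin),
         MvPolynomial.coeff m3 (Q : Quin)] : Fin 3 → ℂ))

/-- The twelve distinguished weight vectors `ρ1,…,ρ12`. -/
def rho : Fin 12 → Fin 5 → ℤ :=
  ![![1,1,1,1,-4], ![2,2,2,-3,-3], ![3,3,-2,-2,-2], ![4,-1,-1,-1,-1],
    ![3,3,3,-2,-7], ![4,4,-1,-1,-6], ![9,4,-1,-6,-6], ![7,2,2,-3,-8],
    ![12,7,2,-8,-13], ![9,4,-1,-1,-11], ![14,4,-1,-6,-11], ![13,8,3,-7,-17]]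

/-- A normalized weight vector: nonincreasing, sums to zero and not identically zero. -/
def IsNormalized (ρ : Fin 5 → ℤ) : Prop :=
  (∀ i j : Fin 5, i ≤ j → ρ j ≤ ρ i) ∧ (∑ i, ρ i) = 0 ∧ ρ ≠ 0

/-- Linear substitution of variables by the matrix `g`, as a linear map on polynomials. -/
noncomputable def substMap (g : Matrix (Fin 5) (Fin 5) ℂ) : Quin →ₗ[ℂ] Quin :=
  (MvPolynomial.aeval fun i => ∑ j, MvPolynomial.C (g i j) * MvPolynomial.X j).toLinearMap

/-- Semistability of a net (Hilbert–Mumford criterion for `SL(5)`). -/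
def Semistable (Λ : Submodule ℂ Quin) : Prop :=
  ∀ (g : Matrix.GeneralLinearGroup (Fin 5) ℂ) (ρ : Fin 5 → ℤ), IsNormalized ρ →
    SemistableWrt (Submodule.map (substMap (g : Matrix (Fin 5) (Fin 5) ℂ)) Λ) ρ

/-- The symmetric matrix of a quadratic form. -/
noncomputable def quadMatrix (Q : Quin) : Matrix (Fin 5) (Fin 5) ℂ :=
  Matrix.of fun i j =>
    if i = j then MvPolynomial.coeff (Finsupp.single i 2) Q
    else (1/2) * MvPolynomial.coeff (Finsupp.single i 1 + Finsupp.single j 1) Q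

/-- The discriminant quintic `det (x·A1 + y·A2 + z·A3)` of a net with basis `Q1,Q2,Q3`. -/
noncomputable def netDisc (Q1 Q2 Q3 : Quin) : MvPolynomial (Fin 3) ℂ :=
  Matrix.det (Matrix.of fun i j : Fin 5 =>
    MvPolynomial.C (quadMatrix Q1 i j) * MvPolynomial.X 0 +
    MvPolynomial.C (quadMatrix Q2 i j) * MvPolynomial.X 1 +
    MvPolynomial.C (quadMatrix Q3 i j) * MvPolynomial.X 2)

/-- The net lies on a smooth quartic del Pezzo surface. -/
def OnSmoothDelPezzo (Λ : Submodule ℂ Quin) : Prop :=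
  ∃ P1 P2 : Quin, P1 ∈ Λ ∧ P2 ∈ Λ ∧ LinearIndependent ℂ ![P1, P2] ∧
    ∀ v : Fin 5 → ℂ, v ≠ 0 → MvPolynomial.eval v P1 = 0 → MvPolynomial.eval v P2 = 0 →
      LinearIndependent ℂ
        ![fun i => MvPolynomial.eval v (MvPolynomial.pderiv i P1),
          fun i => MvPolynomial.eval v (MvPolynomial.pderiv i P2)]

/-- The Zariski topology on `ℂ⁵`, generated by the basic open sets `{v | p(v) ≠ 0}`. -/
def zariski5 : TopologicalSpace (Fin 5 → ℂ) :=
  TopologicalSpace.generateFrom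
    {u : Set (Fin 5 → ℂ) | ∃ p : Quin, u = {v | MvPolynomial.eval v p ≠ 0}}

section Depth

variable {A : Type*} [CommRing A]

/-- `x` is a nonzerodivisor on `A ⧸ J`. -/
def RegMod (J : Ideal A) (x : A) : Prop := ∀ a, x * a ∈ J → a ∈ J

/-- No nonzero element of `A ⧸ J` is killed by `m`. -/
def NoSocle (m J : Ideal A) : Prop := ∀ u, (∀ t ∈ m, t * u ∈ J) → u ∈ J

/-- There is an `A ⧸ J`-regular sequence of length `n` in `m`. -/
def DepthGE (m : Ideal A) : ℕ → Ideal A → Prop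
  | 0, _ => True
  | n + 1, J => ∃ x ∈ m, RegMod J x ∧ DepthGE m n (J ⊔ Ideal.span {x})

lemma mem_sup_span_iff {J : Ideal A} {x a : A} :
    a ∈ J ⊔ Ideal.span {x} ↔ ∃ j ∈ J, ∃ b, a = j + x * b := by
  rw [Submodule.mem_sup]
  constructor
  · rintro ⟨j, hj, z, hz, rfl⟩
    obtain ⟨b, rfl⟩ := Ideal.mem_span_singleton'.1 hz
    exact ⟨j, hj, b, by ring⟩
  · rintro ⟨j, hj, b, rfl⟩
    exact ⟨j, hj, x * b, Ideal.mul_mem_right _ _ (Ideal.mem_span_singleton_self x), rfl⟩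

lemma RegMod.noSocle {m J : Ideal A} {x : A} (hx : x ∈ m) (h : RegMod J x) : NoSocle m J :=
  fun u hu => h u (hu x hx)

lemma NoSocle.transfer {m J : Ideal A} {x y : A} (hx : x ∈ m)
    (hxJ : RegMod J x) (hyJ : RegMod J y) (hs : NoSocle m (J ⊔ Ideal.span {x})) :
    NoSocle m (J ⊔ Ideal.span {y}) := by
  intro u hu
  obtain ⟨j, hj, v, hv⟩ := mem_sup_span_iff.1 (hu x hx)
  have hvx : v ∈ J ⊔ Ideal.span {x} := by
    apply hs
    intro t ht
    obtain ⟨j', hj', w, hw⟩ := mem_sup_span_iff.1 (hu t ht)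
    have h1 : y * (t * v - x * w) ∈ J := by
      have : y * (t * v - x * w) = x * j' - t * j := by linear_combination x * hw - t * hv
      rw [this]
      exact J.sub_mem (J.mul_mem_left _ hj') (J.mul_mem_left _ hj)
    exact mem_sup_span_iff.2 ⟨_, hyJ _ h1, w, by ring⟩
  obtain ⟨j'', hj'', s, hs'⟩ := mem_sup_span_iff.1 hvx
  have h2 : x * (u - y * s) ∈ J := by
    have : x * (u - y * s) = j + y * j'' := by linear_combination hv + y * hs'
    rw [this]
    exact J.add_mem hj (J.mul_mem_left _ hj'')
  exact mem_sup_span_iff.2 ⟨_, hxJ _ h2, s, by ring⟩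

lemma RegMod.swap {J : Ideal A} {x z : A} (hx : RegMod J x)
    (hz : RegMod (J ⊔ Ideal.span {x}) z) : RegMod (J ⊔ Ideal.span {z}) x := by
  intro a ha
  obtain ⟨j, hj, b, hb⟩ := mem_sup_span_iff.1 ha
  have h1 : z * b ∈ J ⊔ Ideal.span {x} :=
    mem_sup_span_iff.2 ⟨-j, J.neg_mem hj, a, by linear_combination -hb⟩
  obtain ⟨j', hj', c, hc⟩ := mem_sup_span_iff.1 (hz _ h1)
  have h2 : x * (a - z * c) ∈ J := by
    have : x * (a - z * c) = j + z * j' := by linear_combination hb + z * hc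
    rw [this]
    exact J.add_mem hj (J.mul_mem_left _ hj')
  exact mem_sup_span_iff.2 ⟨_, hx _ h2, c, by ring⟩

/-- `p` is the annihilator of an element of `A ⧸ J`. -/
def IsAssoc (J p : Ideal A) : Prop := p.IsPrime ∧ ∃ w, ∀ a, a ∈ p ↔ a * w ∈ J

lemma isAssoc_iff [IsNoetherianRing A] {J p : Ideal A} :
    p ∈ associatedPrimes A (A ⧸ J) ↔ IsAssoc J p := by
  rw [AssociatedPrimes.mem_iff, isAssociatedPrime_iff]
  refine and_congr_right fun _ => ?_
  have key : ∀ w a : A, a ∈ (⊥ : Submodule A (A ⧸ J)).colon {Ideal.Quotient.mk J w} ↔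
      a * w ∈ J := by
    intro w a
    rw [Submodule.mem_colon_singleton, Submodule.mem_bot, ← Ideal.Quotient.eq_zero_iff_mem,
      map_mul]
    rfl
  constructor
  · rintro ⟨x, rfl⟩
    obtain ⟨w, rfl⟩ := Ideal.Quotient.mk_surjective x
    exact ⟨w, key w⟩
  · rintro ⟨w, hw⟩
    exact ⟨Ideal.Quotient.mk J w, by ext a; rw [hw, key]⟩

lemma exists_isAssoc [IsNoetherianRing A] {J : Ideal A} {u : A} (hu : u ∉ J) :
    ∃ p, IsAssoc J p ∧ ∀ a, a * u ∈ J → a ∈ p := by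
  obtain ⟨p, hp, h⟩ := exists_le_isAssociatedPrime_of_isNoetherianRing A
    (Ideal.Quotient.mk J u) (by rwa [Ne, Ideal.Quotient.eq_zero_iff_mem])
  refine ⟨p, isAssoc_iff.1 hp, fun a ha => h ?_⟩
  rw [Submodule.mem_colon_singleton, Submodule.mem_bot]
  have := Ideal.Quotient.eq_zero_iff_mem.2 ha
  rwa [map_mul] at this

lemma exists_isAssoc_of_not_regMod [IsNoetherianRing A] {J : Ideal A} {x : A}
    (hx : ¬ RegMod J x) : ∃ p, IsAssoc J p ∧ x ∈ p := by
  simp only [RegMod, not_forall] at hx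
  obtain ⟨a, ha, ha'⟩ := hx
  obtain ⟨p, hp, h⟩ := exists_isAssoc ha'
  exact ⟨p, hp, h x ha⟩

lemma exists_regMod [IsNoetherianRing A] {m : Ideal A} [m.IsMaximal] {ι : Type*} [Finite ι]
    (J : ι → Ideal A) (hJ : ∀ i, NoSocle m (J i)) {K : Ideal A} {N : ℕ} (hK : m ^ N ≤ K) :
    ∃ z ∈ K, ∀ i, RegMod (J i) z := by
  classical
  by_contra! hcon
  have hfin : (⋃ i, associatedPrimes A (A ⧸ J i)).Finite :=
    Set.finite_iUnion fun i => associatedPrimes.finite A (A ⧸ J i)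
  have hsub : (K : Set A) ⊆ ⋃ p ∈ (↑hfin.toFinset : Set (Ideal A)), ((id p : Ideal A) : Set A) := by
    intro z hz
    obtain ⟨i, hi⟩ := hcon z hz
    obtain ⟨p, hp, hzp⟩ := exists_isAssoc_of_not_regMod hi
    simp only [Set.Finite.coe_toFinset, Set.mem_iUnion]
    exact ⟨p, ⟨i, isAssoc_iff.2 hp⟩, hzp⟩
  rw [Ideal.subset_union_prime ⊥ ⊥] at hsub
  · obtain ⟨p, hp, hKp⟩ := hsub
    simp only [Set.Finite.mem_toFinset, Set.mem_iUnion] at hp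
    obtain ⟨i, hi⟩ := hp
    obtain ⟨hpp, w, hw⟩ := isAssoc_iff.1 hi
    have hmp : m ≤ p := hpp.le_of_pow_le (hK.trans hKp)
    have hw' := hJ i w fun t ht => (hw t).1 (hmp ht)
    exact hpp.ne_top ((Ideal.eq_top_iff_one _).2 ((hw 1).2 (by simpa using hw')))
  · intro p hp _ _
    simp only [Set.Finite.mem_toFinset, Set.mem_iUnion] at hp
    obtain ⟨i, hi⟩ := hp
    exact (isAssoc_iff.1 hi).1

lemma DepthGE.noSocle {m J : Ideal A} {n : ℕ} (h : DepthGE m (n + 1) J) : NoSocle m J := by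
  obtain ⟨x, hx, hr, -⟩ := h
  exact hr.noSocle hx

lemma DepthGE.drop [IsNoetherianRing A] {m : Ideal A} [m.IsMaximal] {n : ℕ} {J : Ideal A}
    (h : DepthGE m (n + 1) J) {y : A} (hy : y ∈ m) (hyJ : RegMod J y) :
    DepthGE m n (J ⊔ Ideal.span {y}) := by
  induction n generalizing J y with
  | zero => trivial
  | succ n ih =>
    obtain ⟨x, hx, hxJ, hd⟩ := h
    obtain ⟨z, hz, hzr⟩ := exists_regMod (m := m) (N := 1)
      ![J, J ⊔ Ideal.span {x}, J ⊔ Ideal.span {y}] (by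
        intro i
        fin_cases i
        · exact hxJ.noSocle hx
        · exact hd.noSocle
        · exact hd.noSocle.transfer hx hxJ hyJ) (K := m) (by simp)
    have hz0 : RegMod J z := hzr 0
    have hz1 : RegMod (J ⊔ Ideal.span {x}) z := hzr 1
    have hz2 : RegMod (J ⊔ Ideal.span {y}) z := hzr 2
    have h1 := ih hd hz hz1
    rw [sup_right_comm] at h1
    have h2 : DepthGE m (n + 1) (J ⊔ Ideal.span {z}) := ⟨x, hx, hxJ.swap hz1, h1⟩
    have h3 := ih h2 hy (hyJ.swap hz2)
    rw [sup_right_comm] at h3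
    exact ⟨z, hz, hz2, h3⟩

lemma DepthGE.le_coheight [IsNoetherianRing A] [IsLocalRing A] {n : ℕ} {J : Ideal A}
    (h : DepthGE (IsLocalRing.maximalIdeal A) n J) {p : Ideal A} (hp : IsAssoc J p) :
    (n : ℕ∞) ≤ Order.coheight (⟨p, hp.1⟩ : PrimeSpectrum A) := by
  induction n generalizing J p with
  | zero => simp
  | succ n ih =>
    obtain ⟨x, hx, hxJ, hd⟩ := h
    obtain ⟨hpp, u, hu⟩ := hp
    have huJ : u ∉ J := fun hc =>
      hpp.ne_top ((Ideal.eq_top_iff_one _).2 ((hu 1).2 (by simpa using hc)))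
    let Γ : Ideal A :=
      { carrier := {w | ∀ a ∈ p, a * w ∈ J}
        add_mem' := fun {v w} hv hw a ha => by
          rw [mul_add]; exact J.add_mem (hv a ha) (hw a ha)
        zero_mem' := fun a _ => by simp
        smul_mem' := fun c w hw a ha => by
          rw [smul_eq_mul, mul_left_comm]; exact J.mul_mem_left _ (hw a ha) }
    have hΓ : ¬ Γ ≤ J ⊔ Ideal.span {x} := by
      intro hle
      have : Γ ≤ J := by
        refine Submodule.le_of_le_smul_of_le_jacobson_bot (I := IsLocalRing.maximalIdeal A)
          (IsNoetherian.noetherian Γ) (IsLocalRing.maximalIdeal_le_jacobson _) ?_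
        intro w hw
        obtain ⟨j, hj, v, hv⟩ := mem_sup_span_iff.1 (hle hw)
        have hvΓ : v ∈ Γ := by
          intro a ha
          apply hxJ
          have : x * (a * v) = a * w - a * j := by rw [hv]; ring
          rw [this]
          exact J.sub_mem (hw a ha) (J.mul_mem_left _ hj)
        rw [hv]
        exact Submodule.add_mem_sup hj (Submodule.smul_mem_smul hx hvΓ)
      exact huJ (this fun a ha => (hu a).1 ha)
    obtain ⟨w, hw, hwJ⟩ := SetLike.not_le_iff_exists.1 hΓ
    obtain ⟨p', hp', hann⟩ := exists_isAssoc hwJ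
    have hpp' : p ≤ p' := fun a ha => hann a (Ideal.mem_sup_left (hw a ha))
    have hxp' : x ∈ p' := hann x (Ideal.mem_sup_right
      (Ideal.mul_mem_right _ _ (Ideal.mem_span_singleton_self x)))
    have hxp : x ∉ p := fun hc => huJ (hxJ u ((hu x).1 hc))
    have hlt : (⟨p, hpp⟩ : PrimeSpectrum A) < ⟨p', hp'.1⟩ :=
      lt_of_le_not_ge hpp' fun hc => hxp (hc hxp')
    have h1 := ih hd hp'
    have h2 := Order.coheight_add_one_le hlt
    push_cast
    exact (add_le_add_left h1 1).trans h2

variable {B : Type*} [CommRing B] [Algebra A B]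

lemma RegMod.map (M : Submonoid A) [IsLocalization M B] {J : Ideal A} {x : A}
    (h : RegMod J x) : RegMod (J.map (algebraMap A B)) (algebraMap A B x) := by
  intro a ha
  obtain ⟨r, s, rfl⟩ := IsLocalization.exists_mk'_eq M a
  rw [← IsLocalization.mk'_mul_cancel_left (S := B) x (1 : M)] at ha
  simp only [OneMemClass.coe_one, one_mul] at ha
  rw [← IsLocalization.mk'_mul, IsLocalization.mk'_mem_map_algebraMap_iff] at ha
  rw [IsLocalization.mk'_mem_map_algebraMap_iff]
  obtain ⟨t, ht, h1⟩ := ha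
  exact ⟨t, ht, h _ (by rwa [mul_left_comm])⟩

lemma DepthGE.map (M : Submonoid A) [IsLocalization M B] {m J : Ideal A} {n : ℕ}
    (h : DepthGE m n J) :
    DepthGE (m.map (algebraMap A B)) n (J.map (algebraMap A B)) := by
  induction n generalizing J with
  | zero => trivial
  | succ n ih =>
    obtain ⟨x, hx, hr, hd⟩ := h
    refine ⟨algebraMap A B x, Ideal.mem_map_of_mem _ hx, hr.map M, ?_⟩
    have := ih hd
    rwa [Ideal.map_sup, Ideal.map_span, Set.image_singleton] at this

lemma IsAssoc.map (M : Submonoid A) [IsLocalization M B] {J p : Ideal A}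
    (h : IsAssoc J p) (hM : Disjoint (M : Set A) p) :
    IsAssoc (J.map (algebraMap A B)) (p.map (algebraMap A B)) := by
  obtain ⟨hp, w, hw⟩ := h
  refine ⟨IsLocalization.isPrime_of_isPrime_disjoint M B p hp hM, algebraMap A B w, fun a => ?_⟩
  obtain ⟨r, s, rfl⟩ := IsLocalization.exists_mk'_eq M a
  rw [← IsLocalization.mk'_one (M := M) B w, ← IsLocalization.mk'_mul,
    IsLocalization.mk'_mem_map_algebraMap_iff, IsLocalization.mk'_mem_map_algebraMap_iff]
  refine exists_congr fun t => and_congr_right fun _ => ?_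
  rw [← mul_assoc, hw]

end Depth

/-- The irrelevant maximal ideal of `ℂ[a,b,c,d,e]`. -/
noncomputable def irr : Ideal Quin := RingHom.ker (constantCoeff (R := ℂ) (σ := Fin 5))

lemma mem_irr {p : Quin} : p ∈ irr ↔ constantCoeff p = 0 := RingHom.mem_ker

instance irr_isMaximal : irr.IsMaximal :=
  RingHom.ker_isMaximal_of_surjective _ fun c => ⟨C c, by simp⟩

lemma X_mem_irr (i : Fin 5) : (X i : Quin) ∈ irr := by simp [mem_irr]

lemma regMod_X {s : Set (Fin 5)} {i : Fin 5} (hi : i ∉ s) :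
    RegMod (Ideal.span ((X : Fin 5 → Quin) '' s)) (X i) := by
  intro a ha
  rw [mem_ideal_span_X_image] at ha ⊢
  intro m hm
  obtain ⟨j, hj, hmj⟩ := ha (Finsupp.single i 1 + m) (by
    rw [mem_support_iff, coeff_X_mul]
    exact mem_support_iff.1 hm)
  refine ⟨j, hj, ?_⟩
  have hij : i ≠ j := fun h => hi (h ▸ hj)
  simpa [Finsupp.single_apply, hij] using hmj

lemma depthGE_vars (n : ℕ) (hn : n ≤ 5) :
    DepthGE irr n (Ideal.span ((X : Fin 5 → Quin) '' {i | n ≤ (i : ℕ)})) := by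
  induction n with
  | zero => trivial
  | succ n ih =>
    refine ⟨X ⟨n, by omega⟩, X_mem_irr _, regMod_X (by simp), ?_⟩
    rw [← Ideal.span_union, ← Set.image_singleton, ← Set.image_union]
    convert ih (by omega) using 4
    ext i
    simp only [Set.mem_union, Set.mem_ofPred_eq, Set.mem_singleton_iff, Fin.ext_iff]
    omega

lemma depthGE_bot : DepthGE irr 5 (⊥ : Ideal Quin) := by
  have h := depthGE_vars 5 le_rfl
  have : {i : Fin 5 | 5 ≤ (i : ℕ)} = ∅ := by ext i; simp
  rwa [this, Set.image_empty, Ideal.span_empty] at h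

lemma depthGE_span_pair {P Q : Quin} (hP : P ∈ irr) (hQ : Q ∈ irr) (hP0 : P ≠ 0)
    (hrel : IsRelPrime P Q) : DepthGE irr 3 (Ideal.span {P, Q}) := by
  have h1 := depthGE_bot.drop hP (fun a ha => by simpa [hP0] using ha)
  have h2 := h1.drop hQ (y := Q) (fun a ha => by
    rw [bot_sup_eq, Ideal.mem_span_singleton] at ha ⊢
    exact hrel.dvd_of_dvd_mul_left ha)
  rwa [bot_sup_eq, ← Ideal.span_union, Set.singleton_union] at h2

/-- The local ring of `ℂ⁵` at the origin. -/
abbrev LocQuin : Type := Localization.AtPrime irr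

lemma map_irr : irr.map (algebraMap Quin LocQuin) = IsLocalRing.maximalIdeal LocQuin :=
  Localization.AtPrime.map_eq_maximalIdeal

lemma le_coheight_comap (p : PrimeSpectrum LocQuin) :
    Order.coheight p ≤ Order.coheight (PrimeSpectrum.comap (algebraMap Quin LocQuin) p) :=
  Order.coheight_le_coheight_apply_of_strictMono _
    (Monotone.strictMono_of_injective
      (f := PrimeSpectrum.comap (algebraMap Quin LocQuin)) (fun _ _ h => Ideal.comap_mono h)
      (PrimeSpectrum.localization_comap_injective LocQuin irr.primeCompl)) _

lemma le_coheight_of_isAssoc {n : ℕ} {J P : Ideal Quin} (hd : DepthGE irr n J)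
    (hP : IsAssoc J P) (hPm : P ≤ irr) :
    (n : ℕ∞) ≤ Order.coheight (⟨P, hP.1⟩ : PrimeSpectrum Quin) := by
  have hdis : Disjoint (irr.primeCompl : Set Quin) P :=
    Set.disjoint_left.2 fun x hx hxP => hx (hPm hxP)
  have h1 := hd.map (B := LocQuin) irr.primeCompl
  rw [map_irr] at h1
  have h2 := h1.le_coheight (hP.map irr.primeCompl hdis)
  refine (h2.trans (le_coheight_comap _)).trans_eq ?_
  congr 1
  ext1
  exact IsLocalization.under_map_of_isPrime_disjoint irr.primeCompl LocQuin hP.1 hdis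

lemma height_add_coheight_le (P : PrimeSpectrum Quin) :
    Order.height P + Order.coheight P ≤ 5 := by
  have h := Order.krullDim_eq_iSup_height_add_coheight_of_nonempty (α := PrimeSpectrum Quin)
  have h5 : ringKrullDim Quin = 5 := by
    rw [MvPolynomial.ringKrullDim_of_isNoetherianRing, ringKrullDim_eq_zero_of_field]
    simp
  rw [ringKrullDim, h] at h5
  have h6 := le_iSup (fun a : PrimeSpectrum Quin => Order.height a + Order.coheight a) P
  have : ((⨆ a : PrimeSpectrum Quin, (Order.height a + Order.coheight a) : ℕ∞) : WithBot ℕ∞)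
    = ((5 : ℕ∞) : WithBot ℕ∞) := h5
  rw [WithBot.coe_inj] at this
  exact h6.trans_eq this

lemma isAssoc_of_mem_minimalPrimes {A : Type*} [CommRing A] [IsNoetherianRing A] {J P : Ideal A}
    (h : P ∈ J.minimalPrimes) : IsAssoc J P := by
  rw [← isAssoc_iff]
  apply Module.associatedPrimes.minimalPrimes_annihilator_subset_associatedPrimes
  rwa [Ideal.annihilator_quotient]

/-- The linear form with coefficient vector `h`. -/
noncomputable def lin : (Fin 5 → ℂ) →ₗ[ℂ] Quin where
  toFun h := ∑ i, C (h i) * X i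
  map_add' h k := by simp [add_mul, Finset.sum_add_distrib]
  map_smul' c h := by simp [Finset.mul_sum, mul_assoc, smul_eq_C_mul]

lemma lin_apply (h : Fin 5 → ℂ) : lin h = ∑ i, C (h i) * X i := rfl

lemma lin_single (i : Fin 5) : lin (Pi.single i 1) = X i := by
  rw [lin_apply, Finset.sum_eq_single i] <;> simp +contextual

/-- Linear substitution as an algebra homomorphism. -/
noncomputable def substHom (g : Matrix (Fin 5) (Fin 5) ℂ) : Quin →ₐ[ℂ] Quin :=
  MvPolynomial.aeval fun i => ∑ j, C (g i j) * X j

lemma substMap_apply (g : Matrix (Fin 5) (Fin 5) ℂ) (p : Quin) :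
    substMap g p = substHom g p := rfl

lemma substHom_X (g : Matrix (Fin 5) (Fin 5) ℂ) (i : Fin 5) : substHom g (X i) = lin (g i) := by
  rw [substHom, aeval_X, lin_apply]

lemma substHom_lin (g : Matrix (Fin 5) (Fin 5) ℂ) (h : Fin 5 → ℂ) :
    substHom g (lin h) = lin (Matrix.vecMul h g) := by
  have : Matrix.vecMul h g = ∑ i, h i • g i := by
    ext j
    simp [Matrix.vecMul, dotProduct]
  rw [this, map_sum, lin_apply, map_sum]
  refine Finset.sum_congr rfl fun i _ => ?_
  rw [map_mul, substHom_X, map_smul, smul_eq_C_mul]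
  congr 1
  exact algHom_C _ _

lemma substHom_comp (g h : Matrix (Fin 5) (Fin 5) ℂ) (p : Quin) :
    substHom g (substHom h p) = substHom (h * g) p := by
  have : (substHom g).comp (substHom h) = substHom (h * g) := by
    refine algHom_ext fun i => ?_
    rw [AlgHom.comp_apply, substHom_X, substHom_X, substHom_lin]
    rfl
  exact DFunLike.congr_fun this p

lemma substHom_one (p : Quin) : substHom 1 p = p := by
  have : substHom 1 = AlgHom.id ℂ Quin := by
    refine algHom_ext fun i => ?_
    rw [substHom_X, AlgHom.id_apply, ← lin_single]
    congr 1
    ext j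
    simp [Matrix.one_apply, Pi.single_apply, eq_comm]
  rw [this]; rfl

lemma Semistable.map {Λ : Submodule ℂ Quin} (h : Semistable Λ)
    (g : Matrix.GeneralLinearGroup (Fin 5) ℂ) :
    Semistable (Λ.map (substMap (g : Matrix (Fin 5) (Fin 5) ℂ))) := by
  intro g' ρ hρ
  have e : (substMap (g' : Matrix (Fin 5) (Fin 5) ℂ)).comp
      (substMap (g : Matrix (Fin 5) (Fin 5) ℂ)) =
      substMap ((g * g' : Matrix.GeneralLinearGroup (Fin 5) ℂ) : Matrix (Fin 5) (Fin 5) ℂ) :=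
    LinearMap.ext fun p => substHom_comp _ _ p
  rw [← Submodule.map_comp, e]
  exact h (g * g') ρ hρ

/-- A basis of linear forms whose last members span a given space. -/
lemma exists_adapted_basis (U : Submodule ℂ (Fin 5 → ℂ)) {k : ℕ} (hk : Module.finrank ℂ U ≤ k) :
    ∃ b : Module.Basis (Fin 5) ℂ (Fin 5 → ℂ),
      U ≤ Submodule.span ℂ (b '' {i | 5 ≤ (i : ℕ) + k}) := by
  obtain ⟨W, hW⟩ := U.exists_isCompl
  have hsum := Submodule.finrank_add_eq_of_isCompl hW
  rw [Module.finrank_fin_fun] at hsum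
  let bU := Module.finBasis ℂ U
  let bW := Module.finBasis ℂ W
  let b0 := (bW.prod bU).map (Submodule.prodEquivOfIsCompl W U hW.symm)
  let e := finSumFinEquiv.trans (finCongr (show Module.finrank ℂ W + Module.finrank ℂ U = 5 by omega))
  refine ⟨b0.reindex e, ?_⟩
  intro u hu
  have h1 := bU.sum_repr ⟨u, hu⟩
  have h2 : u = ∑ i, bU.repr ⟨u, hu⟩ i • (bU i : Fin 5 → ℂ) := by
    have h := congrArg U.subtype h1
    rw [map_sum] at h
    exact h.symm
  rw [h2]
  refine Submodule.sum_mem _ fun i _ => Submodule.smul_mem _ _ (Submodule.subset_span ?_)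
  refine ⟨e (Sum.inr i), ?_, ?_⟩
  · simp [e]
    omega
  · simp [b0]

lemma exists_subst (b : Module.Basis (Fin 5) ℂ (Fin 5 → ℂ)) :
    ∃ g : Matrix.GeneralLinearGroup (Fin 5) ℂ,
      ∀ i, substHom (g : Matrix (Fin 5) (Fin 5) ℂ) (lin (b i)) = X i := by
  have hB : LinearIndependent ℂ (Matrix.of b).row := b.linearIndependent
  have hu : IsUnit (Matrix.of b) := Matrix.linearIndependent_rows_iff_isUnit.1 hB
  refine ⟨hu.unit⁻¹, fun i => ?_⟩
  rw [substHom_lin, ← lin_single]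
  congr 1
  have h1 : Matrix.of b * ((hu.unit⁻¹ : Matrix.GeneralLinearGroup (Fin 5) ℂ) :
      Matrix (Fin 5) (Fin 5) ℂ) = 1 := by
    have := Units.mul_inv hu.unit
    rwa [IsUnit.unit_spec] at this
  have h2 := congrFun h1 i
  ext j
  have := congrFun h2 j
  rw [Matrix.one_apply] at this
  rw [Pi.single_apply]
  simp only [eq_comm (a := j)]
  rw [← this]
  rfl

/-- The ideal generated by a space of linear forms. -/
noncomputable def linIdeal (U : Submodule ℂ (Fin 5 → ℂ)) : Ideal Quin :=
  Ideal.span (lin '' U)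

lemma lin_mem_linIdeal {U : Submodule ℂ (Fin 5 → ℂ)} {h : Fin 5 → ℂ} (hh : h ∈ U) :
    lin h ∈ linIdeal U := Ideal.subset_span ⟨h, hh, rfl⟩

lemma substHom_lin_mem {b : Module.Basis (Fin 5) ℂ (Fin 5 → ℂ)} {g : Matrix (Fin 5) (Fin 5) ℂ}
    (hg : ∀ i, substHom g (lin (b i)) = X i) {s : Set (Fin 5)} {u : Fin 5 → ℂ}
    (hu : u ∈ Submodule.span ℂ (b '' s)) :
    substHom g (lin u) ∈ Ideal.span ((X : Fin 5 → Quin) '' s) := by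
  induction hu using Submodule.span_induction with
  | mem x hx =>
    obtain ⟨i, hi, rfl⟩ := hx
    rw [hg]
    exact Ideal.subset_span ⟨i, hi, rfl⟩
  | zero => simp
  | add x y _ _ hx hy => rw [map_add, map_add]; exact Ideal.add_mem _ hx hy
  | smul c x _ hx => rw [map_smul, map_smul, smul_eq_C_mul]; exact Ideal.mul_mem_left _ _ hx

lemma map_linIdeal_le {b : Module.Basis (Fin 5) ℂ (Fin 5 → ℂ)} {g : Matrix (Fin 5) (Fin 5) ℂ}
    (hg : ∀ i, substHom g (lin (b i)) = X i) {s : Set (Fin 5)} {U : Submodule ℂ (Fin 5 → ℂ)}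
    (hU : U ≤ Submodule.span ℂ (b '' s)) :
    (linIdeal U).map (substHom g) ≤ Ideal.span ((X : Fin 5 → Quin) '' s) := by
  rw [linIdeal, Ideal.map_span, Ideal.span_le]
  rintro _ ⟨_, ⟨u, hu, rfl⟩, rfl⟩
  exact substHom_lin_mem hg (hU hu)

lemma coeff_eq_zero_of_mem {s : Set (Fin 5)} {p : Quin}
    (hp : p ∈ Ideal.span ((X : Fin 5 → Quin) '' s)) {m : Fin 5 →₀ ℕ} (hm : ∀ i ∈ s, m i = 0) :
    coeff m p = 0 := by
  by_contra hc
  obtain ⟨i, hi, h⟩ := mem_ideal_span_X_image.1 hp m (mem_support_iff.2 hc)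
  exact h (hm i hi)

lemma coeff_eq_zero_of_mem_sq {s : Finset (Fin 5)} {p : Quin}
    (hp : p ∈ Ideal.span ((X : Fin 5 → Quin) '' s) ^ 2) {m : Fin 5 →₀ ℕ}
    (hm : ∑ i ∈ s, m i ≤ 1) :
    coeff m p = 0 := by
  rw [pow_two] at hp
  induction hp using Submodule.mul_induction_on' with
  | mem_mul_mem f hf g hg =>
    rw [coeff_mul]
    refine Finset.sum_eq_zero fun x hx => ?_
    rw [Finset.HasAntidiagonal.mem_antidiagonal] at hx
    by_contra hc
    obtain ⟨i, hi, h1⟩ := mem_ideal_span_X_image.1 hf x.1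
      (mem_support_iff.2 (left_ne_zero_of_mul hc))
    obtain ⟨j, hj, h2⟩ := mem_ideal_span_X_image.1 hg x.2
      (mem_support_iff.2 (right_ne_zero_of_mul hc))
    have h3 := Finset.single_le_sum (f := fun i => x.1 i) (fun _ _ => Nat.zero_le _) hi
    have h4 := Finset.single_le_sum (f := fun i => x.2 i) (fun _ _ => Nat.zero_le _) hj
    rw [← hx] at hm
    simp only [Finsupp.add_apply, Finset.sum_add_distrib] at hm
    omega
  | add f _ g _ hf hg => rw [coeff_add, hf, hg, add_zero]

lemma Semistable.exists_monomials {Λ : Submodule ℂ Quin} (h : Semistable Λ) (ρ : Fin 5 → ℤ)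
    (hρ : IsNormalized ρ) (g : Matrix.GeneralLinearGroup (Fin 5) ℂ) :
    ∃ m : Fin 3 → Fin 5 →₀ ℕ, (∀ j, ∑ i, m j i = 2) ∧ 0 ≤ wt ρ (m 0) + wt ρ (m 1) + wt ρ (m 2) ∧
      (∀ Q ∈ Λ, (∀ j, coeff (m j) (substHom g Q) = 0) → Q = 0) ∧
      (∀ j, ∃ Q ∈ Λ, coeff (m j) (substHom g Q) ≠ 0) := by
  obtain ⟨m1, m2, m3, -, -, -, h1, h2, h3, hw, hb⟩ := h g ρ hρ
  have hinj : Function.Injective (substHom (g : Matrix (Fin 5) (Fin 5) ℂ)) := by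
    intro p q hpq
    have := congrArg (substHom ((g⁻¹ : Matrix.GeneralLinearGroup (Fin 5) ℂ) :
      Matrix (Fin 5) (Fin 5) ℂ)) hpq
    have h1 : (g : Matrix (Fin 5) (Fin 5) ℂ) * ((g⁻¹ : Matrix.GeneralLinearGroup (Fin 5) ℂ) :
      Matrix (Fin 5) (Fin 5) ℂ) = 1 := Units.mul_inv g
    rwa [substHom_comp, substHom_comp, h1, substHom_one, substHom_one] at this
  refine ⟨![m1, m2, m3], ?_, hw, ?_, ?_⟩
  · have key : ∀ m, QuadMon m → ∑ i, m i = 2 := by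
      intro m hm
      rw [← hm, Finsupp.sum_fintype _ _ (by simp)]
    intro j
    fin_cases j
    · exact key _ h1
    · exact key _ h2
    · exact key _ h3
  · intro Q hQ hj
    have h0 := hb.1 (a₁ := ⟨substHom g Q, Submodule.mem_map_of_mem hQ⟩) (a₂ := 0) (by
      ext j
      have := hj j
      fin_cases j <;> simpa using this)
    have h0' : substHom (g : Matrix (Fin 5) (Fin 5) ℂ) Q = 0 := congrArg Subtype.val h0
    exact hinj (by rw [h0', map_zero])
  · intro j
    obtain ⟨⟨_, Q, hQ, rfl⟩, hc⟩ := hb.2 (fun _ => 1)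
    refine ⟨Q, hQ, ?_⟩
    have := congrFun hc j
    rw [← substMap_apply]
    fin_cases j <;> simp at this ⊢ <;> simp [this]

lemma wt_eq (ρ : Fin 5 → ℤ) (m : Fin 5 →₀ ℕ) :
    wt ρ m = m 0 * ρ 0 + m 1 * ρ 1 + m 2 * ρ 2 + m 3 * ρ 3 + m 4 * ρ 4 := by
  simp [wt, Fin.sum_univ_five]

/-- No pencil in a semistable net has a common linear factor. -/
lemma Semistable.no_linear_factor {Λ : Submodule ℂ Quin} (h : Semistable Λ) {P1 P2 : Quin}
    (h1 : P1 ∈ Λ) (h2 : P2 ∈ Λ) (hli : LinearIndependent ℂ ![P1, P2]) (l : Fin 5 → ℂ)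
    (hl1 : lin l ∣ P1) (hl2 : lin l ∣ P2) : False := by
  obtain ⟨b, hb⟩ := exists_adapted_basis (Submodule.span ℂ {l}) (k := 1)
    ((finrank_span_le_card _).trans (by simp))
  obtain ⟨g, hg⟩ := exists_subst b
  obtain ⟨m, hm, hw, hinj, -⟩ := h.exists_monomials ![1, 1, 1, 1, -4]
    ⟨by decide, by decide, by decide⟩ g
  have hl := substHom_lin_mem hg (hb (Submodule.mem_span_singleton_self l))
  have hz : ∀ P, lin l ∣ P → ∀ j, m j 4 = 0 → coeff (m j) (substHom g P) = 0 := by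
    rintro P ⟨k, rfl⟩ j hj
    refine coeff_eq_zero_of_mem (s := {i | 5 ≤ (i : ℕ) + 1}) ?_ fun i hi => ?_
    · rw [map_mul]
      exact Ideal.mul_mem_right _ _ hl
    · have : i = 4 := by
        rw [Set.mem_ofPred_eq] at hi
        ext; simp; omega
      rwa [this]
  have hj : ∃ j0, ∀ j, j ≠ j0 → m j 4 = 0 := by
    simp only [wt_eq] at hw
    have e0 := hm 0
    have e1 := hm 1
    have e2 := hm 2
    simp only [Fin.sum_univ_five] at e0 e1 e2
    simp at hw
    by_cases c0 : m 0 4 = 0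
    · by_cases c1 : m 1 4 = 0
      · exact ⟨2, fun j hj => by fin_cases j <;> simp_all⟩
      · have c2 : m 2 4 = 0 := by omega
        exact ⟨1, fun j hj => by fin_cases j <;> simp_all⟩
    · have c1 : m 1 4 = 0 := by omega
      have c2 : m 2 4 = 0 := by omega
      exact ⟨0, fun j hj => by fin_cases j <;> simp_all⟩
  obtain ⟨j0, hj0⟩ := hj
  rw [LinearIndependent.pair_iff] at hli
  set α := coeff (m j0) (substHom (g : Matrix (Fin 5) (Fin 5) ℂ) P1) with hα
  set β := coeff (m j0) (substHom (g : Matrix (Fin 5) (Fin 5) ℂ) P2) with hβ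
  have key : ∀ s t : ℂ, s * α + t * β = 0 → s = 0 ∧ t = 0 := by
    intro s t hst
    refine hli s t (hinj _ (Λ.add_mem (Λ.smul_mem _ h1) (Λ.smul_mem _ h2)) fun j => ?_)
    rw [map_add, map_smul, map_smul, coeff_add, coeff_smul, coeff_smul, smul_eq_mul, smul_eq_mul]
    by_cases hjj : j = j0
    · rw [hjj, ← hα, ← hβ, hst]
    · rw [hz _ hl1 _ (hj0 j hjj), hz _ hl2 _ (hj0 j hjj)]; simp
  have k1 := key β (-α) (by ring)
  have k2 := key 1 0 (by rw [neg_eq_zero.1 k1.2]; simp)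
  exact one_ne_zero k2.1

/-- The base locus of a semistable net contains no plane. -/
lemma Semistable.not_le_linIdeal {Λ : Submodule ℂ Quin} (h : Semistable Λ)
    (U : Submodule ℂ (Fin 5 → ℂ)) (hU : Module.finrank ℂ U ≤ 2)
    (hΛ : ∀ Q ∈ Λ, Q ∈ linIdeal U) : False := by
  obtain ⟨b, hb⟩ := exists_adapted_basis U hU
  obtain ⟨g, hg⟩ := exists_subst b
  obtain ⟨m, hm, hw, -, hsurj⟩ := h.exists_monomials ![2, 2, 2, -3, -3]
    ⟨by decide, by decide, by decide⟩ g
  have hj : ∃ j, m j 3 = 0 ∧ m j 4 = 0 := by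
    simp only [wt_eq] at hw
    have e0 := hm 0
    have e1 := hm 1
    have e2 := hm 2
    simp only [Fin.sum_univ_five] at e0 e1 e2
    simp at hw
    by_contra! hc
    have c0 := hc 0
    have c1 := hc 1
    have c2 := hc 2
    omega
  obtain ⟨j, h3, h4⟩ := hj
  obtain ⟨Q, hQ, hc⟩ := hsurj j
  refine hc (coeff_eq_zero_of_mem (s := {i | 5 ≤ (i : ℕ) + 2})
    (map_linIdeal_le hg hb (Ideal.mem_map_of_mem _ (hΛ Q hQ))) fun i hi => ?_)
  rw [Set.mem_ofPred_eq] at hi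
  have : i = 3 ∨ i = 4 := by omega
  rcases this with rfl | rfl <;> assumption

/-- A semistable net vanishing on a line has no member singular along that line. -/
lemma Semistable.not_mem_sq_linIdeal {Λ : Submodule ℂ Quin} (h : Semistable Λ)
    (U : Submodule ℂ (Fin 5 → ℂ)) (hU : Module.finrank ℂ U ≤ 3)
    (hΛ : ∀ Q ∈ Λ, Q ∈ linIdeal U) {Q : Quin} (hQ : Q ∈ Λ) (hQ0 : Q ≠ 0) :
    Q ∉ linIdeal U ^ 2 := by
  intro hsq
  obtain ⟨b, hb⟩ := exists_adapted_basis U hU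
  obtain ⟨g, hg⟩ := exists_subst b
  obtain ⟨m, hm, hw, hinj, hsurj⟩ := h.exists_monomials ![3, 3, -2, -2, -2]
    ⟨by decide, by decide, by decide⟩ g
  have hone : ∀ j, m j 2 ≠ 0 ∨ m j 3 ≠ 0 ∨ m j 4 ≠ 0 := by
    intro j
    by_contra! hc
    obtain ⟨Q', hQ', hc'⟩ := hsurj j
    refine hc' (coeff_eq_zero_of_mem (s := {i | 5 ≤ (i : ℕ) + 3})
      (map_linIdeal_le hg hb (Ideal.mem_map_of_mem _ (hΛ Q' hQ'))) fun i hi => ?_)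
    rw [Set.mem_ofPred_eq] at hi
    have : i = 2 ∨ i = 3 ∨ i = 4 := by omega
    rcases this with rfl | rfl | rfl
    exacts [hc.1, hc.2.1, hc.2.2]
  have hle : ∀ j, m j 2 + m j 3 + m j 4 ≤ 1 := by
    simp only [wt_eq] at hw
    have e0 := hm 0
    have e1 := hm 1
    have e2 := hm 2
    simp only [Fin.sum_univ_five] at e0 e1 e2
    simp at hw
    have c0 := hone 0
    have c1 := hone 1
    have c2 := hone 2
    intro j
    fin_cases j <;> simp <;> omega
  refine hQ0 (hinj Q hQ fun j => ?_)
  have hs : {i : Fin 5 | 5 ≤ (i : ℕ) + 3} = (({2, 3, 4} : Finset (Fin 5)) : Set (Fin 5)) := by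
    ext i
    fin_cases i <;> simp
  rw [hs] at hb
  refine coeff_eq_zero_of_mem_sq (s := {2, 3, 4}) (Ideal.pow_right_mono (map_linIdeal_le hg hb) 2 ?_)
    (by simpa [add_assoc] using hle j)
  rw [← Ideal.map_pow]
  exact Ideal.mem_map_of_mem _ hsq

/-- Linear independence of three vectors, unfolded. -/
def Indep3 (Q1 Q2 Q3 : Quin) : Prop :=
  ∀ a b c : ℂ, a • Q1 + b • Q2 + c • Q3 = 0 → a = 0 ∧ b = 0 ∧ c = 0

lemma Indep3.rotate {Q1 Q2 Q3 : Quin} (h : Indep3 Q1 Q2 Q3) : Indep3 Q2 Q3 Q1 := by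
  intro a b c h0
  obtain ⟨h1, h2, h3⟩ := h c a b (by rw [← h0]; abel)
  exact ⟨h2, h3, h1⟩

lemma Indep3.neg {Q1 Q2 Q3 : Quin} (h : Indep3 Q1 Q2 Q3) : Indep3 (-Q1) (-Q2) (-Q3) := by
  intro a b c h0
  obtain ⟨h1, h2, h3⟩ := h (-a) (-b) (-c) (by simpa using h0)
  simpa using (⟨h1, h2, h3⟩ : -a = 0 ∧ -b = 0 ∧ -c = 0)

lemma minors_degenerate_aux {Λ : Submodule ℂ Quin} (h : Semistable Λ) {Q1 Q2 Q3 : Quin}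
    (h1 : Q1 ∈ Λ) (h2 : Q2 ∈ Λ) (h3 : Q3 ∈ Λ) (hli : Indep3 Q1 Q2 Q3)
    {p0 p1 p2 q0 q1 q2 : Fin 5 → ℂ}
    (e1 : Q1 = lin p1 * lin q2 - lin p2 * lin q1)
    (e2 : Q2 = lin p2 * lin q0 - lin p0 * lin q2)
    (e3 : Q3 = lin p0 * lin q1 - lin p1 * lin q0)
    {w0 w1 w2 : ℂ} (hw : w0 ≠ 0) (hrel : w0 • p0 + w1 • p1 + w2 • p2 = 0) : False := by
  have hp0 : C w0 * lin p0 + C w1 * lin p1 + C w2 * lin p2 = 0 := by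
    have := congrArg lin hrel
    simpa only [map_add, map_smul, map_zero, smul_eq_C_mul] using this
  refine h.no_linear_factor (P1 := w0 • Q2 - w1 • Q1) (P2 := w0 • Q3 - w2 • Q1)
    (Λ.sub_mem (Λ.smul_mem _ h2) (Λ.smul_mem _ h1))
    (Λ.sub_mem (Λ.smul_mem _ h3) (Λ.smul_mem _ h1)) ?_ (w0 • q0 + w1 • q1 + w2 • q2)
    ⟨lin p2, ?_⟩ ⟨-lin p1, ?_⟩
  · rw [LinearIndependent.pair_iff]
    intro s t hst
    obtain ⟨-, hb, hc⟩ := hli (-(s * w1) - t * w2) (s * w0) (t * w0) (by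
      rw [← hst]; module)
    exact ⟨(mul_eq_zero.1 hb).resolve_right hw, (mul_eq_zero.1 hc).resolve_right hw⟩
  · simp only [map_add, map_smul, smul_eq_C_mul, e1, e2]
    linear_combination (-lin q2) * hp0
  · simp only [map_add, map_smul, smul_eq_C_mul, e1, e3]
    linear_combination (lin q1) * hp0

lemma minors_degenerate {Λ : Submodule ℂ Quin} (h : Semistable Λ) {Q1 Q2 Q3 : Quin}
    (h1 : Q1 ∈ Λ) (h2 : Q2 ∈ Λ) (h3 : Q3 ∈ Λ) (hli : Indep3 Q1 Q2 Q3)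
    {p0 p1 p2 q0 q1 q2 : Fin 5 → ℂ}
    (e1 : Q1 = lin p1 * lin q2 - lin p2 * lin q1)
    (e2 : Q2 = lin p2 * lin q0 - lin p0 * lin q2)
    (e3 : Q3 = lin p0 * lin q1 - lin p1 * lin q0)
    {w0 w1 w2 : ℂ} (hw : w0 ≠ 0 ∨ w1 ≠ 0 ∨ w2 ≠ 0)
    (hrel : w0 • p0 + w1 • p1 + w2 • p2 = 0) : False := by
  rcases hw with hw | hw | hw
  · exact minors_degenerate_aux h h1 h2 h3 hli e1 e2 e3 hw hrel
  · exact minors_degenerate_aux h h2 h3 h1 hli.rotate e2 e3 e1 (w1 := w2) (w2 := w0) hw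
      (by rw [← hrel]; abel)
  · exact minors_degenerate_aux h h3 h1 h2 hli.rotate.rotate e3 e1 e2 (w1 := w0) (w2 := w1) hw
      (by rw [← hrel]; abel)

lemma minors_generic_aux {Λ : Submodule ℂ Quin} (h : Semistable Λ) {Q1 Q2 Q3 : Quin}
    (hΛ : Λ = Submodule.span ℂ {Q1, Q2, Q3}) (hli : Indep3 Q1 Q2 Q3)
    {p0 p1 p2 q0 q1 q2 : Fin 5 → ℂ}
    (e1 : Q1 = lin p1 * lin q2 - lin p2 * lin q1)
    (e2 : Q2 = lin p2 * lin q0 - lin p0 * lin q2)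
    (e3 : Q3 = lin p0 * lin q1 - lin p1 * lin q0)
    {x0 x1 x2 y0 y1 y2 : ℂ} (hw : x1 * y2 - x2 * y1 ≠ 0)
    (hrel : x0 • p0 + x1 • p1 + x2 • p2 + (y0 • q0 + y1 • q1 + y2 • q2) = 0) : False := by
  set U : Submodule ℂ (Fin 5 → ℂ) := Submodule.span ℂ (({x0 • p0 + x1 • p1 + x2 • p2,
    x0 • q0 + x1 • q1 + x2 • q2, y0 • p0 + y1 • p1 + y2 • p2} : Finset (Fin 5 → ℂ)) :
      Set (Fin 5 → ℂ)) with hU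
  have hUr : Module.finrank ℂ U ≤ 3 := (finrank_span_finset_le_card _).trans Finset.card_le_three
  have m1 : lin (x0 • p0 + x1 • p1 + x2 • p2) ∈ linIdeal U :=
    lin_mem_linIdeal (Submodule.subset_span (by simp))
  have m2 : lin (x0 • q0 + x1 • q1 + x2 • q2) ∈ linIdeal U :=
    lin_mem_linIdeal (Submodule.subset_span (by simp))
  have m3 : lin (y0 • p0 + y1 • p1 + y2 • p2) ∈ linIdeal U :=
    lin_mem_linIdeal (Submodule.subset_span (by simp))
  have m4 : lin (y0 • q0 + y1 • q1 + y2 • q2) ∈ linIdeal U := by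
    rw [eq_neg_of_add_eq_zero_right hrel, map_neg]
    exact neg_mem m1
  simp only [map_add, map_smul, smul_eq_C_mul] at m1 m2 m3 m4
  set I := linIdeal U
  have mX : (C x0 * lin p0 + C x1 * lin p1 + C x2 * lin p2) * lin q0 -
      (C x0 * lin q0 + C x1 * lin q1 + C x2 * lin q2) * lin p0 ∈ I :=
    I.sub_mem (I.mul_mem_right _ m1) (I.mul_mem_right _ m2)
  have mY : (C y0 * lin p0 + C y1 * lin p1 + C y2 * lin p2) * lin q0 -
      (C y0 * lin q0 + C y1 * lin q1 + C y2 * lin q2) * lin p0 ∈ I :=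
    I.sub_mem (I.mul_mem_right _ m3) (I.mul_mem_right _ m4)
  have hunit : ∀ Q : Quin, C (x1 * y2 - x2 * y1) * Q ∈ I → Q ∈ I := by
    intro Q hQ
    have := I.mul_mem_left (C (x1 * y2 - x2 * y1)⁻¹) hQ
    rwa [← mul_assoc, ← C_mul, inv_mul_cancel₀ hw, C_1, one_mul] at this
  have hsq : (x1 * y2 - x2 * y1) • Q1 + (x2 * y0 - x0 * y2) • Q2 + (x0 * y1 - x1 * y0) • Q3 =
      (C x0 * lin p0 + C x1 * lin p1 + C x2 * lin p2) *
        (C y0 * lin q0 + C y1 * lin q1 + C y2 * lin q2) -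
      (C x0 * lin q0 + C x1 * lin q1 + C x2 * lin q2) *
        (C y0 * lin p0 + C y1 * lin p1 + C y2 * lin p2) := by
    simp only [smul_eq_C_mul, e1, e2, e3, C_sub, C_mul]
    ring
  have hQ2 : Q2 ∈ I := by
    apply hunit
    have := I.sub_mem (I.mul_mem_left (C x1) mY) (I.mul_mem_left (C y1) mX)
    convert this using 1
    simp only [e2, C_sub, C_mul]
    ring
  have hQ3 : Q3 ∈ I := by
    apply hunit
    have := I.sub_mem (I.mul_mem_left (C x2) mY) (I.mul_mem_left (C y2) mX)
    convert this using 1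
    simp only [e3, C_sub, C_mul]
    ring
  have hW : (x1 * y2 - x2 * y1) • Q1 + (x2 * y0 - x0 * y2) • Q2 + (x0 * y1 - x1 * y0) • Q3 ∈
      I ^ 2 := by
    rw [hsq, pow_two]
    exact Ideal.sub_mem _ (Ideal.mul_mem_mul m1 m4) (Ideal.mul_mem_mul m2 m3)
  have hQ1 : Q1 ∈ I := by
    apply hunit
    have h2 := Ideal.pow_le_self two_ne_zero hW
    have := I.sub_mem (I.sub_mem h2 (I.mul_mem_left (C (x2 * y0 - x0 * y2)) hQ2))
      (I.mul_mem_left (C (x0 * y1 - x1 * y0)) hQ3)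
    convert this using 1
    simp only [smul_eq_C_mul]
    ring
  refine h.not_mem_sq_linIdeal U hUr ?_ (Q := (x1 * y2 - x2 * y1) • Q1 +
    (x2 * y0 - x0 * y2) • Q2 + (x0 * y1 - x1 * y0) • Q3) ?_ (fun h0 => hw (hli _ _ _ h0).1) hW
  · have : Λ ≤ I.restrictScalars ℂ := by
      rw [hΛ, Submodule.span_le]
      rintro Q (rfl | rfl | rfl)
      exacts [hQ1, hQ2, hQ3]
    exact fun Q hQ => this hQ
  · rw [hΛ]
    exact Submodule.add_mem _ (Submodule.add_mem _
      (Submodule.smul_mem _ _ (Submodule.subset_span (by simp)))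
      (Submodule.smul_mem _ _ (Submodule.subset_span (by simp))))
      (Submodule.smul_mem _ _ (Submodule.subset_span (by simp)))

lemma span_rotate (Q1 Q2 Q3 : Quin) :
    Submodule.span ℂ {Q1, Q2, Q3} = Submodule.span ℂ {Q2, Q3, Q1} := by
  congr 1
  ext x
  simp only [Set.mem_insert_iff, Set.mem_singleton_iff]
  tauto

/-- A semistable net is not generated by the minors of a `2 × 3` matrix of linear forms. -/
lemma Semistable.not_minors {Λ : Submodule ℂ Quin} (h : Semistable Λ) {Q1 Q2 Q3 : Quin}
    (hΛ : Λ = Submodule.span ℂ {Q1, Q2, Q3}) (hli : Indep3 Q1 Q2 Q3)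
    {p0 p1 p2 q0 q1 q2 : Fin 5 → ℂ}
    (e1 : Q1 = lin p1 * lin q2 - lin p2 * lin q1)
    (e2 : Q2 = lin p2 * lin q0 - lin p0 * lin q2)
    (e3 : Q3 = lin p0 * lin q1 - lin p1 * lin q0) : False := by
  have h1 : Q1 ∈ Λ := by rw [hΛ]; exact Submodule.subset_span (by simp)
  have h2 : Q2 ∈ Λ := by rw [hΛ]; exact Submodule.subset_span (by simp)
  have h3 : Q3 ∈ Λ := by rw [hΛ]; exact Submodule.subset_span (by simp)
  have hdep : ¬ LinearIndependent ℂ ![p0, p1, p2, q0, q1, q2] := by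
    intro hc
    have := hc.fintype_card_le_finrank
    simp at this
  rw [Fintype.not_linearIndependent_iff] at hdep
  obtain ⟨z, hz, i, hi⟩ := hdep
  simp [Fin.sum_univ_succ] at hz
  obtain ⟨x0, hx0⟩ : ∃ x0, x0 = z 0 := ⟨_, rfl⟩
  obtain ⟨x1, hx1⟩ : ∃ x0, x0 = z 1 := ⟨_, rfl⟩
  obtain ⟨x2, hx2⟩ : ∃ x0, x0 = z 2 := ⟨_, rfl⟩
  obtain ⟨y0, hy0⟩ : ∃ x0, x0 = z 3 := ⟨_, rfl⟩
  obtain ⟨y1, hy1⟩ : ∃ x0, x0 = z 4 := ⟨_, rfl⟩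
  obtain ⟨y2, hy2⟩ : ∃ x0, x0 = z 5 := ⟨_, rfl⟩
  have hrel : x0 • p0 + x1 • p1 + x2 • p2 + (y0 • q0 + y1 • q1 + y2 • q2) = 0 := by
    rw [hx0, hx1, hx2, hy0, hy1, hy2, ← hz]
    abel_nf
  by_cases c0 : x1 * y2 - x2 * y1 ≠ 0
  · exact minors_generic_aux h hΛ hli e1 e2 e3 c0 hrel
  by_cases c1 : x2 * y0 - x0 * y2 ≠ 0
  · exact minors_generic_aux h (hΛ.trans (span_rotate _ _ _)) hli.rotate e2 e3 e1
      (x0 := x1) (x1 := x2) (x2 := x0) (y0 := y1) c1 (by rw [← hrel]; abel)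
  by_cases c2 : x0 * y1 - x1 * y0 ≠ 0
  · exact minors_generic_aux h (hΛ.trans ((span_rotate _ _ _).trans (span_rotate _ _ _)))
      hli.rotate.rotate e3 e1 e2
      (x0 := x2) (x1 := x0) (x2 := x1) (y0 := y2) c2 (by rw [← hrel]; abel)
  rw [not_not] at c0 c1 c2
  by_cases hx : x0 ≠ 0 ∨ x1 ≠ 0 ∨ x2 ≠ 0
  · obtain ⟨t, ht0, ht1, ht2⟩ : ∃ t, y0 = t * x0 ∧ y1 = t * x1 ∧ y2 = t * x2 := by
      rcases hx with hx | hx | hx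
      · refine ⟨y0 / x0, ?_, ?_, ?_⟩ <;> field_simp <;> first | linear_combination c2 | linear_combination -c1
      · refine ⟨y1 / x1, ?_, ?_, ?_⟩ <;> field_simp <;> first | linear_combination c0 | linear_combination -c2
      · refine ⟨y2 / x2, ?_, ?_, ?_⟩ <;> field_simp <;> first | linear_combination c1 | linear_combination -c0
    refine minors_degenerate h h1 h2 h3 hli (p0 := p0 + t • q0) (p1 := p1 + t • q1)
      (p2 := p2 + t • q2) (q0 := q0) (q1 := q1) (q2 := q2) ?_ ?_ ?_ hx ?_
    · simp only [e1, map_add, map_smul, smul_eq_C_mul]; ring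
    · simp only [e2, map_add, map_smul, smul_eq_C_mul]; ring
    · simp only [e3, map_add, map_smul, smul_eq_C_mul]; ring
    · rw [← hrel, ht0, ht1, ht2]; module
  · push Not at hx
    obtain ⟨a0, a1, a2⟩ := hx
    rw [a0, a1, a2] at hrel
    refine minors_degenerate h (Λ.neg_mem h1) (Λ.neg_mem h2) (Λ.neg_mem h3) hli.neg (p0 := q0)
      (p1 := q1) (p2 := q2) (q0 := p0) (q1 := p1) (q2 := p2) (w0 := y0) (w1 := y1) (w2 := y2)
      ?_ ?_ ?_ ?_ (by rw [← hrel]; module)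
    · rw [e1]; ring
    · rw [e2]; ring
    · rw [e3]; ring
    · by_contra! hc
      obtain ⟨b0, b1, b2⟩ := hc
      apply hi
      fin_cases i <;> simp_all

lemma isHomogeneous_lin (h : Fin 5 → ℂ) : (lin h).IsHomogeneous 1 := by
  rw [lin_apply]
  exact IsHomogeneous.sum _ _ _ fun i _ => isHomogeneous_C_mul_X _ _

lemma exists_lin {p : Quin} (hp : p.IsHomogeneous 1) : ∃ h, p = lin h := by
  rw [← mem_homogeneousSubmodule, homogeneousSubmodule_one_eq_span_X] at hp
  have : Submodule.span ℂ (Set.range (X : Fin 5 → Quin)) ≤ LinearMap.range lin := by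
    rw [Submodule.span_le]
    rintro _ ⟨i, rfl⟩
    exact ⟨_, lin_single i⟩
  obtain ⟨h, rfl⟩ := this hp
  exact ⟨h, rfl⟩

lemma eval_lin (h u : Fin 5 → ℂ) : eval u (lin h) = ∑ i, h i * u i := by
  simp [lin_apply]

/-- Every linear functional is given by a linear form. -/
lemma exists_lin_eval (f : (Fin 5 → ℂ) →ₗ[ℂ] ℂ) : ∃ h, ∀ u, eval u (lin h) = f u := by
  refine ⟨fun i => f fun j => if i = j then 1 else 0, fun u => ?_⟩
  rw [eval_lin, LinearMap.pi_apply_eq_sum_univ f u]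
  exact Finset.sum_congr rfl fun i _ => mul_comm _ _

lemma homogeneous_two_induction {σ : Type*} {p : MvPolynomial σ ℂ → Prop}
    (hmul : ∀ f g : MvPolynomial σ ℂ, f.IsHomogeneous 1 → g.IsHomogeneous 1 → p (f * g))
    (hadd : ∀ f g, p f → p g → p (f + g)) {Q : MvPolynomial σ ℂ} (hQ : Q.IsHomogeneous 2) : p Q := by
  rw [← mem_homogeneousSubmodule, ← homogeneousSubmodule_one_pow, pow_two] at hQ
  induction hQ using Submodule.mul_induction_on' with
  | mem_mul_mem f hf g hg => exact hmul f g hf hg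
  | add f _ g _ hf hg => exact hadd f g hf hg

lemma exists_bilin {Q : Quin} (hQ : Q.IsHomogeneous 2) :
    ∃ B : (Fin 5 → ℂ) →ₗ[ℂ] (Fin 5 → ℂ) →ₗ[ℂ] ℂ, ∀ u, eval u Q = B u u := by
  refine homogeneous_two_induction (p := fun Q => ∃ B : (Fin 5 → ℂ) →ₗ[ℂ] (Fin 5 → ℂ) →ₗ[ℂ] ℂ,
    ∀ u, eval u Q = B u u) ?_ ?_ hQ
  · intro f g hf hg
    obtain ⟨h, rfl⟩ := exists_lin hf
    obtain ⟨k, rfl⟩ := exists_lin hg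
    have key : ∀ h : Fin 5 → ℂ, ∃ f : (Fin 5 → ℂ) →ₗ[ℂ] ℂ, ∀ u, f u = eval u (lin h) := fun h =>
      ⟨∑ i, h i • LinearMap.proj i, fun u => by simp [eval_lin]⟩
    obtain ⟨f1, h1⟩ := key h
    obtain ⟨f2, h2⟩ := key k
    exact ⟨LinearMap.mk₂ ℂ (fun u v => f1 u * f2 v) (fun _ _ _ => by simp [add_mul])
      (fun _ _ _ => by simp [mul_assoc]) (fun _ _ _ => by simp [mul_add])
      (fun _ _ _ => by simp [mul_left_comm]), fun u => by simp [h1, h2]⟩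
  · rintro f g ⟨B, hB⟩ ⟨B', hB'⟩
    exact ⟨B + B', fun u => by simp [hB, hB']⟩

lemma eq_C_add_of_totalDegree_le_one {σ : Type*} {p : MvPolynomial σ ℂ} (h : p.totalDegree ≤ 1) :
    p = C (coeff 0 p) + homogeneousComponent 1 p := by
  conv_lhs => rw [← sum_homogeneousComponent p]
  rcases Nat.le_one_iff_eq_zero_or_eq_one.1 h with h | h
  · rw [h, homogeneousComponent_eq_zero 1 p (by omega)]
    simp
  · rw [h, Finset.sum_range_succ, Finset.sum_range_one, homogeneousComponent_zero]

lemma mul_eq_of_isHomogeneous_two {σ : Type*} {p q : MvPolynomial σ ℂ} (hp : p.totalDegree ≤ 1)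
    (hq : q.totalDegree ≤ 1) (h : (p * q).IsHomogeneous 2) :
    p * q = homogeneousComponent 1 p * homogeneousComponent 1 q := by
  have e : p * q = C (coeff 0 p * coeff 0 q) + (C (coeff 0 p) * homogeneousComponent 1 q +
      C (coeff 0 q) * homogeneousComponent 1 p) +
      homogeneousComponent 1 p * homogeneousComponent 1 q := by
    conv_lhs => rw [eq_C_add_of_totalDegree_le_one hp, eq_C_add_of_totalDegree_le_one hq]
    rw [C_mul]
    ring
  have hp1 := homogeneousComponent_isHomogeneous 1 p
  have hq1 := homogeneousComponent_isHomogeneous 1 q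
  have := congrArg (homogeneousComponent 2) e
  rw [homogeneousComponent_of_mem h, map_add, map_add,
    homogeneousComponent_of_mem (isHomogeneous_C _ _),
    homogeneousComponent_of_mem ((hq1.C_mul _).add (hp1.C_mul _)),
    homogeneousComponent_of_mem (hp1.mul hq1)] at this
  simpa using this

/-- Independent members of a semistable net are coprime. -/
lemma Semistable.isRelPrime {Λ : Submodule ℂ Quin} (h : Semistable Λ)
    (hhom : ∀ Q ∈ Λ, Q.IsHomogeneous 2) {P1 P2 : Quin}
    (h1 : P1 ∈ Λ) (h2 : P2 ∈ Λ) (hli : LinearIndependent ℂ ![P1, P2]) : IsRelPrime P1 P2 := by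
  rintro g ⟨k1, hk1⟩ ⟨k2, hk2⟩
  have h10 : P1 ≠ 0 := hli.ne_zero 0
  have h20 : P2 ≠ 0 := hli.ne_zero 1
  have hg0 : g ≠ 0 := by rintro rfl; exact h10 (by rw [hk1, zero_mul])
  have hk10 : k1 ≠ 0 := by rintro rfl; exact h10 (by rw [hk1, mul_zero])
  have hk20 : k2 ≠ 0 := by rintro rfl; exact h20 (by rw [hk2, mul_zero])
  have d1 := totalDegree_mul_of_isDomain hg0 hk10
  have d2 := totalDegree_mul_of_isDomain hg0 hk20
  rw [← hk1, (hhom P1 h1).totalDegree h10] at d1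
  rw [← hk2, (hhom P2 h2).totalDegree h20] at d2
  have hg : g.totalDegree = 0 ∨ g.totalDegree = 1 ∨ g.totalDegree = 2 := by omega
  rcases hg with hg | hg | hg
  · rw [totalDegree_eq_zero_iff_eq_C] at hg
    rw [hg] at hg0 ⊢
    exact (IsUnit.mk0 _ (by simpa using hg0)).map C
  · exfalso
    obtain ⟨l, hl⟩ := exists_lin (homogeneousComponent_isHomogeneous 1 g)
    refine h.no_linear_factor h1 h2 hli l ?_ ?_
    · rw [hk1, mul_eq_of_isHomogeneous_two (by omega) (by omega) (hk1 ▸ hhom P1 h1), hl]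
      exact dvd_mul_right _ _
    · rw [hk2, mul_eq_of_isHomogeneous_two (by omega) (by omega) (hk2 ▸ hhom P2 h2), hl]
      exact dvd_mul_right _ _
  · exfalso
    have t1 : k1 = C (coeff 0 k1) := totalDegree_eq_zero_iff_eq_C.1 (by omega)
    have t2 : k2 = C (coeff 0 k2) := totalDegree_eq_zero_iff_eq_C.1 (by omega)
    rw [LinearIndependent.pair_iff] at hli
    have := hli (coeff 0 k2) (-coeff 0 k1) (by
      rw [hk1, hk2, smul_eq_C_mul, smul_eq_C_mul, C_neg, ← t1, ← t2]; ring)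
    rw [this.1, C_0] at t2
    exact hk20 t2

lemma Semistable.no_syzygy {Λ : Submodule ℂ Quin} (h : Semistable Λ)
    (hhom : ∀ Q ∈ Λ, Q.IsHomogeneous 2) {P1 P2 : Quin}
    (h1 : P1 ∈ Λ) (h2 : P2 ∈ Λ) (hli : LinearIndependent ℂ ![P1, P2]) {a b : Fin 5 → ℂ}
    (hab : lin a * P2 = lin b * P1) : lin a = 0 := by
  by_contra ha
  have hd : P1 ∣ lin a := (h.isRelPrime hhom h1 h2 hli).dvd_of_dvd_mul_right ⟨lin b, by rw [hab, mul_comm]⟩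
  have := totalDegree_le_of_dvd_of_isDomain hd ha
  rw [(hhom P1 h1).totalDegree (hli.ne_zero 0), (isHomogeneous_lin a).totalDegree ha] at this
  omega

/-- The determinant of three vectors in `ℂ³`. -/
def det3 (x y z : Fin 3 → ℂ) : ℂ :=
  x 0 * (y 1 * z 2 - y 2 * z 1) - x 1 * (y 0 * z 2 - y 2 * z 0) + x 2 * (y 0 * z 1 - y 1 * z 0)

/-- The combination of three quadrics with given coefficients. -/
noncomputable def comb (Q : Fin 3 → Quin) (c : Fin 3 → ℂ) : Quin :=
  c 0 • Q 0 + c 1 • Q 1 + c 2 • Q 2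

lemma comb_eq_zero {Q : Fin 3 → Quin} (hli : Indep3 (Q 0) (Q 1) (Q 2)) {c : Fin 3 → ℂ}
    (h : comb Q c = 0) (i : Fin 3) : c i = 0 := by
  obtain ⟨h0, h1, h2⟩ := hli _ _ _ h
  fin_cases i <;> assumption

lemma comb_mem {Λ : Submodule ℂ Quin} {Q : Fin 3 → Quin} (hQ : ∀ i, Q i ∈ Λ) (c : Fin 3 → ℂ) :
    comb Q c ∈ Λ :=
  Λ.add_mem (Λ.add_mem (Λ.smul_mem _ (hQ 0)) (Λ.smul_mem _ (hQ 1))) (Λ.smul_mem _ (hQ 2))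

section Line

variable {Λ : Submodule ℂ Quin} {Q : Fin 3 → Quin}
  {B : Fin 3 → (Fin 5 → ℂ) →ₗ[ℂ] (Fin 5 → ℂ) →ₗ[ℂ] ℂ}

lemma exists_lin_polar (B : Fin 3 → (Fin 5 → ℂ) →ₗ[ℂ] (Fin 5 → ℂ) →ₗ[ℂ] ℂ) (c : Fin 3 → ℂ)
    (u : Fin 5 → ℂ) : ∃ h, ∀ x, eval x (lin h) =
      c 0 * (B 0 u x + B 0 x u) + c 1 * (B 1 u x + B 1 x u) + c 2 * (B 2 u x + B 2 x u) := by
  obtain ⟨h, hh⟩ := exists_lin_eval (∑ i, c i • (B i u + (B i).flip u))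
  exact ⟨h, fun x => by rw [hh]; simp [Fin.sum_univ_three]; ring⟩

lemma eval_comb (hB : ∀ i u, eval u (Q i) = B i u u) (c : Fin 3 → ℂ) (x : Fin 5 → ℂ) :
    eval x (comb Q c) = c 0 * B 0 x x + c 1 * B 1 x x + c 2 * B 2 x x := by
  simp [comb, hB, smul_eval]

lemma Semistable.det_polar_polar_eq_zero (h : Semistable Λ) (hhom : ∀ Q ∈ Λ, Q.IsHomogeneous 2)
    (hQ : ∀ i, Q i ∈ Λ) (hli : Indep3 (Q 0) (Q 1) (Q 2)) (hB : ∀ i u, eval u (Q i) = B i u u)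
    (h0 : ∀ u v, det3 (fun i => B i u u) (fun i => B i u v + B i v u) (fun i => B i v v) = 0)
    (u v w : Fin 5 → ℂ) :
    det3 (fun i => B i u u) (fun i => B i u v + B i v u) (fun i => B i u w + B i w u) = 0 := by
  by_contra hδ
  obtain ⟨q, hq⟩ : ∃ q : Fin 3 → ℂ, q = fun i => B i u u := ⟨_, rfl⟩
  obtain ⟨s, hs⟩ : ∃ s : Fin 3 → ℂ, s = fun i => B i u v + B i v u := ⟨_, rfl⟩
  obtain ⟨t, ht⟩ : ∃ t : Fin 3 → ℂ, t = fun i => B i u w + B i w u := ⟨_, rfl⟩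
  rw [← hq, ← hs, ← ht] at hδ
  let c1 : Fin 3 → ℂ := ![t 1 * q 2 - t 2 * q 1, t 2 * q 0 - t 0 * q 2, t 0 * q 1 - t 1 * q 0]
  let c2 : Fin 3 → ℂ := ![q 1 * s 2 - q 2 * s 1, q 2 * s 0 - q 0 * s 2, q 0 * s 1 - q 1 * s 0]
  obtain ⟨l1, hl1⟩ := exists_lin_polar B c1 u
  obtain ⟨l2, hl2⟩ := exists_lin_polar B c2 u
  have hl : lin l1 = 0 := by
    refine h.no_syzygy hhom (comb_mem hQ c1) (comb_mem hQ c2) ?_ (b := l2) ?_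
    · rw [LinearIndependent.pair_iff]
      intro a b hab
      have hc := comb_eq_zero hli (c := fun i => a * c1 i + b * c2 i) (by
        rw [← hab]; simp only [comb]; module)
      have e0 := hc 0
      have e1 := hc 1
      have e2 := hc 2
      simp only [c1, c2, Matrix.cons_val] at e0 e1 e2
      constructor
      · refine (mul_eq_zero.1 (?_ : a * det3 q s t = 0)).resolve_right hδ
        rw [det3]
        linear_combination s 0 * e0 + s 1 * e1 + s 2 * e2
      · refine (mul_eq_zero.1 (?_ : b * det3 q s t = 0)).resolve_right hδ
        rw [det3]
        linear_combination t 0 * e0 + t 1 * e1 + t 2 * e2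
    · refine MvPolynomial.funext fun x => ?_
      have hx := h0 u x
      rw [map_mul, map_mul, hl1, hl2, eval_comb hB, eval_comb hB, ← sub_eq_zero]
      rw [det3] at hx
      have hq' : ∀ i, B i u u = q i := fun i => by rw [hq]
      simp only [hq'] at hx
      simp only [c1, c2, Matrix.cons_val]
      generalize (B 0 u) x + (B 0 x) u = b0 at *
      generalize (B 1 u) x + (B 1 x) u = b1 at *
      generalize (B 2 u) x + (B 2 x) u = b2 at *
      linear_combination (q 0 * (s 1 * t 2 - s 2 * t 1) - q 1 * (s 0 * t 2 - s 2 * t 0) +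
        q 2 * (s 0 * t 1 - s 1 * t 0)) * hx
  apply hδ
  have := hl1 v
  rw [hl, map_zero] at this
  have hs' : ∀ i, B i u v + B i v u = s i := fun i => by rw [hs]
  simp only [hs', c1, Matrix.cons_val] at this
  rw [det3]
  linear_combination -this

lemma Semistable.cross_polar_eq_zero (h : Semistable Λ) (hhom : ∀ Q ∈ Λ, Q.IsHomogeneous 2)
    (hQ : ∀ i, Q i ∈ Λ) (hli : Indep3 (Q 0) (Q 1) (Q 2)) (hB : ∀ i u, eval u (Q i) = B i u u)
    (h0 : ∀ u v, det3 (fun i => B i u u) (fun i => B i u v + B i v u) (fun i => B i v v) = 0)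
    (u v : Fin 5 → ℂ) (i j : Fin 3) :
    B i u u * (B j u v + B j v u) - B j u u * (B i u v + B i v u) = 0 := by
  by_contra hδ
  have h1 := h.det_polar_polar_eq_zero hhom hQ hli hB h0 u v
  obtain ⟨q, hq⟩ : ∃ q : Fin 3 → ℂ, ∀ i, B i u u = q i := ⟨_, fun _ => rfl⟩
  obtain ⟨s, hs⟩ : ∃ s : Fin 3 → ℂ, ∀ i, B i u v + B i v u = s i := ⟨_, fun _ => rfl⟩
  simp only [hq, hs] at hδ h1
  let c : Fin 3 → ℂ := ![q 1 * s 2 - q 2 * s 1, q 2 * s 0 - q 0 * s 2, q 0 * s 1 - q 1 * s 0]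
  obtain ⟨l, hl⟩ := exists_lin_eval (q i • (B j u + (B j).flip u) - q j • (B i u + (B i).flip u))
  have hl' : ∀ x, eval x (lin l) =
      q i * (B j u x + B j x u) - q j * (B i u x + B i x u) := fun x => by rw [hl]; simp; ring
  have hprod : lin l * comb Q c = 0 := by
    refine MvPolynomial.funext fun x => ?_
    rw [map_mul, hl', eval_comb hB, map_zero]
    have hx := h0 u x
    have hy := h1 x
    simp only [det3, hq] at hx hy
    obtain ⟨b, hb⟩ : ∃ b : Fin 3 → ℂ, ∀ i, B i u x + B i x u = b i := ⟨_, fun _ => rfl⟩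
    simp only [hb] at hx hy ⊢
    simp only [c, Matrix.cons_val]
    have key : ∀ a k : Fin 3, (q a * b k - q k * b a) * ((q 1 * s 2 - q 2 * s 1) * B 0 x x +
        (q 2 * s 0 - q 0 * s 2) * B 1 x x + (q 0 * s 1 - q 1 * s 0) * B 2 x x) = 0 := by
      have k01 : (q 0 * b 1 - q 1 * b 0) * ((q 1 * s 2 - q 2 * s 1) * B 0 x x +
        (q 2 * s 0 - q 0 * s 2) * B 1 x x + (q 0 * s 1 - q 1 * s 0) * B 2 x x) = 0 := by
        linear_combination (q 0 * s 1 - q 1 * s 0) * hx + (q 0 * B 1 x x - q 1 * B 0 x x) * hy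
      have k12 : (q 1 * b 2 - q 2 * b 1) * ((q 1 * s 2 - q 2 * s 1) * B 0 x x +
        (q 2 * s 0 - q 0 * s 2) * B 1 x x + (q 0 * s 1 - q 1 * s 0) * B 2 x x) = 0 := by
        linear_combination (q 1 * s 2 - q 2 * s 1) * hx + (q 1 * B 2 x x - q 2 * B 1 x x) * hy
      have k02 : (q 0 * b 2 - q 2 * b 0) * ((q 1 * s 2 - q 2 * s 1) * B 0 x x +
        (q 2 * s 0 - q 0 * s 2) * B 1 x x + (q 0 * s 1 - q 1 * s 0) * B 2 x x) = 0 := by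
        linear_combination (q 0 * s 2 - q 2 * s 0) * hx + (q 0 * B 2 x x - q 2 * B 0 x x) * hy
      intro a k
      fin_cases a <;> fin_cases k <;> simp only [Fin.zero_eta, Fin.mk_one, Fin.reduceFinMk] <;>
        first
        | ring1
        | linear_combination k01
        | linear_combination k12
        | linear_combination k02
        | linear_combination -k01
        | linear_combination -k12
        | linear_combination -k02
    exact key i j
  rcases mul_eq_zero.1 hprod with hz | hz
  · apply hδ
    have := hl' v
    rw [hz, map_zero] at this
    rw [hs, hs] at this
    exact this.symm
  · have e := comb_eq_zero hli hz
    have e0 := e 0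
    have e1 := e 1
    have e2 := e 2
    simp only [c, Matrix.cons_val] at e0 e1 e2
    apply hδ
    fin_cases i <;> fin_cases j <;> simp only [Fin.zero_eta, Fin.mk_one, Fin.reduceFinMk] <;>
      first
      | ring1
      | linear_combination e0
      | linear_combination e1
      | linear_combination e2
      | linear_combination -e0
      | linear_combination -e1
      | linear_combination -e2

/-- A semistable net restricts injectively to some plane. -/
lemma Semistable.exists_det_ne_zero (h : Semistable Λ) (hhom : ∀ Q ∈ Λ, Q.IsHomogeneous 2)
    (hQ : ∀ i, Q i ∈ Λ) (hli : Indep3 (Q 0) (Q 1) (Q 2)) (hB : ∀ i u, eval u (Q i) = B i u u) :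
    ∃ u v, det3 (fun i => B i u u) (fun i => B i u v + B i v u) (fun i => B i v v) ≠ 0 := by
  by_contra! h0
  have h1 := h.cross_polar_eq_zero hhom hQ hli hB h0
  have h2 : ∀ u v i j, B i u u * B j v v - B j u u * B i v v = 0 := by
    intro u v i j
    have e1 := h1 (u + v) v i j
    have e2 := h1 u v i j
    have e3 := h1 v u i j
    simp only [map_add, LinearMap.add_apply] at e1
    linear_combination (e1 - e2 + e3) / 2
  have h3 : Q 0 ≠ 0 := by
    intro hz
    have := (hli 1 0 0 (by simp [hz])).1
    exact one_ne_zero this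
  obtain ⟨u, hu⟩ : ∃ u, eval u (Q 0) ≠ 0 := by
    by_contra! hc
    exact h3 (MvPolynomial.funext fun x => by rw [hc, map_zero])
  rw [hB] at hu
  refine hu (comb_eq_zero hli (c := ![- B 1 u u, B 0 u u, 0]) ?_ 1)
  refine MvPolynomial.funext fun x => ?_
  rw [eval_comb hB, map_zero]
  simp only [Matrix.cons_val]
  linear_combination h2 u x 0 1

end Line

/-- Polynomials in the first three variables. -/
abbrev Tern : Type := MvPolynomial (Fin 3) ℂ

/-- The inclusion of the polynomials in the first three variables. -/
noncomputable def emb : Tern →ₐ[ℂ] Quin := rename (Fin.castLE (by decide))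

lemma emb_C (r : ℂ) : emb (C r) = C r := rename_C _ r

lemma emb_isHomogeneous {n : ℕ} {f : Tern} (hf : f.IsHomogeneous n) : (emb f).IsHomogeneous n :=
  IsHomogeneous.rename_isHomogeneous hf

lemma emb_homogeneousComponent (n : ℕ) (f : Tern) :
    homogeneousComponent n (emb f) = emb (homogeneousComponent n f) :=
  (rename_homogeneousComponent n f).symm

lemma exists_linear_decomposition {f : Quin} (hf : f.IsHomogeneous 1) :
    ∃ (r s : ℂ) (l : Tern), l.IsHomogeneous 1 ∧ f = C r * X 3 + C s * X 4 + emb l := by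
  obtain ⟨h, rfl⟩ := exists_lin hf
  refine ⟨h 3, h 4, ∑ i : Fin 3, C (h (Fin.castLE (by decide) i)) * X i, ?_, ?_⟩
  · exact IsHomogeneous.sum _ _ _ fun i _ => by
      simpa using (isHomogeneous_C (Fin 3) _).mul (isHomogeneous_X ℂ i)
  · simp only [lin_apply, Fin.sum_univ_five, Fin.sum_univ_three, map_add, map_mul, emb_C]
    simp only [emb, rename_X]
    simp [Fin.castLE]
    ring!

lemma exists_quadratic_decomposition {f : Quin} (hf : f.IsHomogeneous 2) :
    ∃ (α β γ : ℂ) (l m n : Tern), l.IsHomogeneous 1 ∧ m.IsHomogeneous 1 ∧ n.IsHomogeneous 2 ∧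
      f = C α * X 3 ^ 2 + C β * (X 3 * X 4) + C γ * X 4 ^ 2 +
        emb l * X 3 + emb m * X 4 + emb n := by
  refine homogeneous_two_induction (p := fun f : Quin => ∃ (α β γ : ℂ) (l m n : Tern),
    l.IsHomogeneous 1 ∧ m.IsHomogeneous 1 ∧ n.IsHomogeneous 2 ∧
      f = C α * X 3 ^ 2 + C β * (X 3 * X 4) + C γ * X 4 ^ 2 +
        emb l * X 3 + emb m * X 4 + emb n) ?_ ?_ hf
  · intro f g hf hg
    obtain ⟨r, s, l, hl, rfl⟩ := exists_linear_decomposition hf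
    obtain ⟨r', s', l', hl', rfl⟩ := exists_linear_decomposition hg
    refine ⟨r * r', r * s' + s * r', s * s', C r * l' + C r' * l, C s * l' + C s' * l, l * l',
      ?_, ?_, ?_, ?_⟩
    · simpa using ((isHomogeneous_C _ r).mul hl').add ((isHomogeneous_C _ r').mul hl)
    · simpa using ((isHomogeneous_C _ s).mul hl').add ((isHomogeneous_C _ s').mul hl)
    · exact hl.mul hl'
    · simp only [map_add, map_mul, emb_C]
      ring
  · rintro f g ⟨α, β, γ, l, m, n, hl, hm, hn, rfl⟩ ⟨α', β', γ', l', m', n', hl', hm', hn', rfl⟩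
    refine ⟨α + α', β + β', γ + γ', l + l', m + m', n + n', hl.add hl', hm.add hm', hn.add hn', ?_⟩
    simp only [map_add]
    ring

lemma eval_emb_eq_zero {f : Tern} {n : ℕ} (hf : f.IsHomogeneous n) (hn : n ≠ 0) {v : Fin 5 → ℂ}
    (hv : ∀ i : Fin 3, v (Fin.castLE (by decide) i) = 0) : eval v (emb f) = 0 := by
  rw [emb, eval_rename]
  have : v ∘ Fin.castLE (by decide) = (0 : Fin 3 → ℂ) := funext fun i => hv i
  rw [this, eval_zero]
  exact hf.coeff_eq_zero (by simpa using hn.symm)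

lemma Indep3.ext_span {Λ : Submodule ℂ Quin} (hfin : Module.finrank ℂ Λ = 3) {Q1 Q2 Q3 : Quin}
    (h1 : Q1 ∈ Λ) (h2 : Q2 ∈ Λ) (h3 : Q3 ∈ Λ) (hli : Indep3 Q1 Q2 Q3) :
    Λ = Submodule.span ℂ {Q1, Q2, Q3} := by
  have : FiniteDimensional ℂ Λ := Module.finite_of_finrank_pos (by omega)
  symm
  have hl : LinearIndependent ℂ ![Q1, Q2, Q3] := by
    rw [Fintype.linearIndependent_iff]
    intro c hc
    simp only [Fin.sum_univ_three, Matrix.cons_val] at hc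
    obtain ⟨e0, e1, e2⟩ := hli _ _ _ hc
    intro i
    fin_cases i <;> assumption
  have hr : Set.range ![Q1, Q2, Q3] = {Q1, Q2, Q3} := by
    ext; simp [eq_comm, or_comm, or_left_comm]
  have hc := finrank_span_eq_card hl
  rw [hr, Fintype.card_fin] at hc
  refine Submodule.eq_of_le_of_finrank_eq ?_ (hc.trans hfin.symm)
  rw [Submodule.span_le]
  rintro x (rfl | rfl | rfl) <;> assumption

lemma eval_substHom (g : Matrix (Fin 5) (Fin 5) ℂ) (x : Fin 5 → ℂ) (p : Quin) :
    eval x (substHom g p) = eval (g.mulVec x) p := by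
  induction p using MvPolynomial.induction_on with
  | C a => rw [← algebraMap_eq, AlgHom.commutes]; simp
  | add p q hp hq => simp [hp, hq]
  | mul_X p i hp => simp [hp, substHom_X, eval_lin, Matrix.mulVec, dotProduct]

lemma finrank_span_pair_le_two (u v : Fin 5 → ℂ) :
    Module.finrank ℂ (Submodule.span ℂ {u, v}) ≤ 2 := by
  classical
  refine (finrank_span_le_card _).trans ?_
  rw [Set.toFinset_insert, Set.toFinset_singleton]
  exact Finset.card_le_two

lemma eq_zero_of_det3_ne_zero {x y z : Fin 3 → ℂ} (hd : det3 x y z ≠ 0) {c0 c1 c2 : ℂ}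
    (hx : c0 * x 0 + c1 * x 1 + c2 * x 2 = 0) (hy : c0 * y 0 + c1 * y 1 + c2 * y 2 = 0)
    (hz : c0 * z 0 + c1 * z 1 + c2 * z 2 = 0) : c0 = 0 ∧ c1 = 0 ∧ c2 = 0 := by
  rw [det3] at hd
  refine ⟨(mul_eq_zero.1 ?_).resolve_right hd, (mul_eq_zero.1 ?_).resolve_right hd,
    (mul_eq_zero.1 ?_).resolve_right hd⟩
  · linear_combination (y 1 * z 2 - y 2 * z 1) * hx + (z 1 * x 2 - z 2 * x 1) * hy +
      (x 1 * y 2 - x 2 * y 1) * hz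
  · linear_combination (y 2 * z 0 - y 0 * z 2) * hx + (z 2 * x 0 - z 0 * x 2) * hy +
      (x 2 * y 0 - x 0 * y 2) * hz
  · linear_combination (y 0 * z 1 - y 1 * z 0) * hx + (z 0 * x 1 - z 1 * x 0) * hy +
      (x 0 * y 1 - x 1 * y 0) * hz

/-- In suitable coordinates, a net contains a pencil of normal form. -/
lemma Semistable.exists_normal_form {Λ : Submodule ℂ Quin} (h : Semistable Λ) (hΛ : IsNet Λ)
    {Q : Fin 3 → Quin} (hQ : ∀ i, Q i ∈ Λ) (hli : Indep3 (Q 0) (Q 1) (Q 2)) :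
    ∃ g : Matrix.GeneralLinearGroup (Fin 5) ℂ,
      ∀ r s t : ℂ, ∃ l m n : Tern, l.IsHomogeneous 1 ∧ m.IsHomogeneous 1 ∧ n.IsHomogeneous 2 ∧
        C r * X 3 ^ 2 + C s * (X 3 * X 4) + C t * X 4 ^ 2 - (emb l * X 3 + emb m * X 4 + emb n) ∈
          Λ.map (substMap (g : Matrix (Fin 5) (Fin 5) ℂ)) := by
  choose B hB using fun i => exists_bilin (hΛ.2 _ (hQ i))
  obtain ⟨u, v, hd⟩ := h.exists_det_ne_zero hΛ.2 hQ hli hB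
  have : FiniteDimensional ℂ Λ := Module.finite_of_finrank_pos (by rw [hΛ.1]; norm_num)
  obtain ⟨b, hb⟩ := exists_adapted_basis (Submodule.span ℂ {u, v}) (k := 2)
    (finrank_span_pair_le_two u v)
  have hset : {i : Fin 5 | 5 ≤ (i : ℕ) + 2} = {3, 4} := by ext i; fin_cases i <;> simp
  rw [hset, Set.image_pair] at hb
  have hspan := hli.ext_span hΛ.1 (hQ 0) (hQ 1) (hQ 2)
  have hinj : ∀ P ∈ Λ, eval (b 3) P = 0 → eval (b 4) P = 0 → eval (b 3 + b 4) P = 0 → P = 0 := by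
    intro P hP e3 e4 e34
    have hall : ∀ w ∈ Submodule.span ℂ {b 3, b 4}, eval w P = 0 := by
      intro w hw
      obtain ⟨x, y, rfl⟩ := Submodule.mem_span_pair.1 hw
      obtain ⟨T, hT⟩ := exists_bilin (hΛ.2 P hP)
      rw [hT] at e3 e4 e34 ⊢
      simp only [map_add, LinearMap.add_apply, map_smul, LinearMap.smul_apply,
        smul_eq_mul] at e34 ⊢
      linear_combination x * (x - y) * e3 + y * (y - x) * e4 + x * y * e34
    rw [hspan] at hP
    obtain ⟨c0, c1, c2, rfl⟩ := Submodule.mem_span_triple.1 hP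
    have hu := hall u (hb (Submodule.subset_span (by simp)))
    have hv := hall v (hb (Submodule.subset_span (by simp)))
    have huv := hall (u + v) (Submodule.add_mem _ (hb (Submodule.subset_span (by simp)))
      (hb (Submodule.subset_span (by simp))))
    simp only [map_add, smul_eval, hB, LinearMap.add_apply] at hu hv huv
    obtain ⟨rfl, rfl, rfl⟩ := eq_zero_of_det3_ne_zero hd hu (c0 := c0) (c1 := c1) (c2 := c2)
      (by linear_combination huv - hu - hv) hv
    simp
  let φ : Λ →ₗ[ℂ] Fin 3 → ℂ := LinearMap.pi
    ![(aeval (b 3)).toLinearMap ∘ₗ Λ.subtype, (aeval (b 4)).toLinearMap ∘ₗ Λ.subtype,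
      (aeval (b 3 + b 4)).toLinearMap ∘ₗ Λ.subtype]
  have hφ : Function.Injective φ := by
    rw [← LinearMap.ker_eq_bot, LinearMap.ker_eq_bot']
    rintro ⟨P, hP⟩ h0
    have e0 := congrFun h0 0
    have e1 := congrFun h0 1
    have e2 := congrFun h0 2
    simp [φ, aeval_eq_eval] at e0 e1 e2
    exact Subtype.ext (hinj P hP e0 e1 e2)
  have hφs := (LinearMap.injective_iff_surjective_of_finrank_eq_finrank
    (by rw [hΛ.1, Module.finrank_fin_fun])).1 hφ
  have hB : LinearIndependent ℂ (Matrix.of b).row := b.linearIndependent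
  have hu : IsUnit (Matrix.of b).transpose := by
    rw [Matrix.isUnit_transpose]
    exact Matrix.linearIndependent_rows_iff_isUnit.1 hB
  refine ⟨hu.unit, fun r s t => ?_⟩
  obtain ⟨⟨P, hP⟩, hPφ⟩ := hφs ![r, t, r + s + t]
  have e0 := congrFun hPφ 0
  have e1 := congrFun hPφ 1
  have e2 := congrFun hPφ 2
  simp only [φ, LinearMap.pi_apply, Matrix.cons_val, LinearMap.comp_apply, Submodule.subtype_apply,
    AlgHom.toLinearMap_apply, aeval_eq_eval] at e0 e1 e2
  have hcol : ∀ i, (Matrix.of b).transpose.mulVec (Pi.single i 1) = b i := fun i => by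
    rw [Matrix.mulVec_single_one]; rfl
  have hom : (substHom (Matrix.of b).transpose P).IsHomogeneous 2 := by
    have := (hΛ.2 P hP).aeval (fun i => ∑ j, C ((Matrix.of b).transpose i j) * X j) (n := 1)
      (fun i => isHomogeneous_lin _)
    simpa [substHom] using this
  obtain ⟨α, β, γ, l, m, n, hl, hm, hn, he⟩ := exists_quadratic_decomposition hom
  have key : ∀ x y : ℂ, eval ((Matrix.of b).transpose.mulVec (x • Pi.single 3 1 + y • Pi.single 4 1)) P
      = α * x ^ 2 + β * (x * y) + γ * y ^ 2 := by
    intro x y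
    have hz : ∀ i : Fin 3, (x • Pi.single 3 1 + y • Pi.single 4 1 : Fin 5 → ℂ)
        (Fin.castLE (by decide) i) = 0 := by
      intro i; fin_cases i <;> simp [Fin.castLE, Fin.ext_iff]
    rw [← eval_substHom, he]
    simp only [map_add, map_mul, eval_emb_eq_zero hl one_ne_zero hz,
      eval_emb_eq_zero hm one_ne_zero hz, eval_emb_eq_zero hn two_ne_zero hz, map_pow, eval_C,
      eval_X]
    simp
  have k0 := key 1 0
  have k1 := key 0 1
  have k2 := key 1 1
  simp only [one_smul, zero_smul, add_zero, zero_add, Matrix.mulVec_add, hcol, e0, e1, e2] at k0 k1 k2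
  refine ⟨-l, -m, -n, hl.neg, hm.neg, hn.neg, P, hP, ?_⟩
  rw [IsUnit.unit_spec, substMap_apply, he]
  have a0 : r = α := by linear_combination k0
  have a1 : t = γ := by linear_combination k1
  have a2 : s = β := by linear_combination k2 - k0 - k1
  rw [a0, a1, a2]
  simp only [map_neg]
  ring

/-- Modulo `P`, everything is a combination of `1`, `X i`, `X j` with coefficients in the first
three variables. -/
def Spans (P : Ideal Quin) (i j : Fin 5) : Prop :=
  ∀ f, ∃ a b c : Tern, f - (emb a + emb b * X i + emb c * X j) ∈ P

/-- The net `Λ` contains quadrics with leading terms `X i ^ 2`, `X i * X j`, `X j ^ 2`. -/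
structure NormalForm (Λ : Submodule ℂ Quin) (i j : Fin 5) (l m n : Fin 3 → Tern) : Prop where
  idx : (i = 3 ∧ j = 4) ∨ (i = 4 ∧ j = 3)
  hl : ∀ k, (l k).IsHomogeneous 1
  hm : ∀ k, (m k).IsHomogeneous 1
  hn : ∀ k, (n k).IsHomogeneous 2
  mem0 : X i ^ 2 - (emb (l 0) * X i + emb (m 0) * X j + emb (n 0)) ∈ Λ
  mem1 : X i * X j - (emb (l 1) * X i + emb (m 1) * X j + emb (n 1)) ∈ Λ
  mem2 : X j ^ 2 - (emb (l 2) * X i + emb (m 2) * X j + emb (n 2)) ∈ Λ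

lemma NormalForm.symm {Λ : Submodule ℂ Quin} {i j : Fin 5} {l m n : Fin 3 → Tern}
    (h : NormalForm Λ i j l m n) :
    NormalForm Λ j i (fun k => m k.rev) (fun k => l k.rev) (fun k => n k.rev) where
  idx := h.idx.symm.imp And.symm And.symm
  hl k := h.hm _
  hm k := h.hl _
  hn k := h.hn _
  mem0 := by
    have := h.mem2
    rw [add_comm (emb (l 2) * X i)] at this
    exact this
  mem1 := by
    have := h.mem1
    rw [add_comm (emb (l 1) * X i), mul_comm (X i)] at this
    exact this
  mem2 := by
    have := h.mem0
    rw [add_comm (emb (l 0) * X i)] at this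
    exact this

lemma NormalForm.spans {Λ : Submodule ℂ Quin} {i j : Fin 5} {l m n : Fin 3 → Tern}
    (h : NormalForm Λ i j l m n) {P : Ideal Quin} (hP : ∀ Q ∈ Λ, Q ∈ P) : Spans P i j := by
  intro f
  induction f using MvPolynomial.induction_on with
  | C r => exact ⟨C r, 0, 0, by simp⟩
  | add f g hf hg =>
    obtain ⟨a, b, c, h1⟩ := hf
    obtain ⟨a', b', c', h2⟩ := hg
    refine ⟨a + a', b + b', c + c', ?_⟩
    convert P.add_mem h1 h2 using 1
    simp only [map_add]; ring
  | mul_X f k hf =>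
    obtain ⟨a, b, c, h1⟩ := hf
    have h0 := P.mul_mem_right (X k) h1
    have hk : (∃ k', X k = emb (X k')) ∨ k = i ∨ k = j := by
      by_cases hk : (k : ℕ) < 3
      · exact Or.inl ⟨⟨k, hk⟩, by rw [emb, rename_X]; rfl⟩
      · right; have := h.idx; omega
    rcases hk with ⟨k', hk⟩ | rfl | rfl
    · refine ⟨a * X k', b * X k', c * X k', ?_⟩
      convert h0 using 1
      rw [hk]; simp only [map_mul]; ring
    · refine ⟨b * n 0 + c * n 1, a + b * l 0 + c * l 1, b * m 0 + c * m 1, ?_⟩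
      convert P.add_mem h0 (P.add_mem (P.mul_mem_left (emb b) (hP _ h.mem0))
        (P.mul_mem_left (emb c) (hP _ h.mem1))) using 1
      simp only [map_mul, map_add]; ring
    · refine ⟨b * n 1 + c * n 2, b * l 1 + c * l 2, a + b * m 1 + c * m 2, ?_⟩
      convert P.add_mem h0 (P.add_mem (P.mul_mem_left (emb b) (hP _ h.mem1))
        (P.mul_mem_left (emb c) (hP _ h.mem2))) using 1
      simp only [map_mul, map_add]; ring

lemma Spans.symm {P : Ideal Quin} {i j : Fin 5} (h : Spans P i j) : Spans P j i := fun f => by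
  obtain ⟨a, b, c, hf⟩ := h f
  exact ⟨a, c, b, by convert hf using 1; ring⟩

section

variable {P : Ideal Quin} {i j : Fin 5}

lemma Spans.isIntegral (h : Spans P i j) :
    ((Ideal.Quotient.mk P).comp (emb : Tern →+* Quin)).IsIntegral := by
  let : Algebra Tern (Quin ⧸ P) := ((Ideal.Quotient.mk P).comp (emb : Tern →+* Quin)).toAlgebra
  have hfin : Module.Finite Tern (Quin ⧸ P) := by
    classical
    refine ⟨⟨{1, Ideal.Quotient.mk P (X i), Ideal.Quotient.mk P (X j)}, ?_⟩⟩
    rw [eq_top_iff]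
    rintro x -
    obtain ⟨f, rfl⟩ := Ideal.Quotient.mk_surjective x
    obtain ⟨a, b, c, hf⟩ := h f
    rw [Ideal.Quotient.eq.2 hf]
    have e : Ideal.Quotient.mk P (emb a + emb b * X i + emb c * X j) =
      a • 1 + b • Ideal.Quotient.mk P (X i) + c • Ideal.Quotient.mk P (X j) := by
      simp [Algebra.smul_def, RingHom.algebraMap_toAlgebra]
    rw [e]
    refine Submodule.add_mem _ (Submodule.add_mem _ ?_ ?_) ?_ <;>
      exact Submodule.smul_mem _ _ (Submodule.subset_span (by simp))
  exact (Algebra.IsIntegral.of_finite Tern (Quin ⧸ P)).isIntegral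

lemma Spans.exists_monic (h : Spans P i j) (y : Quin) :
    ∃ p : Polynomial Tern, p.Monic ∧ p.eval₂ (emb : Tern →+* Quin) y ∈ P := by
  obtain ⟨p, hp, hy⟩ := h.isIntegral (Ideal.Quotient.mk P y)
  refine ⟨p, hp, ?_⟩
  rw [← Polynomial.hom_eval₂] at hy
  exact Ideal.Quotient.eq_zero_iff_mem.1 hy

lemma height_add_coheight_tern_le (P : PrimeSpectrum Tern) :
    Order.height P + Order.coheight P ≤ 3 := by
  have h := Order.krullDim_eq_iSup_height_add_coheight_of_nonempty (α := PrimeSpectrum Tern)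
  have h5 : ringKrullDim Tern = 3 := by
    rw [MvPolynomial.ringKrullDim_of_isNoetherianRing, ringKrullDim_eq_zero_of_field]
    simp
  rw [ringKrullDim, h] at h5
  have h6 := le_iSup (fun a : PrimeSpectrum Tern => Order.height a + Order.coheight a) P
  have : ((⨆ a : PrimeSpectrum Tern, (Order.height a + Order.coheight a) : ℕ∞) : WithBot ℕ∞)
    = ((3 : ℕ∞) : WithBot ℕ∞) := h5
  rw [WithBot.coe_inj] at this
  exact h6.trans_eq this

lemma Spans.emb_mem (h : Spans P i j) [hP : P.IsPrime]
    (hc : 3 ≤ Order.coheight (⟨P, hP⟩ : PrimeSpectrum Quin)) {a : Tern} (ha : emb a ∈ P) :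
    a = 0 := by
  let φ : PrimeSpectrum Quin → PrimeSpectrum Tern := PrimeSpectrum.comap (emb : Tern →+* Quin)
  have hφ : StrictMono fun I : Set.Ici (⟨P, hP⟩ : PrimeSpectrum Quin) =>
      (⟨φ I.1, fun x hx => I.2 hx⟩ : Set.Ici (φ ⟨P, hP⟩)) := by
    rintro ⟨I, hI⟩ ⟨J, hJ⟩ hIJ
    obtain ⟨hle, x, hxJ, hxI⟩ := SetLike.lt_iff_le_and_exists.1
      (show I.asIdeal < J.asIdeal from hIJ)
    obtain ⟨p, hp, hpx⟩ := h.exists_monic x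
    exact Ideal.comap_lt_comap_of_root_mem_sdiff hle ⟨hxJ, hxI⟩
      (Polynomial.map_monic_ne_zero hp) (hI hpx)
  have h1 := Order.krullDim_le_of_strictMono _ hφ
  rw [← Order.coheight_eq_krullDim_Ici, ← Order.coheight_eq_krullDim_Ici, WithBot.coe_le_coe] at h1
  by_contra hne
  have h2 : (1 : ℕ∞) ≤ Order.height (φ ⟨P, hP⟩) := by
    rw [Order.one_le_iff_ne_zero, Ne, Order.height_eq_zero]
    intro hmin
    have := hmin (b := ⟨⊥, Ideal.isPrime_bot⟩) bot_le (show a ∈ (φ ⟨P, hP⟩).asIdeal from ha)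
    exact hne (by simpa using this)
  have h3 := (add_le_add h2 (hc.trans h1)).trans (height_add_coheight_tern_le _)
  exact absurd h3 (by decide)

lemma Spans.exists_monic_natDegree_le [P.IsPrime] (h : Spans P i j)
    (hA : ∀ a, emb a ∈ P → a = 0) {y : Quin} {f : Polynomial Tern} (hf : f ≠ 0)
    (hy : f.eval₂ (emb : Tern →+* Quin) y ∈ P) :
    ∃ p : Polynomial Tern, p.Monic ∧ p.natDegree ≤ f.natDegree ∧
      p.eval₂ (emb : Tern →+* Quin) y ∈ P := by
  let : Algebra Tern (Quin ⧸ P) := ((Ideal.Quotient.mk P).comp (emb : Tern →+* Quin)).toAlgebra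
  have hinj : Function.Injective (algebraMap Tern (Quin ⧸ P)) := by
    rw [injective_iff_map_eq_zero]
    exact fun a ha => hA a (Ideal.Quotient.eq_zero_iff_mem.1 ha)
  have : FaithfulSMul Tern (Quin ⧸ P) := (faithfulSMul_iff_algebraMap_injective _ _).2 hinj
  have hz : ∀ p : Polynomial Tern, Polynomial.aeval (Ideal.Quotient.mk P y) p =
      Ideal.Quotient.mk P (p.eval₂ (emb : Tern →+* Quin) y) := fun p => by
    rw [Polynomial.hom_eval₂]; rfl
  have hint : IsIntegral Tern (Ideal.Quotient.mk P y) := h.isIntegral _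
  refine ⟨minpoly Tern (Ideal.Quotient.mk P y), minpoly.monic hint, ?_, ?_⟩
  · refine Polynomial.natDegree_le_of_dvd (minpoly.isIntegrallyClosed_dvd hint ?_) hf
    rw [hz, Ideal.Quotient.eq_zero_iff_mem]
    exact hy
  · rw [← Ideal.Quotient.eq_zero_iff_mem, ← hz]
    exact minpoly.aeval _ _

lemma Spans.exists_add_mem [hP : P.IsPrime] (h : Spans P i j) (hA : ∀ a, emb a ∈ P → a = 0)
    {y : Quin} {a b : Tern} (ha : a ≠ 0) (hy : emb a * y + emb b ∈ P) :
    ∃ s, y + emb s ∈ P := by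
  obtain ⟨p, hp, hd, hpy⟩ := h.exists_monic_natDegree_le hA (y := y)
    (f := Polynomial.C a * Polynomial.X + Polynomial.C b)
    (fun h0 => ha (by simpa using congrArg (fun q => q.coeff 1) h0)) (by simpa using hy)
  have hd1 := hd.trans (Polynomial.natDegree_linear_le)
  have hd0 : p.natDegree ≠ 0 := fun h0 => by
    rw [hp.natDegree_eq_zero.1 h0, Polynomial.eval₂_one] at hpy
    exact hP.ne_top ((Ideal.eq_top_iff_one _).2 hpy)
  have he := hp.eq_X_add_C (by omega)
  exact ⟨p.coeff 0, by rw [he] at hpy; simpa using hpy⟩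

lemma Spans.exists_sq_add_mem [hP : P.IsPrime] (h : Spans P i j) (hA : ∀ a, emb a ∈ P → a = 0)
    {y : Quin} {a b c : Tern} (ha : a ≠ 0) (hy : emb a * y ^ 2 + emb b * y + emb c ∈ P) :
    ∃ s t, y ^ 2 + emb s * y + emb t ∈ P := by
  obtain ⟨p, hp, hd, hpy⟩ := h.exists_monic_natDegree_le hA (y := y)
    (f := Polynomial.C a * Polynomial.X ^ 2 + Polynomial.C b * Polynomial.X + Polynomial.C c)
    (fun h0 => ha (by simpa using congrArg (fun q => q.coeff 2) h0)) (by simpa using hy)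
  have hd2 := hd.trans (Polynomial.natDegree_quadratic_le)
  have hd0 : p.natDegree ≠ 0 := fun h0 => by
    rw [hp.natDegree_eq_zero.1 h0, Polynomial.eval₂_one] at hpy
    exact hP.ne_top ((Ideal.eq_top_iff_one _).2 hpy)
  obtain h1 | h1 : p.natDegree = 1 ∨ p.natDegree = 2 := by omega
  · rw [hp.eq_X_add_C h1] at hpy
    refine ⟨p.coeff 0, 0, ?_⟩
    convert P.mul_mem_left y hpy using 1
    simp; ring
  · refine ⟨p.coeff 1, p.coeff 0, ?_⟩
    have hl : p.coeff 2 = 1 := by rw [← h1]; exact hp.coeff_natDegree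
    rw [Polynomial.eval₂_eq_sum_range, h1] at hpy
    simp only [Finset.sum_range_succ, Finset.sum_range_zero, hl] at hpy
    convert hpy using 1
    simp; ring

end

lemma homogeneousComponent_mul_of_isHomogeneous {σ : Type*} {f : MvPolynomial σ ℂ} {n : ℕ}
    (hf : f.IsHomogeneous n) (k : ℕ) (p : MvPolynomial σ ℂ) :
    homogeneousComponent (k + n) (p * f) = homogeneousComponent k p * f := by
  have h1 : ∀ i, homogeneousComponent (k + n) (homogeneousComponent i p * f) =
      if k = i then homogeneousComponent k p * f else 0 := by
    intro i
    rw [homogeneousComponent_of_mem ((homogeneousComponent_isHomogeneous i p).mul hf)]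
    by_cases hk : k = i
    · simp [hk]
    · simp [hk]
  conv_lhs => rw [← sum_homogeneousComponent p]
  rw [Finset.sum_mul, map_sum, Finset.sum_congr rfl fun i _ => h1 i, Finset.sum_ite_eq]
  split_ifs with hk
  · rfl
  · rw [Finset.mem_range, not_lt] at hk
    rw [homogeneousComponent_eq_zero _ _ (by omega), zero_mul]

namespace NormalForm

variable {Λ : Submodule ℂ Quin} {i j : Fin 5} {l m n : Fin 3 → Tern}

lemma ne (h : NormalForm Λ i j l m n) : i ≠ j := by
  rcases h.idx with ⟨rfl, rfl⟩ | ⟨rfl, rfl⟩ <;> decide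

lemma eval_emb (h : NormalForm Λ i j l m n) {f : Tern} {k : ℕ} (hf : f.IsHomogeneous k) (hk : k ≠ 0)
    (x y : ℂ) : eval (x • Pi.single i 1 + y • Pi.single j 1) (emb f) = 0 := by
  refine eval_emb_eq_zero hf hk fun k' => ?_
  rcases h.idx with ⟨rfl, rfl⟩ | ⟨rfl, rfl⟩ <;> fin_cases k' <;> simp [Fin.castLE, Fin.ext_iff]

lemma indep (h : NormalForm Λ i j l m n) :
    Indep3 (X i ^ 2 - (emb (l 0) * X i + emb (m 0) * X j + emb (n 0)))
      (X i * X j - (emb (l 1) * X i + emb (m 1) * X j + emb (n 1)))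
      (X j ^ 2 - (emb (l 2) * X i + emb (m 2) * X j + emb (n 2))) := by
  intro a b c h0
  have hij := h.ne
  have key : ∀ x y : ℂ, a * x ^ 2 + b * (x * y) + c * y ^ 2 = 0 := by
    intro x y
    have := congrArg (eval (x • Pi.single i 1 + y • Pi.single j 1 : Fin 5 → ℂ)) h0
    simp only [map_add, map_sub, map_mul, smul_eval, map_pow, eval_X, map_zero,
      h.eval_emb (h.hl _) one_ne_zero, h.eval_emb (h.hm _) one_ne_zero,
      h.eval_emb (h.hn _) two_ne_zero] at this
    simpa [hij, hij.symm] using this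
  have k0 := key 1 0
  have k1 := key 0 1
  have k2 := key 1 1
  exact ⟨by linear_combination k0, by linear_combination k2 - k0 - k1, by linear_combination k1⟩

/-- A homogeneous prime containing the net gives a linear relation over the first variables. -/
lemma exists_relation (h : NormalForm Λ i j l m n) (hss : Semistable Λ)
    (hfin : Module.finrank ℂ Λ = 3) {P : Ideal Quin} (hP : ∀ Q ∈ Λ, Q ∈ P) :
    ∃ α β γ : Tern, ¬ (α = 0 ∧ β = 0 ∧ γ = 0) ∧ emb α * X i + emb β * X j + emb γ ∈ P := by
  by_contra! hfree
  have q0 := hP _ h.mem0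
  have q1 := hP _ h.mem1
  have q2 := hP _ h.mem2
  have hfree' : ∀ α β γ : Tern, emb α * X i + emb β * X j + emb γ ∈ P → α = 0 ∧ β = 0 := by
    intro α β γ hm
    by_contra hc
    exact hfree α β γ (fun h1 h2 => absurd ⟨h1, h2⟩ hc) hm
  have hl := h.hl
  have hm := h.hm
  have r1 := hfree' (n 1 + l 1 * m 1 - m 0 * l 2)
    (-(n 0 + l 0 * m 1 + m 0 * l 1 - m 1 ^ 2 + m 0 * (m 2 - 2 * l 1)))
    (-(n 1 + l 1 * m 1 - m 0 * l 2) * m 1 +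
      (n 0 + l 0 * m 1 + m 0 * l 1 - m 1 ^ 2 + m 0 * (m 2 - 2 * l 1)) * l 1 -
      (l 0 - 2 * m 1) * (n 1 + l 1 * m 1) -
      m 0 * (n 2 + l 2 * m 1 + m 2 * l 1 - l 1 ^ 2)) (by
    convert P.add_mem (P.add_mem (P.mul_mem_left (X j - emb (l 1)) q0)
      (P.mul_mem_left (-(X i - emb (m 1)) + emb (l 0 - 2 * m 1)) q1))
      (P.mul_mem_left (emb (m 0)) q2) using 1
    simp only [map_add, map_sub, map_mul, map_neg, map_pow, map_ofNat]
    ring)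
  have r3 := hfree' (-(n 2 + l 2 * m 1 + m 2 * l 1 - l 1 ^ 2 + l 2 * (l 0 - 2 * m 1)))
    (n 1 + l 1 * m 1 - m 0 * l 2)
    ((n 2 + l 2 * m 1 + m 2 * l 1 - l 1 ^ 2 + l 2 * (l 0 - 2 * m 1)) * m 1 -
      (n 1 + l 1 * m 1 - m 0 * l 2) * l 1 -
      (m 2 - 2 * l 1) * (n 1 + l 1 * m 1) -
      l 2 * (n 0 + l 0 * m 1 + m 0 * l 1 - m 1 ^ 2)) (by
    convert P.add_mem (P.add_mem (P.mul_mem_left (X i - emb (m 1)) q2)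
      (P.mul_mem_left (-(X j - emb (l 1)) + emb (m 2 - 2 * l 1)) q1))
      (P.mul_mem_left (emb (l 2)) q0) using 1
    simp only [map_add, map_sub, map_mul, map_neg, map_pow, map_ofNat]
    ring)
  have k1 := congrArg emb r1.1
  have k2 := congrArg emb r1.2
  have k3 := congrArg emb r3.1
  simp only [map_add, map_sub, map_mul, map_neg, map_pow, map_ofNat, map_zero] at k1 k2 k3
  have hX := isHomogeneous_X ℂ (σ := Fin 5)
  obtain ⟨p0, hp0⟩ := exists_lin ((hX i).sub (emb_isHomogeneous (hm 1)))
  obtain ⟨p1, hp1⟩ := exists_lin (emb_isHomogeneous (hl 2))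
  obtain ⟨p2, hp2⟩ := exists_lin ((hX j).sub (emb_isHomogeneous ((hm 2).sub (hl 1))))
  obtain ⟨s0, hs0⟩ := exists_lin (emb_isHomogeneous (hm 0))
  obtain ⟨s1, hs1⟩ := exists_lin ((hX j).sub (emb_isHomogeneous (hl 1)))
  obtain ⟨s2, hs2⟩ := exists_lin ((hX i).sub (emb_isHomogeneous ((hl 0).sub (hm 1))))
  simp only [map_sub] at hp2 hs2
  have hind : Indep3 (-(X j ^ 2 - (emb (l 2) * X i + emb (m 2) * X j + emb (n 2))))
      (-(X i ^ 2 - (emb (l 0) * X i + emb (m 0) * X j + emb (n 0))))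
      (X i * X j - (emb (l 1) * X i + emb (m 1) * X j + emb (n 1))) := by
    intro a b c h0
    obtain ⟨e1, e2, e3⟩ := h.indep (-b) c (-a) (by rw [← h0]; module)
    exact ⟨neg_eq_zero.1 e3, neg_eq_zero.1 e1, e2⟩
  refine hss.not_minors (hind.ext_span hfin (Λ.neg_mem h.mem2) (Λ.neg_mem h.mem0) h.mem1) hind
    (p0 := p0) (p1 := p1) (p2 := p2) (q0 := s0) (q1 := s1) (q2 := s2) ?_ ?_ ?_
  · rw [← hp1, ← hs2, ← hp2, ← hs1]
    linear_combination -k3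
  · rw [← hp2, ← hs0, ← hp0, ← hs2]
    linear_combination -k2
  · rw [← hp0, ← hs1, ← hp1, ← hs0]
    linear_combination -k1

end NormalForm

/-- If `b ^ 2 * f = a ^ 2 * g` with `f`, `g` nonzero quadrics and `a`, `b` coprime, then `a`, `b`
are constants or `f` is the square of a multiple of `b`. -/
lemma sq_factor {f g a b : Tern} (hf : f.IsHomogeneous 2) (hg : g.IsHomogeneous 2) (hf0 : f ≠ 0)
    (hg0 : g ≠ 0) (hab : IsRelPrime a b) (h : a ^ 2 * f = b ^ 2 * g) :
    ((∃ r, a = C r) ∧ ∃ t, b = C t) ∨ ∃ k, f = (C k * b) ^ 2 := by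
  obtain ⟨w, rfl⟩ : b ^ 2 ∣ f :=
    (hab.symm.pow (m := 2) (n := 2)).dvd_of_dvd_mul_left ⟨g, h⟩
  have hb : b ≠ 0 := fun hb => hf0 (by simp [hb])
  have hw : w ≠ 0 := fun hw => hf0 (by simp [hw])
  obtain rfl : a ^ 2 * w = g := mul_left_cancel₀ (pow_ne_zero 2 hb) (by rw [← h]; ring)
  have ha : a ≠ 0 := fun ha => hg0 (by simp [ha])
  have d1 := hf.totalDegree hf0
  have d2 := hg.totalDegree hg0
  rw [totalDegree_mul_of_isDomain (pow_ne_zero 2 hb) hw, pow_two,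
    totalDegree_mul_of_isDomain hb hb] at d1
  rw [totalDegree_mul_of_isDomain (pow_ne_zero 2 ha) hw, pow_two,
    totalDegree_mul_of_isDomain ha ha] at d2
  rcases Nat.eq_zero_or_pos b.totalDegree with h0 | h0
  · exact Or.inl ⟨⟨_, totalDegree_eq_zero_iff_eq_C.1 (by omega)⟩,
      ⟨_, totalDegree_eq_zero_iff_eq_C.1 h0⟩⟩
  · right
    rw [totalDegree_eq_zero_iff_eq_C.1 (show w.totalDegree = 0 by omega)]
    obtain ⟨k, hk⟩ := IsAlgClosed.exists_pow_nat_eq (coeff 0 w) (n := 2) (by norm_num)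
    exact ⟨k, by rw [← hk, C_pow]; ring⟩

namespace NormalForm

variable {Λ : Submodule ℂ Quin} {i j : Fin 5} {l m n : Fin 3 → Tern}

/-- `X i` is, up to translation, a square root of a ternary quadric. -/
lemma exists_sq_sub_mem (h : NormalForm Λ i j l m n) {P : Ideal Quin} [P.IsPrime]
    (hP : ∀ Q ∈ Λ, Q ∈ P) (hH : ∀ f ∈ P, ∀ k, homogeneousComponent k f ∈ P)
    (hA : ∀ a, emb a ∈ P → a = 0) {α β γ : Tern} (hβ : β ≠ 0)
    (hr : emb α * X i + emb β * X j + emb γ ∈ P) :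
    ∃ u f : Tern, u.IsHomogeneous 1 ∧ f.IsHomogeneous 2 ∧ (X i + emb u) ^ 2 - emb f ∈ P := by
  obtain ⟨s, t, hst⟩ := (h.spans hP).exists_sq_add_mem hA (y := X i) (b := m 0 * α - β * l 0)
    (c := m 0 * γ - β * n 0) hβ (by
      convert P.add_mem (P.mul_mem_left (emb β) (hP _ h.mem0)) (P.mul_mem_left (emb (m 0)) hr) using 1
      simp only [map_sub, map_mul]
      ring)
  have h2 := hH _ hst 2
  rw [map_add, map_add, homogeneousComponent_eq_self (by simpa using (isHomogeneous_X ℂ i).pow 2),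
    homogeneousComponent_mul_of_isHomogeneous (isHomogeneous_X ℂ i) 1, emb_homogeneousComponent,
    emb_homogeneousComponent] at h2
  have hs := homogeneousComponent_isHomogeneous 1 s
  have ht := homogeneousComponent_isHomogeneous 2 t
  generalize homogeneousComponent 1 s = s at *
  generalize homogeneousComponent 2 t = t at *
  have hs' : (C (1 / 2) * s).IsHomogeneous 1 := by
    simpa using (isHomogeneous_C (Fin 3) (1 / 2 : ℂ)).mul hs
  refine ⟨C (1 / 2) * s, (C (1 / 2) * s) ^ 2 - t, hs', (hs'.pow 2).sub ht, ?_⟩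
  convert h2 using 1
  have hC : (C (1 / 2) : Quin) * 2 = 1 := by
    rw [← map_ofNat C 2, ← C_mul]; norm_num
  simp only [map_sub, map_mul, map_pow, emb_C]
  linear_combination (X i * emb s) * hC

set_option maxHeartbeats 1000000 in
/-- A homogeneous prime containing the net contains a linear form. -/
lemma exists_linear_mem (h : NormalForm Λ i j l m n) (hss : Semistable Λ)
    (hfin : Module.finrank ℂ Λ = 3) {P : Ideal Quin} [hPp : P.IsPrime]
    (hP : ∀ Q ∈ Λ, Q ∈ P) (hH : ∀ f ∈ P, ∀ k, homogeneousComponent k f ∈ P)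
    (hA : ∀ a, emb a ∈ P → a = 0) :
    ∃ (r t : ℂ) (s : Tern), C r * X i + C t * X j + emb s ∈ P ∧ ¬ (r = 0 ∧ t = 0) := by
  by_contra! hno
  have hno1 : ∀ s, X i + emb s ∉ P := fun s hs =>
    one_ne_zero (hno 1 0 s (by simpa using hs)).1
  have hno2 : ∀ s, X j + emb s ∉ P := fun s hs =>
    one_ne_zero (hno 0 1 s (by simpa using hs)).2
  have hsp := h.spans hP
  obtain ⟨α, β, γ, hne, hr⟩ := h.exists_relation hss hfin hP
  have hβ : β ≠ 0 := by
    rintro rfl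
    have hα : α ≠ 0 := by
      rintro rfl
      exact hne ⟨rfl, rfl, hA _ (by simpa using hr)⟩
    obtain ⟨s, hs⟩ := hsp.exists_add_mem hA hα (y := X i) (b := γ) (by simpa using hr)
    exact hno1 s hs
  have hα : α ≠ 0 := by
    rintro rfl
    obtain ⟨s, hs⟩ := hsp.exists_add_mem hA hβ (y := X j) (b := γ) (by simpa using hr)
    exact hno2 s hs
  obtain ⟨u, f, hu, hf, huf⟩ := h.exists_sq_sub_mem hP hH hA hβ hr
  obtain ⟨v, g, hv, hg, hvg⟩ := h.symm.exists_sq_sub_mem hP hH hA hα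
    (by rwa [add_comm (emb α * X i)] at hr)
  have hγ : γ = α * u + β * v := by
    by_contra hγ
    obtain ⟨s, hs⟩ := hsp.exists_add_mem hA (a := 2 * α * (γ - α * u - β * v))
      (b := α ^ 2 * f + (γ - α * u - β * v) ^ 2 - β ^ 2 * g) (y := X i + emb u)
      (mul_ne_zero (mul_ne_zero two_ne_zero hα) (fun h0 => hγ (by linear_combination h0))) (by
      convert P.add_mem (P.add_mem (P.mul_mem_left (-emb α ^ 2) huf)
        (P.mul_mem_left (emb β ^ 2) hvg)) (P.mul_mem_left
          (emb α * (X i + emb u) + emb (γ - α * u - β * v) - emb β * (X j + emb v)) hr) using 1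
      simp only [map_sub, map_mul, map_pow, map_add, map_ofNat]
      ring)
    exact hno1 (u + s) (by convert hs using 1; rw [map_add]; ring)
  subst hγ
  obtain ⟨α', β', c, hrel, rfl, rfl⟩ := UniqueFactorizationMonoid.exists_reduced_factors α hα β
  have hr' : emb α' * (X i + emb u) + emb β' * (X j + emb v) ∈ P := by
    refine (hPp.mem_or_mem (x := emb c) ?_).resolve_left
      fun hc => hα (by rw [hA _ hc, zero_mul])
    convert hr using 1
    simp only [map_mul, map_add]
    ring
  have hfg : α' ^ 2 * f = β' ^ 2 * g := by
    rw [← sub_eq_zero]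
    apply hA
    convert P.add_mem (P.add_mem (P.mul_mem_left (-emb α' ^ 2) huf)
        (P.mul_mem_left (emb β' ^ 2) hvg)) (P.mul_mem_left
          (emb α' * (X i + emb u) - emb β' * (X j + emb v)) hr') using 1
    simp only [map_sub, map_mul, map_pow]
    ring
  have hf0 : f ≠ 0 := by
    rintro rfl
    exact hno1 u (hPp.mem_of_pow_mem 2 (by simpa using huf))
  have hg0 : g ≠ 0 := by
    rintro rfl
    exact hno2 v (hPp.mem_of_pow_mem 2 (by simpa using hvg))
  rcases sq_factor hf hg hf0 hg0 hrel hfg with ⟨⟨r, rfl⟩, t, rfl⟩ | ⟨k, rfl⟩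
  · have := (hno r t (C r * u + C t * v) (by
      convert hr' using 1
      simp only [map_add, map_mul, emb_C]
      ring)).1
    exact hα (by rw [this]; simp)
  · rcases hPp.mem_or_mem (x := X i + emb u - emb (C k * β')) (y := X i + emb u + emb (C k * β'))
      (by convert huf using 1; rw [map_pow]; ring) with hm | hm
    · exact hno1 (u - C k * β') (by convert hm using 1; rw [map_sub]; ring)
    · exact hno1 (u + C k * β') (by convert hm using 1; rw [map_add]; ring)

lemma exists_sub_emb_mem (h : NormalForm Λ i j l m n) {r : ℂ} {s t : Tern} {J : Ideal Quin}
    (h1 : X j + C r * X i + emb s ∈ J) (h2 : X i + emb t ∈ J) (f : Quin) :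
    ∃ a, f - emb a ∈ J := by
  induction f using MvPolynomial.induction_on with
  | C r => exact ⟨C r, by simp⟩
  | add f g hf hg =>
    obtain ⟨a, ha⟩ := hf
    obtain ⟨b, hb⟩ := hg
    exact ⟨a + b, by convert J.add_mem ha hb using 1; rw [map_add]; ring⟩
  | mul_X f k hf =>
    obtain ⟨a, ha⟩ := hf
    have hk : (∃ k', X k = emb (X k')) ∨ k = i ∨ k = j := by
      by_cases hk : (k : ℕ) < 3
      · exact Or.inl ⟨⟨k, hk⟩, by rw [emb, rename_X]; rfl⟩
      · right; have := h.idx; omega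
    obtain ⟨b, hb⟩ : ∃ b, X k - emb b ∈ J := by
      rcases hk with ⟨k', hk⟩ | rfl | rfl
      · exact ⟨X k', by simp [hk]⟩
      · exact ⟨-t, by simpa using h2⟩
      · refine ⟨C r * t - s, ?_⟩
        convert J.sub_mem h1 (J.mul_mem_left (C r) h2) using 1
        simp only [map_sub, map_mul, emb_C]
        ring
    refine ⟨a * b, ?_⟩
    convert J.add_mem (J.mul_mem_right (X k) ha) (J.mul_mem_left (emb a) hb) using 1
    rw [map_mul]
    ring

lemma not_linear_mem (h : NormalForm Λ i j l m n) (hss : Semistable Λ)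
    {P : Ideal Quin} [hPp : P.IsPrime]
    (hP : ∀ Q ∈ Λ, Q ∈ P) (hH : ∀ f ∈ P, ∀ k, homogeneousComponent k f ∈ P)
    (hA : ∀ a, emb a ∈ P → a = 0) {r : ℂ} {s : Tern} (hm : X j + C r * X i + emb s ∈ P) : False := by
  have hX := isHomogeneous_X ℂ (σ := Fin 5)
  obtain ⟨s, hs, hm⟩ : ∃ s, s.IsHomogeneous 1 ∧ X j + C r * X i + emb s ∈ P := by
    refine ⟨_, homogeneousComponent_isHomogeneous 1 s, ?_⟩
    have := hH _ hm 1
    rwa [map_add, map_add, homogeneousComponent_C_mul, homogeneousComponent_eq_self (hX i),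
      homogeneousComponent_eq_self (hX j), emb_homogeneousComponent] at this
  have hCX : (C r * X i : Quin).IsHomogeneous 1 := by
    simpa using (isHomogeneous_C (Fin 5) r).mul (hX i)
  obtain ⟨v, hv⟩ := exists_lin (((hX j).add hCX).add (emb_isHomogeneous hs))
  by_cases hcase : ∃ t, X i + emb t ∈ P
  · obtain ⟨t, ht⟩ := hcase
    obtain ⟨t, ht1, ht⟩ : ∃ t, t.IsHomogeneous 1 ∧ X i + emb t ∈ P := by
      refine ⟨_, homogeneousComponent_isHomogeneous 1 t, ?_⟩
      have := hH _ ht 1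
      rwa [map_add, homogeneousComponent_eq_self (hX i), emb_homogeneousComponent] at this
    obtain ⟨w, hw⟩ := exists_lin ((hX i).add (emb_isHomogeneous ht1))
    have hle : linIdeal (Submodule.span ℂ {v, w}) ≤ P := by
      rw [linIdeal, Ideal.span_le]
      rintro _ ⟨x, hx, rfl⟩
      obtain ⟨a, b, rfl⟩ := Submodule.mem_span_pair.1 hx
      rw [map_add, map_smul, map_smul, smul_eq_C_mul, smul_eq_C_mul, ← hv, ← hw]
      exact P.add_mem (P.mul_mem_left _ hm) (P.mul_mem_left _ ht)
    refine hss.not_le_linIdeal _ (finrank_span_pair_le_two v w) fun Q hQ => ?_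
    obtain ⟨a, ha⟩ := h.exists_sub_emb_mem (J := linIdeal (Submodule.span ℂ {v, w}))
      (by rw [hv]; exact lin_mem_linIdeal (Submodule.subset_span (by simp)))
      (by rw [hw]; exact lin_mem_linIdeal (Submodule.subset_span (by simp))) Q
    have : a = 0 := hA _ (by
      convert P.sub_mem (hP Q hQ) (hle ha) using 1
      ring)
    simpa [this] using ha
  · push Not at hcase
    have hred : ∀ a b, emb a * X i + emb b ∈ P → a = 0 ∧ b = 0 := by
      intro a b hab
      have ha : a = 0 := by
        by_contra ha
        obtain ⟨t, ht⟩ := (h.spans hP).exists_add_mem hA ha hab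
        exact hcase t ht
      exact ⟨ha, hA _ (by simpa [ha] using hab)⟩
    have m1 := Λ.add_mem h.mem1 (Λ.smul_mem r h.mem0)
    have m2 := Λ.sub_mem h.mem2 (Λ.smul_mem (r ^ 2) h.mem0)
    have hdvd : ∀ Q ∈ Λ, ∀ q a b, Q = q * lin v + (emb a * X i + emb b) → lin v ∣ Q := by
      rintro Q hQ q a b rfl
      obtain ⟨rfl, rfl⟩ := hred a b (by
        convert P.sub_mem (hP _ hQ) (P.mul_mem_left q (hv ▸ hm)) using 1
        ring)
      simp
    refine hss.no_linear_factor m1 m2 ?_ v (hdvd _ m1 (X i - emb (m 1) - C r * emb (m 0))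
      (-s - l 1 + C r * m 1 - C r * l 0 + C r ^ 2 * m 0)
      (m 1 * s - n 1 + C r * m 0 * s - C r * n 0) ?_)
      (hdvd _ m2 (X j - C r * X i - emb s - emb (m 2) + C r ^ 2 * emb (m 0))
        (2 * C r * s - l 2 + C r * m 2 + C r ^ 2 * l 0 - C r ^ 3 * m 0)
        (s ^ 2 + m 2 * s - n 2 - C r ^ 2 * m 0 * s + C r ^ 2 * n 0) ?_)
    · rw [LinearIndependent.pair_iff]
      intro a b hab
      obtain ⟨-, e1, e2⟩ := h.indep (a * r - b * r ^ 2) a b (by rw [← hab]; module)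
      exact ⟨e1, e2⟩
    · rw [← hv]
      simp only [smul_eq_C_mul, map_add, map_sub, map_mul, map_neg, map_pow, emb_C]
      ring
    · rw [← hv]
      simp only [smul_eq_C_mul, map_add, map_sub, map_mul, map_pow, emb_C, map_ofNat]
      ring

/-- No homogeneous prime disjoint from the ternary forms contains the net. -/
lemma not_le_prime (h : NormalForm Λ i j l m n) (hss : Semistable Λ)
    (hfin : Module.finrank ℂ Λ = 3) {P : Ideal Quin} [hPp : P.IsPrime]
    (hP : ∀ Q ∈ Λ, Q ∈ P) (hH : ∀ f ∈ P, ∀ k, homogeneousComponent k f ∈ P)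
    (hA : ∀ a, emb a ∈ P → a = 0) : False := by
  obtain ⟨r, t, s, hm, hne⟩ := h.exists_linear_mem hss hfin hP hH hA
  have hdiv : ∀ {z : ℂ}, z ≠ 0 → (C z⁻¹ : Quin) * C z = 1 := fun hz => by
    rw [← C_mul, inv_mul_cancel₀ hz, C_1]
  by_cases ht : t = 0
  · have hr : r ≠ 0 := fun hr => hne ⟨hr, ht⟩
    refine h.symm.not_linear_mem hss hP hH hA (r := r⁻¹ * t) (s := C r⁻¹ * s) ?_
    convert P.mul_mem_left (C r⁻¹) hm using 1
    rw [C_mul, map_mul emb, emb_C]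
    linear_combination (-X i) * hdiv hr
  · refine h.not_linear_mem hss hP hH hA (r := t⁻¹ * r) (s := C t⁻¹ * s) ?_
    convert P.mul_mem_left (C t⁻¹) hm using 1
    rw [C_mul, map_mul emb, emb_C]
    linear_combination (-X j) * hdiv ht

end NormalForm

section
attribute [local instance] MvPolynomial.gradedAlgebra

/-- Minimal primes over a homogeneous ideal are homogeneous. -/
lemma homogeneousComponent_mem_of_mem_minimalPrimes {S : Set Quin} {d : ℕ}
    (hS : ∀ Q ∈ S, Q.IsHomogeneous d) {P : Ideal Quin} (hP : P ∈ (Ideal.span S).minimalPrimes)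
    {f : Quin} (hf : f ∈ P) (k : ℕ) : homogeneousComponent k f ∈ P := by
  have hPp := hP.1.1
  have hle := Ideal.toIdeal_homogeneousCore_le (homogeneousSubmodule (Fin 5) ℂ) P
  have h1 : P ≤ (P.homogeneousCore (homogeneousSubmodule (Fin 5) ℂ)).toIdeal := by
    refine hP.2 ⟨Ideal.IsPrime.homogeneousCore hPp, Ideal.span_le.2 fun Q hQ => ?_⟩ hle
    exact Ideal.mem_homogeneousCore_of_homogeneous_of_mem ⟨d, hS Q hQ⟩
      (hP.1.2 (Ideal.subset_span hQ))
  exact hle (homogeneousComponent_mem_of_mem (HomogeneousIdeal.isHomogeneous _) (h1 hf) k)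

end

lemma le_irr_of_mem_minimalPrimes {S : Set Quin} {d : ℕ}
    (hS : ∀ Q ∈ S, Q.IsHomogeneous d) {P : Ideal Quin} (hP : P ∈ (Ideal.span S).minimalPrimes) :
    P ≤ irr := by
  intro f hf
  have h0 := homogeneousComponent_mem_of_mem_minimalPrimes hS hP hf 0
  rw [homogeneousComponent_zero] at h0
  rw [mem_irr, constantCoeff_eq]
  by_contra hne
  exact hP.1.1.ne_top (Ideal.eq_top_of_isUnit_mem _ h0 ((isUnit_iff_ne_zero.2 hne).map C))

lemma mem_irr_of_isHomogeneous {Q : Quin} (hQ : Q.IsHomogeneous 2) : Q ∈ irr := by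
  rw [mem_irr, constantCoeff_eq]
  exact hQ.coeff_eq_zero (by simp)

/-- A prime containing two coprime elements is minimal over them or has height at least `3`. -/
lemma mem_minimalPrimes_or_three_le_height {A : Type*} [CommRing A] [IsDomain A]
    [UniqueFactorizationMonoid A] {f g : A} (hf : f ≠ 0) (hfg : IsRelPrime f g)
    {P : Ideal A} [hP : P.IsPrime] (h1 : f ∈ P) (h2 : g ∈ P) :
    P ∈ (Ideal.span {f, g}).minimalPrimes ∨ 3 ≤ Order.height (⟨P, hP⟩ : PrimeSpectrum A) := by
  by_contra! hcon
  refine hcon.1 ⟨⟨hP, Ideal.span_le.2 ?_⟩, ?_⟩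
  · rintro x (rfl | rfl)
    exacts [h1, h2]
  rintro p ⟨hp, hpI⟩ hpP
  by_contra hPp
  have hfp : f ∈ p := hpI (Ideal.subset_span (by simp))
  have hgp : g ∈ p := hpI (Ideal.subset_span (by simp))
  obtain ⟨q, hqf, hq⟩ := hp.exists_mem_prime_of_ne_bot (fun h => hf (by simpa [h] using hfp))
  have hlt1 : Ideal.span {q} < p := by
    refine lt_of_le_of_ne ((Ideal.span_singleton_le_iff_mem _).2 hqf) fun he => hq.not_isUnit ?_
    rw [← he, Ideal.mem_span_singleton] at hfp hgp
    exact hfg hfp hgp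
  have hqp : (Ideal.span {q}).IsPrime := (Ideal.span_singleton_prime hq.ne_zero).2 hq
  have hlt0 : (⊥ : Ideal A) < Ideal.span {q} :=
    bot_lt_iff_ne_bot.2 fun h => hq.ne_zero (Ideal.span_singleton_eq_bot.1 h)
  have e1 := Order.height_add_one_le (α := PrimeSpectrum A) (a := ⟨⊥, Ideal.isPrime_bot⟩)
    (b := ⟨_, hqp⟩) hlt0
  have e2 := Order.height_add_one_le (α := PrimeSpectrum A) (a := ⟨_, hqp⟩) (b := ⟨p, hp⟩) hlt1
  have e3 := Order.height_add_one_le (α := PrimeSpectrum A) (a := ⟨p, hp⟩) (b := ⟨P, hP⟩)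
    (lt_of_le_of_ne hpP fun h => hPp h.ge)
  refine hcon.2.not_ge (le_trans ?_ e3)
  have e4 := le_trans (add_le_add_left (le_trans (add_le_add_left (bot_le (α := ℕ∞)) 1) e1) 1) e2
  exact (le_of_eq (by norm_num)).trans (add_le_add_left e4 1)

lemma Ideal.mem_of_mem_map_substHom {Λ : Submodule ℂ Quin}
    (g : Matrix.GeneralLinearGroup (Fin 5) ℂ) {P : Ideal Quin} (hP : ∀ Q ∈ Λ, Q ∈ P) :
    ∀ Q ∈ Λ.map (substMap (g : Matrix (Fin 5) (Fin 5) ℂ)),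
      Q ∈ P.comap (substHom (↑g⁻¹ : Matrix (Fin 5) (Fin 5) ℂ)) := by
  rintro _ ⟨Q, hQ, rfl⟩
  rw [Ideal.mem_comap, substMap_apply, substHom_comp, ← Units.val_mul, mul_inv_cancel, Units.val_one,
    substHom_one]
  exact hP Q hQ

lemma substHom_injective (g : Matrix.GeneralLinearGroup (Fin 5) ℂ) :
    Function.Injective (substHom (g : Matrix (Fin 5) (Fin 5) ℂ)) := by
  refine Function.LeftInverse.injective (g := substHom (↑g⁻¹ : Matrix (Fin 5) (Fin 5) ℂ)) fun Q => ?_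
  rw [substHom_comp, ← Units.val_mul, mul_inv_cancel, Units.val_one, substHom_one]

lemma substHom_surjective (g : Matrix.GeneralLinearGroup (Fin 5) ℂ) :
    Function.Surjective (substHom (g : Matrix (Fin 5) (Fin 5) ℂ)) := by
  intro Q
  refine ⟨substHom (↑g⁻¹ : Matrix (Fin 5) (Fin 5) ℂ) Q, ?_⟩
  rw [substHom_comp, ← Units.val_mul, inv_mul_cancel, Units.val_one, substHom_one]

lemma IsNet.map {Λ : Submodule ℂ Quin} (h : IsNet Λ) (g : Matrix.GeneralLinearGroup (Fin 5) ℂ) :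
    IsNet (Λ.map (substMap (g : Matrix (Fin 5) (Fin 5) ℂ))) := by
  refine ⟨?_, ?_⟩
  · rw [← h.1]
    exact (LinearEquiv.finrank_eq (Submodule.equivMapOfInjective _ (substHom_injective g) Λ)).symm
  · rintro _ ⟨Q, hQ, rfl⟩
    have := (h.2 Q hQ).aeval (fun i => lin ((g : Matrix (Fin 5) (Fin 5) ℂ) i)) (n := 1)
      fun i => isHomogeneous_lin _
    exact this

lemma exists_minimalPrimes_le_height {S : Set Quin} {P : Ideal Quin} [hP : P.IsPrime]
    (hS : S ⊆ P) : ∃ p : PrimeSpectrum Quin, p.asIdeal ∈ (Ideal.span S).minimalPrimes ∧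
      Order.height p ≤ Order.height (⟨P, hP⟩ : PrimeSpectrum Quin) := by
  obtain ⟨p, hp, hpP⟩ := Ideal.exists_minimalPrimes_le (Ideal.span_le.2 hS)
  exact ⟨⟨p, hp.1.1⟩, hp, Order.height_mono hpP⟩

lemma Indep3.pair {Q1 Q2 Q3 : Quin} (h : Indep3 Q1 Q2 Q3) : LinearIndependent ℂ ![Q1, Q2] := by
  rw [LinearIndependent.pair_iff]
  intro a b hab
  obtain ⟨e0, e1, -⟩ := h a b 0 (by rw [hab, zero_smul, add_zero])
  exact ⟨e0, e1⟩

lemma NormalForm.three_le_height {Λ : Submodule ℂ Quin} {i j : Fin 5} {l m n : Fin 3 → Tern}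
    (h : NormalForm Λ i j l m n) (hss : Semistable Λ) (hΛ : IsNet Λ)
    (P : Ideal Quin) [hP : P.IsPrime] (hΛP : ∀ Q ∈ Λ, Q ∈ P) :
    3 ≤ Order.height (⟨P, hP⟩ : PrimeSpectrum Quin) := by
  obtain ⟨⟨p, hp⟩, hmin, hle⟩ := exists_minimalPrimes_le_height (S := Λ) hΛP
  refine le_trans ?_ hle
  have hΛp : ∀ Q ∈ Λ, Q ∈ p := fun Q hQ => hmin.1.2 (Ideal.subset_span hQ)
  have hli := Indep3.pair h.indep
  have hrel := hss.isRelPrime hΛ.2 h.mem0 h.mem1 hli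
  rcases mem_minimalPrimes_or_three_le_height (hli.ne_zero 0) hrel (hΛp _ h.mem0) (hΛp _ h.mem1)
    with hm | hm
  · have hc := le_coheight_of_isAssoc (depthGE_span_pair (mem_irr_of_isHomogeneous (hΛ.2 _ h.mem0))
      (mem_irr_of_isHomogeneous (hΛ.2 _ h.mem1)) (hli.ne_zero 0) hrel)
      (isAssoc_of_mem_minimalPrimes hm) (le_irr_of_mem_minimalPrimes hΛ.2 hmin)
    exact (h.not_le_prime hss hΛ.1 hΛp
      (fun f hf k => homogeneousComponent_mem_of_mem_minimalPrimes hΛ.2 hmin hf k)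
      fun a ha => (h.spans hΛp).emb_mem hc ha).elim
  · exact hm

/-- A prime containing a semistable net has height at least `3`. -/
lemma Semistable.three_le_height {Λ : Submodule ℂ Quin} (hss : Semistable Λ) (hΛ : IsNet Λ)
    {Q : Fin 3 → Quin} (hQ : ∀ i, Q i ∈ Λ) (hli : Indep3 (Q 0) (Q 1) (Q 2))
    (P : Ideal Quin) [hP : P.IsPrime] (hΛP : ∀ Q ∈ Λ, Q ∈ P) :
    3 ≤ Order.height (⟨P, hP⟩ : PrimeSpectrum Quin) := by
  obtain ⟨g, hg⟩ := hss.exists_normal_form hΛ hQ hli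
  choose l m n hl hm hn hmem using fun k : Fin 3 =>
    hg (if k = 0 then 1 else 0) (if k = 1 then 1 else 0) (if k = 2 then 1 else 0)
  have hnf : NormalForm (Λ.map (substMap (g : Matrix (Fin 5) (Fin 5) ℂ))) 3 4 l m n :=
    ⟨Or.inl ⟨rfl, rfl⟩, hl, hm, hn, by simpa using hmem 0, by simpa using hmem 1,
      by simpa using hmem 2⟩
  have h3 := hnf.three_le_height (hss.map g) (hΛ.map g) _ (Ideal.mem_of_mem_map_substHom g hΛP)
  refine h3.trans ((Order.height_le_height_apply_of_strictMono
    (PrimeSpectrum.comap (substHom (g : Matrix (Fin 5) (Fin 5) ℂ) : Quin →+* Quin))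
    (Monotone.strictMono_of_injective (fun _ _ h => Ideal.comap_mono h)
      (PrimeSpectrum.comap_injective_of_surjective _ (substHom_surjective g))) _).trans_eq ?_)
  congr 1
  ext1
  ext Q
  change substHom _ (substHom _ Q) ∈ P ↔ Q ∈ P
  rw [substHom_comp, ← Units.val_mul, mul_inv_cancel, Units.val_one, substHom_one]

/-- Hartshorne's connectedness lemma: a punctured spectrum of depth at least two is connected. -/
lemma DepthGE.le_or_le_of_mul_le {A : Type*} [CommRing A] [IsNoetherianRing A] [IsLocalRing A]
    {I J₁ J₂ : Ideal A} (hd : DepthGE (IsLocalRing.maximalIdeal A) 2 I) (hmul : J₁ * J₂ ≤ I)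
    {N : ℕ} (hN : IsLocalRing.maximalIdeal A ^ N ≤ J₁ ⊔ J₂) : J₁ ≤ I ∨ J₂ ≤ I := by
  have hN' : IsLocalRing.maximalIdeal A ^ (N + 1) ≤ (J₁ ⊔ J₂) ⊓ IsLocalRing.maximalIdeal A :=
    le_inf ((Ideal.pow_le_pow_right N.le_succ).trans hN) (Ideal.pow_le_self N.succ_ne_zero)
  obtain ⟨x, ⟨hx, hxm⟩, hxr⟩ := exists_regMod (fun _ : Unit => I) (fun _ => hd.noSocle) hN'
  replace hxr := hxr ()
  obtain ⟨y, ⟨hy, -⟩, hyr⟩ := exists_regMod (fun _ : Unit => I ⊔ Ideal.span {x})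
    (fun _ => (hd.drop hxm hxr).noSocle) hN'
  replace hyr := hyr ()
  obtain ⟨x₁, hx₁, x₂, hx₂, rfl⟩ := Submodule.mem_sup.1 hx
  obtain ⟨y₁, hy₁, y₂, hy₂, rfl⟩ := Submodule.mem_sup.1 hy
  have hI : ∀ {a b}, a ∈ J₁ → b ∈ J₂ → a * b ∈ I := fun ha hb => hmul (Ideal.mul_mem_mul ha hb)
  obtain ⟨i, hi, z, hz⟩ := mem_sup_span_iff.1 (hyr x₁ (mem_sup_span_iff.2
    ⟨x₁ * y₂ - y₁ * x₂, I.sub_mem (hI hx₁ hy₂) (hI hy₁ hx₂), y₁, by ring⟩))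
  have hzz : z * (1 - z) ∈ I := by
    refine hxr _ (hxr _ ?_)
    convert I.sub_mem (hI hx₁ hx₂) (I.mul_mem_left (x₂ - (x₁ + x₂) * z) hi) using 1
    linear_combination ((x₁ + x₂) * z - x₂) * hz
  rcases IsLocalRing.isUnit_or_isUnit_one_sub_self z with hu | hu
  · have hz1 : 1 - z ∈ I := (Ideal.unit_mul_mem_iff_mem I hu).1 hzz
    refine Or.inr fun j hj => hxr j ?_
    convert I.add_mem (hI hx₁ hj) (I.mul_mem_right j
      (I.sub_mem (I.mul_mem_left (x₁ + x₂) hz1) hi)) using 1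
    linear_combination (-j) * hz
  · have hz1 : z ∈ I := (Ideal.unit_mul_mem_iff_mem I hu).1 (by rwa [mul_comm])
    refine Or.inl fun j hj => hxr j ?_
    convert I.add_mem (hI hj hx₂) (I.mul_mem_right j
      (I.add_mem (I.mul_mem_left (x₁ + x₂) hz1) hi)) using 1
    linear_combination j * hz

lemma not_pow_le_of_regMod {A : Type*} [CommRing A] {m I : Ideal A} {x : A} (hx : x ∈ m)
    (hr : RegMod I x) (hI : I ≠ ⊤) (N : ℕ) : ¬ m ^ N ≤ I := by
  induction N with
  | zero => simpa using hI
  | succ N ih => exact fun h => ih fun a ha => hr a (h (by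
      rw [pow_succ']; exact Ideal.mul_mem_mul hx ha))

/-- The global form of Hartshorne's lemma, at the origin of `ℂ⁵`. -/
lemma exists_pow_mul_mem {I J₁ J₂ : Ideal Quin}
    (hd : DepthGE (IsLocalRing.maximalIdeal LocQuin) 2 (I.map (algebraMap Quin LocQuin)))
    (hmul : J₁ * J₂ ≤ I.radical) (hsup : irr ≤ (J₁ ⊔ J₂).radical) :
    ∃ k, (∀ j ∈ J₁, ∃ s ∉ irr, s * j ^ k ∈ I) ∨ ∀ j ∈ J₂, ∃ s ∉ irr, s * j ^ k ∈ I := by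
  obtain ⟨k, hk⟩ := Ideal.exists_pow_le_of_le_radical_of_fg hmul (IsNoetherian.noetherian _)
  have key : ∀ {J : Ideal Quin}, (J ^ k).map (algebraMap Quin LocQuin) ≤
      I.map (algebraMap Quin LocQuin) → ∀ j ∈ J, ∃ s ∉ irr, s * j ^ k ∈ I := fun h j hj =>
    (IsLocalization.algebraMap_mem_map_algebraMap_iff irr.primeCompl LocQuin I _).1
      (h (Ideal.mem_map_of_mem _ (Ideal.pow_mem_pow hj k)))
  obtain ⟨N, hN⟩ := Ideal.exists_pow_le_of_le_radical_of_fg hsup (IsNoetherian.noetherian _)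
  refine ⟨k, (hd.le_or_le_of_mul_le (J₁ := (J₁ ^ k).map (algebraMap Quin LocQuin))
    (J₂ := (J₂ ^ k).map (algebraMap Quin LocQuin)) (N := N * (k + k)) ?_ ?_).imp key key⟩
  · rw [← Ideal.map_mul, ← mul_pow]
    exact Ideal.map_mono hk
  · rw [← Ideal.map_sup, ← map_irr, ← Ideal.map_pow]
    refine Ideal.map_mono ?_
    rw [pow_mul]
    exact (Ideal.pow_right_mono hN _).trans Ideal.sup_pow_add_le_pow_sup_pow

/-- The pullback of polynomials along the line `t ↦ t • v`. -/
noncomputable def lineHom (v : Fin 5 → ℂ) : Quin →ₐ[ℂ] Polynomial ℂ :=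
  aeval fun i => Polynomial.C (v i) * Polynomial.X

lemma eval_lineHom (v : Fin 5 → ℂ) (t : ℂ) (f : Quin) :
    (lineHom v f).eval t = eval (t • v) f := by
  induction f using MvPolynomial.induction_on with
  | C r => simp [lineHom]
  | add f g hf hg => simp [hf, hg]
  | mul_X f i hf =>
    rw [map_mul, Polynomial.eval_mul, hf, lineHom, aeval_X, map_mul, eval_X, Polynomial.eval_mul,
      Polynomial.eval_C, Polynomial.eval_X, Pi.smul_apply, smul_eq_mul, mul_comm t]

lemma eval_eq_zero_of_mul_pow_mem {I : Ideal Quin} {v : Fin 5 → ℂ}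
    (hv : ∀ t : ℂ, ∀ f ∈ I, eval (t • v) f = 0) {s j : Quin} (hs : s ∉ irr) {k : ℕ}
    (h : s * j ^ k ∈ I) : eval v j = 0 := by
  have h0 : lineHom v (s * j ^ k) = 0 := Polynomial.funext fun t => by
    rw [eval_lineHom, hv t _ h, Polynomial.eval_zero]
  have hs0 : lineHom v s ≠ 0 := fun h0 => hs <| by
    have := eval_lineHom v 0 s
    rwa [h0, Polynomial.eval_zero, zero_smul, eq_comm, eval_zero, ← mem_irr] at this
  rw [map_mul, map_pow] at h0
  have hj := eq_zero_of_pow_eq_zero ((mul_eq_zero.1 h0).resolve_left hs0)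
  simpa [hj, eq_comm] using eval_lineHom v 1 j

/-- Zariski open sets are unions of basic ones. -/
lemma exists_eval_ne_zero_of_isOpen {u : Set (Fin 5 → ℂ)} (hu : @IsOpen _ zariski5 u)
    {v : Fin 5 → ℂ} (hv : v ∈ u) : ∃ p : Quin, eval v p ≠ 0 ∧ ∀ w ∉ u, eval w p = 0 := by
  replace hu : TopologicalSpace.GenerateOpen _ u := hu
  induction hu with
  | basic u hu =>
    obtain ⟨p, rfl⟩ := hu
    exact ⟨p, hv, fun w hw => not_not.1 hw⟩
  | univ => exact ⟨1, by simp, fun w hw => absurd (Set.mem_univ w) hw⟩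
  | inter u u' _ _ ih ih' =>
    obtain ⟨p, hp, h⟩ := ih hv.1
    obtain ⟨p', hp', h'⟩ := ih' hv.2
    refine ⟨p * p', by simp [hp, hp'], fun w hw => ?_⟩
    rcases not_and_or.1 hw with hw | hw
    · simp [h w hw]
    · simp [h' w hw]
  | sUnion U _ ih =>
    obtain ⟨u, hu, hvu⟩ := hv
    obtain ⟨p, hp, h⟩ := ih u hu hvu
    exact ⟨p, hp, fun w hw => h w fun hwu => hw ⟨u, hu, hwu⟩⟩

lemma exists_mem_vanishingIdeal {S u : Set (Fin 5 → ℂ)} (hu : @IsOpen _ zariski5 u)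
    {v : Fin 5 → ℂ} (hv : v ∈ u) (hv0 : v ≠ 0) :
    ∃ f ∈ irr ⊓ vanishingIdeal ℂ (S \ u), eval v f ≠ 0 := by
  obtain ⟨p, hp, hpu⟩ := exists_eval_ne_zero_of_isOpen hu hv
  obtain ⟨i, hi⟩ := Function.ne_iff.1 hv0
  exact ⟨p * X i, ⟨irr.mul_mem_left p (X_mem_irr i), fun w hw => by simp [hpu w hw.2]⟩,
    by simpa [hp] using hi⟩

lemma mem_radical_of_eval {I : Ideal Quin} {f : Quin}
    (h : ∀ v, (∀ g ∈ I, eval v g = 0) → eval v f = 0) : f ∈ I.radical := by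
  rw [← vanishingIdeal_zeroLocus_eq_radical (K := ℂ)]
  intro v hv
  exact h v fun g hg => by simpa using hv g hg

lemma eval_zero_of_mem_irr {f : Quin} (hf : f ∈ irr) : eval 0 f = 0 := by
  rwa [eval_zero, ← mem_irr]

/-- A cone of depth at least two at the origin is connected outside of the origin. -/
lemma isConnected_of_depthGE {I : Ideal Quin} (hI : I ≤ irr)
    (hd : DepthGE (IsLocalRing.maximalIdeal LocQuin) 2 (I.map (algebraMap Quin LocQuin)))
    (hcone : ∀ v, (∀ f ∈ I, eval v f = 0) → ∀ t : ℂ, ∀ f ∈ I, eval (t • v) f = 0) :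
    @IsConnected (Fin 5 → ℂ) zariski5 {v | v ≠ 0 ∧ ∀ f ∈ I, eval v f = 0} := by
  set S : Set (Fin 5 → ℂ) := {v | v ≠ 0 ∧ ∀ f ∈ I, eval v f = 0} with hS
  refine ⟨?_, fun u u' hu hu' hcov ⟨v, hvS, hvu⟩ ⟨v', hvS', hvu'⟩ => ?_⟩
  · by_contra hempty
    have hle : irr ≤ I.radical := fun f hf => mem_radical_of_eval fun v hv => by
      have hv0 : v = 0 := by
        by_contra hv0
        exact hempty ⟨v, hv0, hv⟩
      rw [hv0, eval_zero_of_mem_irr hf]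
    obtain ⟨N, hN⟩ := Ideal.exists_pow_le_of_le_radical_of_fg hle (IsNoetherian.noetherian _)
    obtain ⟨x, hx, hr, -⟩ := hd
    refine not_pow_le_of_regMod hx hr (fun htop => ?_) N ?_
    · have := Ideal.map_mono (f := algebraMap Quin LocQuin) hI
      rw [htop, map_irr, top_le_iff] at this
      exact (IsLocalRing.maximalIdeal.isMaximal LocQuin).ne_top this
    · rw [← map_irr, ← Ideal.map_pow]
      exact Ideal.map_mono hN
  · by_contra hdis
    have key : ∀ {w : Set (Fin 5 → ℂ)} {x : Fin 5 → ℂ} {k : ℕ}, @IsOpen _ zariski5 w → x ∈ S → x ∈ w →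
        (∀ j ∈ irr ⊓ vanishingIdeal ℂ (S \ w), ∃ s ∉ irr, s * j ^ k ∈ I) → False := by
      intro w x k hw hxS hxw h
      obtain ⟨f, hf, hfx⟩ := exists_mem_vanishingIdeal (S := S) hw hxw hxS.1
      obtain ⟨s, hs, hsI⟩ := h f hf
      exact hfx (eval_eq_zero_of_mul_pow_mem (hcone x hxS.2) hs hsI)
    suffices h : _ ∧ _ by
      obtain ⟨k, h | h⟩ := exists_pow_mul_mem (J₁ := irr ⊓ vanishingIdeal ℂ (S \ u))
        (J₂ := irr ⊓ vanishingIdeal ℂ (S \ u')) hd h.1 h.2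
      · exact key hu hvS hvu h
      · exact key hu' hvS' hvu' h
    constructor
    · rw [Ideal.mul_le]
      refine fun f hf g hg => mem_radical_of_eval fun x hx => ?_
      rw [map_mul]
      by_cases hx0 : x = 0
      · rw [hx0, eval_zero_of_mem_irr hf.1, zero_mul]
      by_cases hxu : x ∈ u
      · have : eval x g = 0 := by
          simpa using hg.2 x ⟨⟨hx0, hx⟩, fun hxu' => hdis ⟨x, ⟨hx0, hx⟩, hxu, hxu'⟩⟩
        rw [this, mul_zero]
      · have : eval x f = 0 := by simpa using hf.2 x ⟨⟨hx0, hx⟩, hxu⟩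
        rw [this, zero_mul]
    · refine fun f hf => mem_radical_of_eval fun x hx => ?_
      suffices hx0 : x = 0 by rw [hx0, eval_zero_of_mem_irr hf]
      by_contra hx0
      have hxS : x ∈ S := ⟨hx0, fun g hg => hx g (Ideal.mem_sup_left ⟨hI hg, fun w hw => by
        simpa using hw.1.2 g hg⟩)⟩
      rcases hcov hxS with hxu | hxu
      · obtain ⟨g, hg, hgx⟩ := exists_mem_vanishingIdeal (S := S) hu hxu hx0
        exact hgx (hx g (Ideal.mem_sup_left hg))
      · obtain ⟨g, hg, hgx⟩ := exists_mem_vanishingIdeal (S := S) hu' hxu hx0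
        exact hgx (hx g (Ideal.mem_sup_right hg))

/-- A complete intersection of codimension three in `ℂ⁵` has depth two at the origin. -/
lemma depthGE_two_of_three_le_height {Q1 Q2 Q3 : Quin} (h1 : Q1 ∈ irr) (h2 : Q2 ∈ irr)
    (h3 : Q3 ∈ irr) (h0 : Q1 ≠ 0) (hrel : IsRelPrime Q1 Q2)
    (hht : ∀ P : PrimeSpectrum Quin, Ideal.span {Q1, Q2, Q3} ≤ P.asIdeal → 3 ≤ Order.height P) :
    DepthGE (IsLocalRing.maximalIdeal LocQuin) 2
      ((Ideal.span {Q1, Q2, Q3}).map (algebraMap Quin LocQuin)) := by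
  have hd := (depthGE_span_pair h1 h2 h0 hrel).map (B := LocQuin) irr.primeCompl
  rw [map_irr] at hd
  have hspan : Ideal.span {Q1, Q2, Q3} = Ideal.span {Q1, Q2} ⊔ Ideal.span {Q3} := by
    rw [← Ideal.span_union]
    congr 1
    ext
    simp only [Set.mem_insert_iff, Set.mem_singleton_iff, Set.mem_union]
    tauto
  have hreg : RegMod ((Ideal.span {Q1, Q2}).map (algebraMap Quin LocQuin))
      (algebraMap Quin LocQuin Q3) := by
    by_contra hreg
    obtain ⟨p, hp, hQp⟩ := exists_isAssoc_of_not_regMod hreg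
    have hle : (Ideal.span {Q1, Q2}).map (algebraMap Quin LocQuin) ≤ p := by
      obtain ⟨-, w, hw⟩ := hp
      exact fun a ha => (hw a).2 (Ideal.mul_mem_right _ _ ha)
    let P := PrimeSpectrum.comap (algebraMap Quin LocQuin) ⟨p, hp.1⟩
    have hc : 3 ≤ Order.coheight P := (hd.le_coheight hp).trans (le_coheight_comap _)
    have hh : 3 ≤ Order.height P := hht P <| by
      rw [hspan, sup_le_iff, Ideal.span_singleton_le_iff_mem]
      exact ⟨Ideal.map_le_iff_le_comap.1 hle, hQp⟩
    have := (add_le_add hh hc).trans (height_add_coheight_le P)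
    exact absurd this (by norm_num)
  have := hd.drop (y := algebraMap Quin LocQuin Q3) (map_irr ▸ Ideal.mem_map_of_mem _ h3) hreg
  rwa [hspan, Ideal.map_sup, Ideal.map_span _ {Q3}, Set.image_singleton]

/-- A semistable net of quadrics cuts out a purely one-dimensional
(every minimal prime of the ideal has height `3`) and connected scheme. -/
theorem semistable_net_pure_dim_and_connected (Λ : Submodule ℂ Quin) (hΛ : IsNet Λ)
    (hss : Semistable Λ) (Q1 Q2 Q3 : Quin)
    (hQ1 : Q1 ∈ Λ) (hQ2 : Q2 ∈ Λ) (hQ3 : Q3 ∈ Λ)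
    (hli : LinearIndependent ℂ ![Q1, Q2, Q3])
    (hspan : Submodule.span ℂ {Q1, Q2, Q3} = Λ) :
    (∀ (P : Ideal Quin) (hP : P ∈ (Ideal.span {Q1, Q2, Q3}).minimalPrimes),
        Order.height (⟨P, hP.1.1⟩ : PrimeSpectrum Quin) = 3) ∧
    @IsConnected (Fin 5 → ℂ) zariski5
      {v : Fin 5 → ℂ | v ≠ 0 ∧ MvPolynomial.eval v Q1 = 0 ∧
        MvPolynomial.eval v Q2 = 0 ∧ MvPolynomial.eval v Q3 = 0} := by
  have hli3 : Indep3 Q1 Q2 Q3 := fun a b c h => by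
    have := Fintype.linearIndependent_iff.1 hli ![a, b, c] (by simpa [Fin.sum_univ_three] using h)
    exact ⟨this 0, this 1, this 2⟩
  have hirr : ∀ Q ∈ Λ, Q ∈ irr := fun Q hQ => mem_irr_of_isHomogeneous (hΛ.2 Q hQ)
  have hpair := hli3.pair
  have hht : ∀ P : PrimeSpectrum Quin, Ideal.span {Q1, Q2, Q3} ≤ P.asIdeal →
      3 ≤ Order.height P := by
    rintro ⟨P, hP⟩ hle
    refine hss.three_le_height hΛ (Q := ![Q1, Q2, Q3]) ?_ hli3 P fun Q hQ => hle ?_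
    · intro i
      fin_cases i
      exacts [hQ1, hQ2, hQ3]
    · rw [← hspan] at hQ
      exact Submodule.span_le_restrictScalars ℂ Quin _ hQ
  refine ⟨fun P hP => le_antisymm ?_ (hht _ hP.1.2), ?_⟩
  · have := Ideal.height_le_card_of_mem_minimalPrimes_span_finset (s := {Q1, Q2, Q3}) (p := P)
      (by simpa using hP)
    have h3 : (({Q1, Q2, Q3} : Finset Quin).card : ℕ∞) ≤ 3 := by
      exact_mod_cast Finset.card_le_three
    rw [← PrimeSpectrum.height_eq_orderHeight]
    exact this.trans h3
  · have hmem : ∀ v : Fin 5 → ℂ, (∀ f ∈ Ideal.span {Q1, Q2, Q3}, eval v f = 0) ↔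
        eval v Q1 = 0 ∧ eval v Q2 = 0 ∧ eval v Q3 = 0 := by
      intro v
      change Ideal.span {Q1, Q2, Q3} ≤ RingHom.ker (eval v) ↔ _
      rw [Ideal.span_le]
      simp [Set.insert_subset_iff, RingHom.mem_ker]
    have := isConnected_of_depthGE (I := Ideal.span {Q1, Q2, Q3}) ?_
      (depthGE_two_of_three_le_height (hirr _ hQ1) (hirr _ hQ2) (hirr _ hQ3) (hpair.ne_zero 0)
        (hss.isRelPrime hΛ.2 hQ1 hQ2 hpair) hht) ?_
    · simpa only [hmem] using this
    · rw [Ideal.span_le]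
      rintro Q (rfl | rfl | rfl)
      exacts [hirr _ hQ1, hirr _ hQ2, hirr _ hQ3]
    · intro v hv t
      have hhom : ∀ Q ∈ Λ, eval v Q = 0 → eval (t • v) Q = 0 := fun Q hQ h0 => by
        obtain ⟨B, hB⟩ := exists_bilin (hΛ.2 Q hQ)
        rw [hB] at h0 ⊢
        rw [map_smul, map_smul, LinearMap.smul_apply, h0, smul_zero, smul_zero]
      obtain ⟨e1, e2, e3⟩ := (hmem v).1 hv
      exact (hmem (t • v)).2 ⟨hhom _ hQ1 e1, hhom _ hQ2 e2, hhom _ hQ3 e3⟩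
end

section
/- Let Λ be a net of quadrics with basis (Q1,Q2,Q3) such that every minimal prime over the ideal (Q1,Q2,Q3) ⊆ ℂ[a,b,c,d,e] has height 3 (i.e. the net defines a complete-intersection curve in ℙ⁴). Then the discriminant Δ = det(xA1+yA2+zA3) ∈ ℂ[x,y,z] is nonzero and squarefree (has no repeated irreducible factor) if and only if Λ lies on a smooth quartic del Pezzo surface, i.e. there exist linearly independent P1,P2 ∈ Λ such that at every point v ∈ ℂ⁵ ∖ {0} with P1(v)=P2(v)=0 the gradients ∇P1(v) and ∇P2(v) are linearly independent. -/
open MvPolynomial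

/-- A subspace of a complex quadratic space without nonzero isotropic vectors is at most a line. -/
lemma finrank_le_one_of_anisotropic {V : Type*} [AddCommGroup V] [Module ℂ V]
    (B : LinearMap.BilinForm ℂ V) (hB : ∀ x y, B x y = B y x) (E : Submodule ℂ V)
    (hE : ∀ v ∈ E, B v v = 0 → v = 0) : Module.finrank ℂ E ≤ 1 := by
  by_cases h : ∃ y ∈ E, y ≠ 0
  · obtain ⟨y, hy, hy0⟩ := h
    refine finrank_le_one (⟨y, hy⟩ : E) fun ⟨x, hx⟩ => ?_
    have hyy : B y y ≠ 0 := fun h => hy0 (hE y hy h)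
    obtain ⟨s, hs⟩ := IsAlgClosed.exists_eq_mul_self
      (discrim (B y y) (2 * B x y) (B x x))
    obtain ⟨t, ht⟩ := exists_quadratic_eq_zero hyy ⟨s, hs⟩
    have hz : x + t • y = 0 := by
      refine hE _ (E.add_mem hx (E.smul_mem t hy)) ?_
      simp only [map_add, LinearMap.add_apply, map_smul, LinearMap.smul_apply, smul_eq_mul, hB y x]
      linear_combination ht
    refine ⟨-t, Subtype.ext ?_⟩
    simpa using (eq_neg_of_add_eq_zero_left hz).symm
  · push Not at h
    rw [(Submodule.eq_bot_iff E).2 h, finrank_bot]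
    exact zero_le_one

lemma squarefree_charpoly_iff_finrank_maxGenEigenspace_le_one {V : Type*} [AddCommGroup V]
    [Module ℂ V] [FiniteDimensional ℂ V] (N : Module.End ℂ V) :
    Squarefree N.charpoly ↔ ∀ μ, Module.finrank ℂ (N.maxGenEigenspace μ) ≤ 1 := by
  rw [← PerfectField.separable_iff_squarefree,
    ← Polynomial.nodup_roots_iff_of_splits N.charpoly_monic.ne_zero (IsAlgClosed.splits _),
    Multiset.nodup_iff_count_le_one]
  simp [LinearMap.finrank_maxGenEigenspace_eq]

/-- The characteristic polynomial of a self-adjoint endomorphism of a nondegenerate complex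
quadratic space is squarefree if and only if no eigenvector is isotropic. -/
lemma squarefree_charpoly_iff_anisotropic {V : Type*} [AddCommGroup V] [Module ℂ V]
    [FiniteDimensional ℂ V] (B : LinearMap.BilinForm ℂ V) (hB : ∀ x y, B x y = B y x)
    (hnd : ∀ x, (∀ y, B x y = 0) → x = 0) (N : Module.End ℂ V)
    (hN : ∀ x y, B (N x) y = B x (N y)) :
    Squarefree N.charpoly ↔ ∀ (v : V) (μ : ℂ), N v = μ • v → B v v = 0 → v = 0 := by
  rw [squarefree_charpoly_iff_finrank_maxGenEigenspace_le_one]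
  constructor
  · intro h v μ hv hvv
    by_contra hv0
    refine hv0 (hnd v fun y => ?_)
    have hy : y ∈ ⨆ ν, N.maxGenEigenspace ν := by
      rw [Module.End.iSup_maxGenEigenspace_eq_top]; trivial
    induction hy using Submodule.iSup_induction' with
    | mem ν x hx =>
      by_cases hνμ : ν = μ
      · subst hνμ
        have hv' : v ∈ N.maxGenEigenspace ν :=
          Module.End.eigenspace_le_maxGenEigenspace (Module.End.mem_eigenspace_iff.2 hv)
        obtain ⟨e, he⟩ := finrank_le_one_iff.1 (h ν)
        obtain ⟨c, hc⟩ := he ⟨v, hv'⟩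
        obtain ⟨d, hd⟩ := he ⟨x, hx⟩
        have hc : c • (e : V) = v := congrArg Subtype.val hc
        have hd : d • (e : V) = x := congrArg Subtype.val hd
        have hc0 : c ≠ 0 := fun h0 => hv0 (by rw [← hc, h0, zero_smul])
        have hx : x = (d / c) • v := by rw [← hc, ← hd, smul_smul, div_mul_cancel₀ _ hc0]
        rw [hx, map_smul, hvv, smul_zero]
      · obtain ⟨k, hk⟩ := (N.mem_maxGenEigenspace ν x).1 hx
        have hpow : ∀ (k : ℕ) (z : V),
            B v (((N - ν • 1) ^ k) z) = (μ - ν) ^ k * B v z := by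
          intro k
          induction k with
          | zero => simp
          | succ k ih =>
            intro z
            rw [pow_succ, Module.End.mul_apply, ih]
            simp only [LinearMap.sub_apply, LinearMap.smul_apply, Module.End.one_apply, map_sub,
              map_smul, ← hN, hv, smul_eq_mul]
            ring
        have := hpow k x
        rw [hk, map_zero, eq_comm] at this
        exact (mul_eq_zero.1 this).resolve_left (pow_ne_zero _ (sub_ne_zero.2 (Ne.symm hνμ)))
    | zero => simp
    | add x z _ _ hx hz => simp [hx, hz]
  · intro h μ
    have hE : N.maxGenEigenspace μ = N.eigenspace μ := by
      refine le_antisymm (fun w hw => ?_) Module.End.eigenspace_le_maxGenEigenspace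
      obtain ⟨k, hk⟩ := (N.mem_maxGenEigenspace μ w).1 hw
      have hD : ∀ x y, B ((N - μ • 1) x) y = B x ((N - μ • 1) y) := fun x y => by
        simp [hN]
      induction k with
      | zero => simp at hk; simp [hk]
      | succ k ih =>
        rcases k with _ | k
        · rw [Module.End.mem_eigenspace_iff]; simpa [sub_eq_zero] using hk
        · refine ih (h _ μ ?_ ?_)
          · rw [pow_succ'] at hk
            simpa [sub_eq_zero] using hk
          · rw [pow_succ' _ k, Module.End.mul_apply, hD, ← Module.End.mul_apply,
              ← Module.End.mul_apply, mul_assoc, ← pow_succ', ← pow_succ', hk, map_zero]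
    rw [hE]
    exact finrank_le_one_of_anisotropic B hB _ fun v hv =>
      h v μ (Module.End.mem_eigenspace_iff.1 hv)

lemma Squarefree.map_fractionRing_of_monic {R : Type*} [CommRing R] [IsDomain R]
    [IsIntegrallyClosed R] {f : Polynomial R} (hf : f.Monic) (h : Squarefree f) :
    Squarefree (f.map (algebraMap R (FractionRing R))) := by
  intro g hg
  obtain ⟨g', hg'⟩ := IsIntegrallyClosed.eq_map_mul_C_of_dvd (FractionRing R) hf
    ((dvd_mul_right g g).trans hg)
  have hg0 : g ≠ 0 := by
    rintro rfl
    exact (hf.map (algebraMap R (FractionRing R))).ne_zero (by simpa using hg)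
  have hu : IsUnit (Polynomial.C g.leadingCoeff) := by simpa using hg0
  have hmon : (g'.map (algebraMap R (FractionRing R))).Monic := by
    have := congrArg Polynomial.leadingCoeff hg'
    rw [Polynomial.leadingCoeff_mul, Polynomial.leadingCoeff_C] at this
    exact mul_right_cancel₀ (Polynomial.leadingCoeff_ne_zero.2 hg0) (by simpa using this)
  have hmon' : g'.Monic := Polynomial.monic_of_injective (IsFractionRing.injective _ _) hmon
  have hdvd : g' * g' ∣ f := by
    refine (Polynomial.map_dvd_map _ (IsFractionRing.injective R (FractionRing R))
      (hmon'.mul hmon')).1 (dvd_trans ?_ hg)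
    rw [Polynomial.map_mul]
    exact mul_dvd_mul ⟨_, hg'.symm⟩ ⟨_, hg'.symm⟩
  rw [← hg']
  exact ((h g' hdvd).map (Polynomial.mapRingHom (algebraMap R (FractionRing R)))).mul hu

/-- Squarefreeness of a monic polynomial over a polynomial ring is inherited by its
specializations outside a hypersurface. -/
lemma exists_forall_squarefree_map_eval {σ : Type*} {f : Polynomial (MvPolynomial σ ℂ)}
    (hf : f.Monic) (h : Squarefree f) :
    ∃ r : MvPolynomial σ ℂ, r ≠ 0 ∧ ∀ x, eval x r ≠ 0 → Squarefree (f.map (eval x)) := by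
  have hinj := IsFractionRing.injective (MvPolynomial σ ℂ) (FractionRing (MvPolynomial σ ℂ))
  have hsep := PerfectField.separable_iff_squarefree.2 (h.map_fractionRing_of_monic hf)
  rw [Polynomial.separable_def, Polynomial.derivative_map] at hsep
  have hres := Polynomial.resultant_ne_zero _ _ hsep
  rw [Polynomial.natDegree_map_eq_of_injective hinj, Polynomial.natDegree_map_eq_of_injective hinj,
    Polynomial.resultant_map_map] at hres
  by_cases hd : f.natDegree = 0
  · exact ⟨1, one_ne_zero, fun x _ => by simp [hf.natDegree_eq_zero.1 hd]⟩
  obtain ⟨p, q, -, -, hpq⟩ := Polynomial.exists_mul_add_mul_eq_C_resultant f f.derivative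
    le_rfl le_rfl (Or.inl hd)
  generalize f.resultant f.derivative = r at hres hpq
  refine ⟨r, fun h0 => hres (by rw [h0, map_zero]), fun x hx => Polynomial.Separable.squarefree ?_⟩
  have hpq := congrArg (Polynomial.map (eval x)) hpq
  simp only [Polynomial.map_add, Polynomial.map_mul, Polynomial.map_C] at hpq
  rw [Polynomial.separable_def, Polynomial.derivative_map]
  refine ⟨p.map (eval x) * Polynomial.C (eval x r)⁻¹, q.map (eval x) * Polynomial.C (eval x r)⁻¹,
    ?_⟩
  calc _ = (f.map (eval x) * p.map (eval x) + f.derivative.map (eval x) * q.map (eval x)) *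
        Polynomial.C (eval x r)⁻¹ := by ring
    _ = 1 := by rw [hpq, ← Polynomial.C_mul, mul_inv_cancel₀ hx, Polynomial.C_1]

/-- A polynomial with invertible leading coefficient is squarefree if one of its specializations
is. -/
lemma squarefree_of_squarefree_map {R K : Type*} [CommRing R] [IsDomain R] [Field K] (e : R →+* K)
    {f : Polynomial R} (hf : IsUnit f.leadingCoeff) (h : Squarefree (f.map e)) :
    Squarefree f := by
  intro g hg
  have hu : IsUnit g.leadingCoeff := by
    refine isUnit_of_dvd_unit ?_ hf
    obtain ⟨k, rfl⟩ := hg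
    rw [mul_assoc, Polynomial.leadingCoeff_mul]
    exact dvd_mul_right _ _
  have hm : IsUnit (g.map e) := h _ (by
    rw [← Polynomial.map_mul]; exact Polynomial.map_dvd e hg)
  have hd : g.natDegree = 0 := by
    rw [← Polynomial.natDegree_map_of_leadingCoeff_ne_zero e (hu.map e).ne_zero]
    exact Polynomial.natDegree_eq_zero_of_isUnit hm
  rw [Polynomial.eq_C_of_natDegree_eq_zero hd] at hu ⊢
  simpa using hu

lemma Squarefree.map_ringEquiv {R S : Type*} [CommRing R] [CommRing S] (e : R ≃+* S) {x : R}
    (h : Squarefree x) : Squarefree (e x) := by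
  intro y hy
  have := h (e.symm y) (by simpa using map_dvd e.symm hy)
  simpa using this.map e

lemma det_X_add_C_eq_C_mul_charpoly {n : Type*} [Fintype n] [DecidableEq n]
    {A : Matrix n n ℂ} (hA : A.det ≠ 0) (B : Matrix n n ℂ) :
    ((Polynomial.X : Polynomial ℂ) • A.map Polynomial.C + B.map Polynomial.C).det =
      Polynomial.C A.det * (-(A⁻¹ * B)).charpoly := by
  have h : A.map Polynomial.C * (A⁻¹ * B).map Polynomial.C = B.map Polynomial.C := by
    rw [← Matrix.map_mul, A.mul_nonsing_inv_cancel_left B hA.isUnit]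
  have hA' : Polynomial.C A.det = (A.map Polynomial.C).det := RingHom.map_det Polynomial.C A
  rw [Matrix.charpoly, hA', ← Matrix.det_mul, Matrix.charmatrix, map_neg, sub_neg_eq_add,
    Matrix.mul_add, RingHom.mapMatrix_apply, h, Matrix.scalar_apply, ← Matrix.smul_one_eq_diagonal,
    Matrix.mul_smul, Matrix.mul_one]

/-- A pencil of quadrics with a nondegenerate member `A` has squarefree discriminant if and only
if no singular point of a member lies on `A`. -/
lemma squarefree_det_pencil_iff {n : Type*} [Fintype n] [DecidableEq n]
    {A B : Matrix n n ℂ} (hA : A.det ≠ 0) (hAs : A.IsSymm) (hBs : B.IsSymm) :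
    Squarefree ((Polynomial.X : Polynomial ℂ) • A.map Polynomial.C + B.map Polynomial.C).det ↔
      ∀ (v : n → ℂ) (t : ℂ), (t • A + B).mulVec v = 0 → v ⬝ᵥ A.mulVec v = 0 → v = 0 := by
  have hsymm {M : Matrix n n ℂ} (hM : M.IsSymm) (x y : n → ℂ) :
      x ⬝ᵥ M.mulVec y = y ⬝ᵥ M.mulVec x := by
    rw [Matrix.dotProduct_mulVec, ← Matrix.mulVec_transpose, hM.eq, dotProduct_comm]
  have hAN (x : n → ℂ) : A.mulVec ((-(A⁻¹ * B)).mulVec x) = - B.mulVec x := by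
    rw [Matrix.mulVec_mulVec, mul_neg, A.mul_nonsing_inv_cancel_left B hA.isUnit,
      Matrix.neg_mulVec]
  have hinj (x : n → ℂ) (hx : A.mulVec x = 0) : x = 0 := by
    by_contra h0
    exact hA (Matrix.exists_mulVec_eq_zero_iff.1 ⟨x, h0, hx⟩)
  rw [det_X_add_C_eq_C_mul_charpoly hA]
  have hassoc : Associated (Polynomial.C A.det * (-(A⁻¹ * B)).charpoly)
      (Matrix.toLin' (-(A⁻¹ * B))).charpoly := by
    rw [← Matrix.charpoly_toLin', mul_comm]
    exact (associated_mul_unit_left _ _ (by simpa using hA))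
  rw [hassoc.squarefree_iff, squarefree_charpoly_iff_anisotropic (Matrix.toBilin' A)]
  · refine forall₂_congr fun v t => ?_
    have : (Matrix.toLin' (-(A⁻¹ * B))) v = t • v ↔ (t • A + B).mulVec v = 0 := by
      rw [Matrix.toLin'_apply, ← sub_eq_zero, Matrix.add_mulVec, Matrix.smul_mulVec]
      constructor
      · intro h
        have := congrArg A.mulVec h
        rw [Matrix.mulVec_sub, hAN, Matrix.mulVec_zero, Matrix.mulVec_smul, ← neg_eq_zero] at this
        rw [← this]; abel
      · intro h
        apply hinj
        rw [Matrix.mulVec_sub, hAN, Matrix.mulVec_smul, ← neg_eq_zero, ← h]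
        abel
    rw [this, Matrix.toBilin'_apply']
  · intro x y
    simpa [Matrix.toBilin'_apply'] using hsymm hAs x y
  · intro x hx
    apply hinj
    refine dotProduct_eq_zero _ fun y => ?_
    rw [dotProduct_comm, hsymm hAs, ← Matrix.toBilin'_apply', hx]
  · intro x y
    rw [Matrix.toBilin'_apply', Matrix.toBilin'_apply', hsymm hAs, Matrix.toLin'_apply,
      Matrix.toLin'_apply, hAN, hAN, dotProduct_neg, dotProduct_neg, hsymm hBs]

/-- If every member of a pencil of quadrics is singular, some member of the pencil is singular at
a base point. -/
lemma exists_singular_base_point_of_det_eq_zero {n : Type*} [Fintype n] [DecidableEq n]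
    {A B : Matrix n n ℂ} (hBs : B.IsSymm)
    (h : ((Polynomial.X : Polynomial ℂ) • A.map Polynomial.C + B.map Polynomial.C).det = 0) :
    ∃ v : n → ℂ, v ≠ 0 ∧ B.mulVec v = 0 ∧ v ⬝ᵥ A.mulVec v = 0 := by
  obtain ⟨w, hw0, hw⟩ := Matrix.exists_mulVec_eq_zero_iff.2 h
  have hcoeff (k : ℕ) : A.mulVec (fun j => (w j).coeff k) +
      B.mulVec (fun j => (w j).coeff (k + 1)) = 0 := by
    ext i
    have := congrArg (Polynomial.coeff · (k + 1)) (congrFun hw i)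
    simpa [Matrix.mulVec, dotProduct, add_mul, Finset.sum_add_distrib, mul_assoc,
      Polynomial.finsetSum_coeff] using this
  have hcoeff0 : B.mulVec (fun j => (w j).coeff 0) = 0 := by
    ext i
    have := congrArg (Polynomial.coeff · 0) (congrFun hw i)
    simpa [Matrix.mulVec, dotProduct, add_mul, Finset.sum_add_distrib, mul_assoc,
      Polynomial.finsetSum_coeff] using this
  have hex : ∃ k, (fun j => (w j).coeff k) ≠ 0 := by
    by_contra! hall
    exact hw0 (funext fun j => Polynomial.ext fun k => congrFun (hall k) j)
  classical
  set k := Nat.find hex with hk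
  have hB : B.mulVec (fun j => (w j).coeff k) = 0 := by
    rcases hk' : k with _ | m
    · exact hcoeff0
    · have hm : (fun j => (w j).coeff m) = 0 := by
        by_contra hm
        exact absurd (Nat.find_min' hex hm) (by omega)
      simpa [hm] using hcoeff m
  refine ⟨_, Nat.find_spec hex, hB, ?_⟩
  rw [eq_neg_of_add_eq_zero_left (hcoeff k), dotProduct_neg, Matrix.dotProduct_mulVec,
    ← Matrix.mulVec_transpose, hBs.eq, hB, zero_dotProduct, neg_zero]

lemma MvPolynomial.IsHomogeneous.eval_eq_sum_coeff {σ : Type*} [Fintype σ] {L : MvPolynomial σ ℂ}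
    (hL : L.IsHomogeneous 1) (v : σ → ℂ) :
    eval v L = ∑ i, coeff (Finsupp.single i 1) L * v i := by
  classical
  have hL' : L ∈ homogeneousSubmodule σ ℂ 1 := hL
  rw [homogeneousSubmodule_one_eq_span_X] at hL'
  clear hL
  induction hL' using Submodule.span_induction with
  | mem x h =>
    obtain ⟨j, rfl⟩ := h
    simp [coeff_X, Finsupp.single_left_inj]
  | zero => simp
  | add x y _ _ hx hy => simp [hx, hy, add_mul, Finset.sum_add_distrib]
  | smul a x _ hx => simp [hx, Finset.mul_sum, mul_assoc]

lemma quadMatrix_isSymm (Q : MvPolynomial (Fin 5) ℂ) : (quadMatrix Q).IsSymm := by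
  ext i j
  simp only [quadMatrix, Matrix.transpose_apply, Matrix.of_apply, eq_comm (a := j),
    add_comm (Finsupp.single j 1)]
  split_ifs with h <;> simp [h]

lemma quadMatrix_add (P Q : MvPolynomial (Fin 5) ℂ) :
    quadMatrix (P + Q) = quadMatrix P + quadMatrix Q := by
  ext i j
  simp only [quadMatrix, Matrix.add_apply, Matrix.of_apply, coeff_add]
  split_ifs <;> ring

lemma quadMatrix_smul (c : ℂ) (Q : MvPolynomial (Fin 5) ℂ) :
    quadMatrix (c • Q) = c • quadMatrix Q := by
  ext i j
  simp only [quadMatrix, Matrix.smul_apply, Matrix.of_apply, coeff_smul, smul_eq_mul]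
  split_ifs <;> ring

lemma MvPolynomial.IsHomogeneous.eval_pderiv_eq_mulVec {Q : MvPolynomial (Fin 5) ℂ}
    (hQ : Q.IsHomogeneous 2) (v : Fin 5 → ℂ) (k : Fin 5) :
    eval v (pderiv k Q) = 2 * (quadMatrix Q).mulVec v k := by
  have h := hQ.pderiv (i := k)
  rw [h.eval_eq_sum_coeff, Matrix.mulVec, dotProduct, Finset.mul_sum]
  refine Finset.sum_congr rfl fun j _ => ?_
  rw [coeff_pderiv, quadMatrix, Matrix.of_apply]
  split_ifs with hkj
  · subst hkj
    simp [← Finsupp.single_add]; ring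
  · simp [Ne.symm hkj, add_comm (Finsupp.single k 1)]
    ring

lemma MvPolynomial.IsHomogeneous.eval_eq_dotProduct_mulVec {Q : MvPolynomial (Fin 5) ℂ}
    (hQ : Q.IsHomogeneous 2) (v : Fin 5 → ℂ) :
    eval v Q = v ⬝ᵥ (quadMatrix Q).mulVec v := by
  have h := congrArg (eval v) hQ.sum_X_mul_pderiv
  simp only [map_sum, map_mul, eval_X, hQ.eval_pderiv_eq_mulVec, map_nsmul] at h
  rw [dotProduct]
  simp only [mul_left_comm _ (2 : ℂ), ← Finset.mul_sum, nsmul_eq_mul, Nat.cast_ofNat] at h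
  exact (mul_left_cancel₀ two_ne_zero h).symm

/-- Squarefreeness of the discriminant of a net does not depend on the basis. -/
lemma squarefree_netDisc_of_basis {Λ : Submodule ℂ Quin} (b b' : Module.Basis (Fin 3) ℂ Λ)
    (h : Squarefree (netDisc (b 0) (b 1) (b 2))) : Squarefree (netDisc (b' 0) (b' 1) (b' 2)) := by
  let φ (T : Matrix (Fin 3) (Fin 3) ℂ) : MvPolynomial (Fin 3) ℂ →ₐ[ℂ] MvPolynomial (Fin 3) ℂ :=
    aeval fun j => ∑ i, C (T j i) * X i
  have hφ (S T : Matrix (Fin 3) (Fin 3) ℂ) (hST : S * T = 1) :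
      (φ T).comp (φ S) = AlgHom.id ℂ _ := by
    ext1 j
    have hX : (X j : MvPolynomial (Fin 3) ℂ) = ∑ i, C ((S * T) j i) * X i := by
      simp [hST, Matrix.one_apply]
    simp only [AlgHom.comp_apply, AlgHom.id_apply]
    conv_rhs => rw [hX]
    simp only [φ, aeval_X, map_sum, map_mul, Matrix.mul_apply, Finset.sum_mul, algHom_C,
      algebraMap_eq, Finset.mul_sum]
    rw [Finset.sum_comm]
    simp only [mul_assoc]
  let e := AlgEquiv.ofAlgHom (φ (b.toMatrix b')) (φ (b'.toMatrix b))
    (hφ _ _ (b'.toMatrix_mul_toMatrix_flip b)) (hφ _ _ (b.toMatrix_mul_toMatrix_flip b'))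
  have hb (i : Fin 3) : quadMatrix (b' i : Quin) =
      ∑ j, b.toMatrix b' j i • quadMatrix (b j : Quin) := by
    conv_lhs => rw [← b.sum_toMatrix_smul_self b' i]
    simp only [Fin.sum_univ_three, Submodule.coe_add, Submodule.coe_smul, quadMatrix_add,
      quadMatrix_smul]
  have he : e.toRingEquiv (netDisc (b 0) (b 1) (b 2)) = netDisc (b' 0) (b' 1) (b' 2) := by
    change φ (b.toMatrix b') _ = _
    rw [netDisc, AlgHom.map_det, netDisc]
    congr 1
    ext1 i j
    simp only [AlgHom.mapMatrix_apply, Matrix.map_apply, Matrix.of_apply, hb, Fin.sum_univ_three,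
      Matrix.add_apply, Matrix.smul_apply, smul_eq_mul, φ, map_add, map_mul, aeval_X, algHom_C,
      algebraMap_eq]
    ring
  rw [← he]
  exact h.map_ringEquiv e.toRingEquiv

lemma eval_netDisc (x : Fin 3 → ℂ) (Q1 Q2 Q3 : Quin) :
    eval x (netDisc Q1 Q2 Q3) = (quadMatrix (x 0 • Q1 + x 1 • Q2 + x 2 • Q3)).det := by
  rw [netDisc, RingHom.map_det]
  congr 1
  ext1 i j
  simp [quadMatrix_add, quadMatrix_smul, mul_comm]

lemma finSuccEquiv_netDisc (P Q R : Quin) :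
    finSuccEquiv ℂ 2 (netDisc P Q R) =
      ((Polynomial.X : Polynomial (MvPolynomial (Fin 2) ℂ)) •
        ((quadMatrix P).map (C : ℂ →+* MvPolynomial (Fin 2) ℂ)).map Polynomial.C +
        (Matrix.of fun i j => C (quadMatrix Q i j) * X 0 + C (quadMatrix R i j) * X 1).map
          Polynomial.C).det := by
  rw [netDisc, AlgEquiv.map_det]
  congr 1
  ext1 i j
  have h1 := finSuccEquiv_X_succ (R := ℂ) (n := 2) (j := 0)
  have h2 := finSuccEquiv_X_succ (R := ℂ) (n := 2) (j := 1)
  simp only [Fin.succ_zero_eq_one, Fin.succ_one_eq_two] at h1 h2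
  simp only [AlgEquiv.mapMatrix_apply, Matrix.map_apply, Matrix.of_apply, map_add, map_mul,
    finSuccEquiv_X_zero, h1, h2, Matrix.add_apply, Matrix.smul_apply, smul_eq_mul]
  have hC (a : ℂ) : finSuccEquiv ℂ 2 (C a) = Polynomial.C (C a) := by simp [finSuccEquiv_apply]
  simp only [hC]
  ring

lemma leadingCoeff_det_X_add_C {R n : Type*} [CommRing R] [Fintype n] [DecidableEq n]
    {A : Matrix n n R} (hA : A.det ≠ 0) (B : Matrix n n R) :
    ((Polynomial.X : Polynomial R) • A.map Polynomial.C + B.map Polynomial.C).det.leadingCoeff =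
      A.det := by
  have h := Polynomial.coeff_det_X_add_C_card A B
  rw [Polynomial.leadingCoeff, le_antisymm (Polynomial.natDegree_det_X_add_C_le A B)
    (Polynomial.le_natDegree_of_ne_zero (h ▸ hA)), h]

lemma leadingCoeff_finSuccEquiv_netDisc {P : Quin} (hP : (quadMatrix P).det ≠ 0) (Q R : Quin) :
    (finSuccEquiv ℂ 2 (netDisc P Q R)).leadingCoeff = C (quadMatrix P).det := by
  have hA : ((quadMatrix P).map (C : ℂ →+* MvPolynomial (Fin 2) ℂ)).det =
      C (quadMatrix P).det := (RingHom.map_det C (quadMatrix P)).symm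
  rw [finSuccEquiv_netDisc, leadingCoeff_det_X_add_C, hA]
  rwa [hA, Ne, C_eq_zero]

lemma map_eval_finSuccEquiv_netDisc (x : Fin 2 → ℂ) (P Q R : Quin) :
    (finSuccEquiv ℂ 2 (netDisc P Q R)).map (eval x) =
      ((Polynomial.X : Polynomial ℂ) • (quadMatrix P).map Polynomial.C +
        (quadMatrix (x 0 • Q + x 1 • R)).map Polynomial.C).det := by
  rw [finSuccEquiv_netDisc, ← Polynomial.coe_mapRingHom, RingHom.map_det]
  congr 1
  ext1 i j
  simp only [RingHom.mapMatrix_apply, Matrix.map_apply, Matrix.add_apply, Matrix.smul_apply,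
    Matrix.of_apply, smul_eq_mul, Polynomial.coe_mapRingHom, Polynomial.map_add,
    Polynomial.map_mul, Polynomial.map_X, Polynomial.map_C, map_add, map_mul, eval_C, eval_X,
    quadMatrix_add, quadMatrix_smul]
  ring

lemma squarefree_netDisc_of_pencil {P : Quin} (hP : (quadMatrix P).det ≠ 0) (Q R : Quin)
    (h : Squarefree ((Polynomial.X : Polynomial ℂ) • (quadMatrix P).map Polynomial.C +
        (quadMatrix Q).map Polynomial.C).det) : Squarefree (netDisc P Q R) := by
  have h' : Squarefree (finSuccEquiv ℂ 2 (netDisc P Q R)) := by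
    refine squarefree_of_squarefree_map (eval ![1, 0]) ?_ ?_
    · rw [leadingCoeff_finSuccEquiv_netDisc hP]
      exact (isUnit_iff_ne_zero.2 hP).map C
    · rw [map_eval_finSuccEquiv_netDisc]
      simpa using h
  simpa using h'.map_ringEquiv (finSuccEquiv ℂ 2).symm.toRingEquiv

lemma exists_squarefree_pencil_of_squarefree_netDisc {P Q R : Quin}
    (hP : (quadMatrix P).det ≠ 0) (h : Squarefree (netDisc P Q R)) :
    ∃ x : Fin 2 → ℂ, x 0 ≠ 0 ∧
      Squarefree ((Polynomial.X : Polynomial ℂ) • (quadMatrix P).map Polynomial.C +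
        (quadMatrix (x 0 • Q + x 1 • R)).map Polynomial.C).det := by
  set f := finSuccEquiv ℂ 2 (netDisc P Q R)
  have hf : Squarefree f := h.map_ringEquiv (finSuccEquiv ℂ 2).toRingEquiv
  set c : Polynomial (MvPolynomial (Fin 2) ℂ) := Polynomial.C (C (quadMatrix P).det⁻¹)
  have hc : IsUnit c := ((isUnit_iff_ne_zero.2 (inv_ne_zero hP)).map C).map Polynomial.C
  have hmonic : (f * c).Monic := by
    rw [Polynomial.Monic, Polynomial.leadingCoeff_mul, leadingCoeff_finSuccEquiv_netDisc hP,
      Polynomial.leadingCoeff_C, ← C_mul, mul_inv_cancel₀ hP, C_1]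
  obtain ⟨r, hr0, hr⟩ := exists_forall_squarefree_map_eval hmonic
    ((associated_mul_unit_left f c hc).squarefree_iff.2 hf)
  obtain ⟨x, hx⟩ : ∃ x, eval x (r * X 0) ≠ 0 := by
    by_contra! hall
    exact mul_ne_zero hr0 (X_ne_zero 0) (MvPolynomial.funext fun x => by simpa using hall x)
  rw [map_mul, eval_X] at hx
  refine ⟨x, right_ne_zero_of_mul hx, ?_⟩
  rw [← map_eval_finSuccEquiv_netDisc]
  refine (hr x (left_ne_zero_of_mul hx)).squarefree_of_dvd ?_
  rw [Polynomial.map_mul]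
  exact dvd_mul_right _ _

lemma exists_basis_of_linearIndependent_pair {V : Type*} [AddCommGroup V] [Module ℂ V]
    (hV : Module.finrank ℂ V = 3) {x y : V} (h : LinearIndependent ℂ ![x, y]) :
    ∃ b : Module.Basis (Fin 3) ℂ V, b 0 = x ∧ b 1 = y := by
  have : FiniteDimensional ℂ V := Module.finite_of_finrank_pos (by omega)
  obtain ⟨z, hz⟩ := exists_linearIndependent_snoc_of_lt_finrank h (by omega)
  refine ⟨basisOfLinearIndependentOfCardEqFinrank hz (by simp [hV]), ?_, ?_⟩ <;>
    rw [coe_basisOfLinearIndependentOfCardEqFinrank] <;> rfl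

lemma linearIndependent_pair_of_basis {K V : Type*} [Field K] [AddCommGroup V] [Module K V]
    (b : Module.Basis (Fin 3) K V) {x : K} (hx : x ≠ 0) (y : K) :
    LinearIndependent K ![b 0, x • b 1 + y • b 2] := by
  rw [LinearIndependent.pair_iff]
  intro s t hst
  have hli := Fintype.linearIndependent_iff.1 b.linearIndependent ![s, t * x, t * y] (by
    rw [← hst, Fin.sum_univ_three]
    simp [mul_smul, add_assoc])
  exact ⟨by simpa using hli 0, by simpa [hx] using hli 1⟩

/-- If `P` is nondegenerate and the pencil spanned by `P` and `Q` has squarefree discriminant, then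
the gradients of `P` and `Q` are independent at every nonzero point of `P = 0`. -/
lemma linearIndependent_gradients_of_squarefree {P Q : Quin} (hP2 : P.IsHomogeneous 2)
    (hQ2 : Q.IsHomogeneous 2) (hP : (quadMatrix P).det ≠ 0)
    (h : Squarefree ((Polynomial.X : Polynomial ℂ) • (quadMatrix P).map Polynomial.C +
        (quadMatrix Q).map Polynomial.C).det)
    {v : Fin 5 → ℂ} (hv : v ≠ 0) (hPv : eval v P = 0) :
    LinearIndependent ℂ ![fun i => eval v (pderiv i P), fun i => eval v (pderiv i Q)] := by
  rw [squarefree_det_pencil_iff hP (quadMatrix_isSymm P) (quadMatrix_isSymm Q)] at h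
  rw [hP2.eval_eq_dotProduct_mulVec] at hPv
  rw [LinearIndependent.pair_iff]
  intro s t hst
  have hst' : s • (quadMatrix P).mulVec v + t • (quadMatrix Q).mulVec v = 0 := by
    ext i
    have := congrFun hst i
    simp only [hP2.eval_pderiv_eq_mulVec, hQ2.eval_pderiv_eq_mulVec, Pi.add_apply, Pi.smul_apply,
      smul_eq_mul, Pi.zero_apply] at this ⊢
    linear_combination this / 2
  by_cases ht : t = 0
  · refine ⟨?_, ht⟩
    by_contra hs
    have hAv : (quadMatrix P).mulVec v = 0 := by simpa [ht, hs] using hst'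
    exact hP (Matrix.exists_mulVec_eq_zero_iff.1 ⟨v, hv, hAv⟩)
  · refine absurd (h v (s / t) ?_ hPv) hv
    rw [Matrix.add_mulVec, Matrix.smul_mulVec]
    have := congrArg (t⁻¹ • ·) hst'
    simpa [smul_smul, ht, div_eq_inv_mul] using this

lemma onSmoothDelPezzo_of_squarefree_netDisc {Λ : Submodule ℂ Quin} (hΛ : IsNet Λ)
    (b : Module.Basis (Fin 3) ℂ Λ) (h : Squarefree (netDisc (b 0) (b 1) (b 2))) :
    OnSmoothDelPezzo Λ := by
  obtain ⟨p, hp⟩ : ∃ p, eval p (netDisc (b 0) (b 1) (b 2)) ≠ 0 := by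
    by_contra! hall
    exact h.ne_zero (MvPolynomial.funext fun x => by simpa using hall x)
  rw [eval_netDisc] at hp
  obtain ⟨P, hP⟩ : ∃ P : Λ, (P : Quin) = p 0 • (b 0 : Quin) + p 1 • (b 1 : Quin) +
      p 2 • (b 2 : Quin) :=
    ⟨p 0 • b 0 + p 1 • b 1 + p 2 • b 2, by simp only [Submodule.coe_add, Submodule.coe_smul]⟩
  rw [← hP] at hp
  have hP0 : P ≠ 0 := by
    intro h0
    rw [h0, ← zero_smul ℂ (0 : Λ), Submodule.coe_smul, quadMatrix_smul, zero_smul] at hp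
    exact hp (Matrix.det_zero)
  obtain ⟨y, hy⟩ := exists_linearIndependent_pair_of_one_lt_finrank (R := ℂ)
    (by rw [hΛ.1]; norm_num) hP0
  obtain ⟨b', hb0, -⟩ := exists_basis_of_linearIndependent_pair hΛ.1 hy
  have h' := squarefree_netDisc_of_basis b b' h
  rw [hb0] at h'
  obtain ⟨x, hx0, hx⟩ := exists_squarefree_pencil_of_squarefree_netDisc hp h'
  obtain ⟨Q, hQ⟩ : ∃ Q : Λ, Q = x 0 • b' 1 + x 1 • b' 2 := ⟨_, rfl⟩
  have hQ' : (Q : Quin) = x 0 • (b' 1 : Quin) + x 1 • (b' 2 : Quin) := by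
    rw [hQ, Submodule.coe_add, Submodule.coe_smul, Submodule.coe_smul]
  rw [← hQ'] at hx
  have hPQ : LinearIndependent ℂ ![(P : Quin), Q] := by
    have hli := linearIndependent_pair_of_basis b' hx0 (x 1)
    rw [hb0, ← hQ, LinearIndependent.pair_iff] at hli
    exact LinearIndependent.pair_iff.2 fun s t hst => hli s t (Subtype.ext hst)
  exact ⟨P, Q, P.2, Q.2, hPQ, fun v hv hPv _ =>
    linearIndependent_gradients_of_squarefree (hΛ.2 _ P.2) (hΛ.2 _ Q.2) hp hx hv hPv⟩

/-- If the pencil spanned by `P` and `Q` is smooth, so is the pencil written in terms of a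
nondegenerate member `t • P + Q` and `P`, and its discriminant is squarefree. -/
lemma exists_squarefree_pencil_of_smooth {P Q : Quin} (hP2 : P.IsHomogeneous 2)
    (hQ2 : Q.IsHomogeneous 2)
    (h : ∀ v : Fin 5 → ℂ, v ≠ 0 → eval v P = 0 → eval v Q = 0 →
      LinearIndependent ℂ ![fun i => eval v (pderiv i P), fun i => eval v (pderiv i Q)]) :
    ∃ t : ℂ, (quadMatrix (t • P + Q)).det ≠ 0 ∧
      Squarefree ((Polynomial.X : Polynomial ℂ) • (quadMatrix (t • P + Q)).map Polynomial.C +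
        (quadMatrix P).map Polynomial.C).det := by
  have key (v : Fin 5 → ℂ) (s t : ℂ) (hv : v ≠ 0) (hP : v ⬝ᵥ (quadMatrix P).mulVec v = 0)
      (hQ : v ⬝ᵥ (quadMatrix Q).mulVec v = 0)
      (hst : s • (quadMatrix P).mulVec v + t • (quadMatrix Q).mulVec v = 0) : s = 0 ∧ t = 0 := by
    have hli := h v hv (by rwa [hP2.eval_eq_dotProduct_mulVec])
      (by rwa [hQ2.eval_eq_dotProduct_mulVec])
    refine LinearIndependent.pair_iff.1 hli s t ?_
    ext i
    have := congrFun hst i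
    simp only [hP2.eval_pderiv_eq_mulVec, hQ2.eval_pderiv_eq_mulVec, Pi.add_apply, Pi.smul_apply,
      smul_eq_mul, Pi.zero_apply] at this ⊢
    linear_combination 2 * this
  have hdet : ((Polynomial.X : Polynomial ℂ) • (quadMatrix P).map Polynomial.C +
      (quadMatrix Q).map Polynomial.C).det ≠ 0 := by
    intro h0
    obtain ⟨v, hv, hQv, hPv⟩ := exists_singular_base_point_of_det_eq_zero (quadMatrix_isSymm Q) h0
    exact one_ne_zero (key v 0 1 hv hPv (by simp [hQv]) (by simp [hQv])).2
  obtain ⟨t, ht⟩ : ∃ t, Polynomial.eval t ((Polynomial.X : Polynomial ℂ) •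
      (quadMatrix P).map Polynomial.C + (quadMatrix Q).map Polynomial.C).det ≠ 0 := by
    by_contra! hall
    exact hdet (Polynomial.funext fun t => by simpa using hall t)
  have ht : (quadMatrix (t • P + Q)).det ≠ 0 := by
    rw [← Polynomial.coe_evalRingHom, RingHom.map_det] at ht
    convert ht using 2
    ext1 i j
    simp only [RingHom.mapMatrix_apply, Matrix.map_apply, Matrix.add_apply, Matrix.smul_apply,
      smul_eq_mul, Polynomial.coe_evalRingHom, Polynomial.eval_add, Polynomial.eval_mul,
      Polynomial.eval_X, Polynomial.eval_C, quadMatrix_add, quadMatrix_smul]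
  refine ⟨t, ht, ?_⟩
  rw [squarefree_det_pencil_iff ht (quadMatrix_isSymm _) (quadMatrix_isSymm _)]
  intro v s hsv hv
  by_contra hv0
  have hP : v ⬝ᵥ (quadMatrix P).mulVec v = 0 := by
    simpa [Matrix.add_mulVec, Matrix.smul_mulVec, hv] using congrArg (v ⬝ᵥ ·) hsv
  have hQ : v ⬝ᵥ (quadMatrix Q).mulVec v = 0 := by
    simpa [quadMatrix_add, quadMatrix_smul, Matrix.add_mulVec, Matrix.smul_mulVec, hP] using hv
  obtain ⟨h1, h2⟩ := key v (s * t + 1) s hv0 hP hQ (by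
    rw [← hsv, quadMatrix_add, quadMatrix_smul]
    simp only [Matrix.add_mulVec, Matrix.smul_mulVec]
    module)
  simp [h2] at h1

/-- For a net defining a complete-intersection curve, the discriminant is
nonzero and squarefree if and only if the net lies on a smooth quartic del Pezzo surface. -/
theorem disc_squarefree_iff_smooth_delPezzo (Λ : Submodule ℂ Quin) (hΛ : IsNet Λ)
    (Q1 Q2 Q3 : Quin) (hQ1 : Q1 ∈ Λ) (hQ2 : Q2 ∈ Λ) (hQ3 : Q3 ∈ Λ)
    (hli : LinearIndependent ℂ ![Q1, Q2, Q3])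
    (hspan : Submodule.span ℂ {Q1, Q2, Q3} = Λ)
    (hht : ∀ (P : Ideal Quin) (hP : P ∈ (Ideal.span {Q1, Q2, Q3}).minimalPrimes),
        Order.height (⟨P, hP.1.1⟩ : PrimeSpectrum Quin) = 3) :
    (netDisc Q1 Q2 Q3 ≠ 0 ∧ Squarefree (netDisc Q1 Q2 Q3)) ↔ OnSmoothDelPezzo Λ := by
  have hmem : ∀ i, ![Q1, Q2, Q3] i ∈ Λ := by
    intro i
    fin_cases i <;> assumption
  have hliΛ : LinearIndependent ℂ fun i => (⟨_, hmem i⟩ : Λ) :=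
    LinearIndependent.of_comp Λ.subtype hli
  have : FiniteDimensional ℂ Λ := Module.finite_of_finrank_pos (by rw [hΛ.1]; norm_num)
  obtain ⟨b, hb⟩ : ∃ b : Module.Basis (Fin 3) ℂ Λ, ∀ i, (b i : Quin) = ![Q1, Q2, Q3] i :=
    ⟨basisOfLinearIndependentOfCardEqFinrank hliΛ (by simp [hΛ.1]), fun i => by simp⟩
  have hdisc : netDisc Q1 Q2 Q3 = netDisc (b 0) (b 1) (b 2) := by simp [hb]
  rw [hdisc]
  constructor
  · exact fun h => onSmoothDelPezzo_of_squarefree_netDisc hΛ b h.2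
  · rintro ⟨P, Q, hP, hQ, hPQ, hsmooth⟩
    obtain ⟨t, ht, hsq⟩ := exists_squarefree_pencil_of_smooth (hΛ.2 P hP) (hΛ.2 Q hQ) hsmooth
    have hpair : LinearIndependent ℂ
        ![(⟨t • P + Q, Λ.add_mem (Λ.smul_mem t hP) hQ⟩ : Λ), ⟨P, hP⟩] := by
      rw [LinearIndependent.pair_iff] at hPQ ⊢
      intro r s hrs
      have hrs : r • (t • P + Q) + s • P = 0 := congrArg Subtype.val hrs
      obtain ⟨h1, h2⟩ := hPQ (r * t + s) r (by rw [← hrs]; module)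
      exact ⟨h2, by simpa [h2] using h1⟩
    obtain ⟨b', h0, h1⟩ := exists_basis_of_linearIndependent_pair hΛ.1 hpair
    have hb' : Squarefree (netDisc (b' 0) (b' 1) (b' 2)) := by
      rw [h0, h1]
      exact squarefree_netDisc_of_pencil ht P _ hsq
    have := squarefree_netDisc_of_basis b' b hb'
    exact ⟨this.ne_zero, this⟩
end
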